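/- arXiv:0911.4321 — 2 statements merged into one kernel-verified Lean document; each statement's English description precedes it below -/
import Mathlib

section
/- Let n ≥ 3, m ≥ 1, and let A be a constant positive definite symmetric m×m real matrix. Let q > (n+2)/n and set p = (n/2)(q-1). Suppose f = (f^1,…,f^m) : ℝ^m → ℝ^m is C^1 and satisfies |f^i(V)| ≤ C|V|^q and |∇f^i(V)| ≤ C|V|^{q-1} for all V ∈ ℝ^m and all i. Let K ⊂ ℝ^n be compact and let V : ℝ^n \ K → ℝ^m be a smooth solution of Σ_j A_{ij} ΔV_j = f^i(V) on ℝ^n \ K with V ∈ L^p(ℝ^n \ K). Then there exist constants C' > 0 and R > 0 such that |V(x)| ≤ C'|x|^{-(n-2)} and |∇V(x)| ≤ C'|x|^{-(n-1)} for all |x| ≥ R. -/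
open MeasureTheory Metric Finset Filter Asymptotics
open scoped RealInnerProductSpace

noncomputable section

/-- `pder u i x` is the partial derivative `Dᵢ u (x)` in the `i`-th coordinate direction. -/
def pder {n : ℕ} (u : EuclideanSpace ℝ (Fin n) → ℝ) (i : Fin n)
    (x : EuclideanSpace ℝ (Fin n)) : ℝ :=
  fderiv ℝ u x (EuclideanSpace.single i 1)

/-- The Euclidean Laplacian `Δu = ∑ i, D_i D_i u`. -/
def lap {n : ℕ} (u : EuclideanSpace ℝ (Fin n) → ℝ)
    (x : EuclideanSpace ℝ (Fin n)) : ℝ :=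
  ∑ i : Fin n, pder (pder u i) i x

/-- `|∇V|² = ∑_{l,j} (D_l V_j)²` for a vector-valued map `V`. -/
def gradNormSq {n m : ℕ}
    (V : EuclideanSpace ℝ (Fin n) → EuclideanSpace ℝ (Fin m))
    (x : EuclideanSpace ℝ (Fin n)) : ℝ :=
  ∑ l : Fin n, ∑ j : Fin m, (pder (fun y => V y j) l x) ^ 2

section PartialDerivatives

variable {n : ℕ} {v w : EuclideanSpace ℝ (Fin n) → ℝ} {x : EuclideanSpace ℝ (Fin n)}

lemma pder_add (hv : DifferentiableAt ℝ v x) (hw : DifferentiableAt ℝ w x) (i : Fin n) :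
    pder (fun y => v y + w y) i x = pder v i x + pder w i x := by
  simp [pder, fderiv_fun_add hv hw]

lemma pder_const_mul (hv : DifferentiableAt ℝ v x) (a : ℝ) (i : Fin n) :
    pder (fun y => a * v y) i x = a * pder v i x := by
  simp [pder, fderiv_const_mul hv]

lemma pder_eventuallyEq (h : v =ᶠ[nhds x] w) (i : Fin n) :
    pder v i =ᶠ[nhds x] pder w i := by
  filter_upwards [h.eventuallyEq_nhds] with y hy
  simp only [pder, hy.fderiv_eq]

lemma lap_congr (h : v =ᶠ[nhds x] w) : lap v x = lap w x :=
  Finset.sum_congr rfl fun i _ => (pder_eventuallyEq (pder_eventuallyEq h i) i).eq_of_nhds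

lemma contDiffAt_pder {k l : ℕ∞} (hkl : k + 1 ≤ l) (hv : ContDiffAt ℝ l v x) (i : Fin n) :
    ContDiffAt ℝ k (pder v i) x :=
  (hv.fderiv_right (m := k) (by exact_mod_cast hkl)).clm_apply contDiffAt_const

lemma contDiff_pder {k l : ℕ∞} (hkl : k + 1 ≤ l) (hv : ContDiff ℝ l v) (i : Fin n) :
    ContDiff ℝ k (pder v i) :=
  contDiff_iff_contDiffAt.2 fun _ => contDiffAt_pder hkl hv.contDiffAt i

lemma eventually_differentiableAt_of_contDiffAt_two (hv : ContDiffAt ℝ 2 v x) :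
    ∀ᶠ y in nhds x, DifferentiableAt ℝ v y :=
  (hv.eventually (by simp)).mono fun _ h => h.differentiableAt (by simp)

lemma differentiableAt_pder (hv : ContDiffAt ℝ 2 v x) (i : Fin n) :
    DifferentiableAt ℝ (pder v i) x :=
  (contDiffAt_pder (k := 1) (l := 2) (by norm_num) hv i).differentiableAt (by simp)

lemma lap_add (hv : ContDiffAt ℝ 2 v x) (hw : ContDiffAt ℝ 2 w x) :
    lap (fun y => v y + w y) x = lap v x + lap w x := by
  rw [lap, lap, lap, ← Finset.sum_add_distrib]
  refine Finset.sum_congr rfl fun i _ => ?_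
  rw [← pder_add (differentiableAt_pder hv i) (differentiableAt_pder hw i)]
  refine (pder_eventuallyEq ?_ i).eq_of_nhds
  filter_upwards [eventually_differentiableAt_of_contDiffAt_two hv,
    eventually_differentiableAt_of_contDiffAt_two hw] with y h1 h2
  exact pder_add h1 h2 i

lemma lap_const_mul (hv : ContDiffAt ℝ 2 v x) (a : ℝ) :
    lap (fun y => a * v y) x = a * lap v x := by
  rw [lap, lap, Finset.mul_sum]
  refine Finset.sum_congr rfl fun i _ => ?_
  rw [← pder_const_mul (differentiableAt_pder hv i)]
  refine (pder_eventuallyEq ?_ i).eq_of_nhds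
  filter_upwards [eventually_differentiableAt_of_contDiffAt_two hv] with y h1
  exact pder_const_mul h1 a i

lemma lap_sub (hv : ContDiffAt ℝ 2 v x) (hw : ContDiffAt ℝ 2 w x) :
    lap (fun y => v y - w y) x = lap v x - lap w x := by
  have h := lap_add hv (contDiffAt_const.mul hw : ContDiffAt ℝ 2 (fun y => (-1 : ℝ) * w y) x)
  rw [lap_const_mul hw] at h
  simpa [sub_eq_add_neg] using h

lemma lap_sum {ι : Type*} (s : Finset ι) {g : ι → EuclideanSpace ℝ (Fin n) → ℝ}
    (hg : ∀ j ∈ s, ContDiffAt ℝ 2 (g j) x) :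
    lap (fun y => ∑ j ∈ s, g j y) x = ∑ j ∈ s, lap (g j) x := by
  classical
  induction s using Finset.induction_on with
  | empty =>
    have h0 : ∀ i, pder (fun _ : EuclideanSpace ℝ (Fin n) => (0 : ℝ)) i = fun _ => 0 := by
      intro i; ext; simp [pder]
    simp [lap, h0]
  | insert a s ha ih =>
    simp only [Finset.sum_insert ha]
    rw [lap_add (hg a (by simp)) (ContDiffAt.sum fun j hj => hg j (by simp [hj])),
      ih fun j hj => hg j (by simp [hj])]

lemma deriv_deriv_nonpos_of_isLocalMax {g : ℝ → ℝ} {t : ℝ} (hg : ContinuousAt g t)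
    (h : IsLocalMax g t) : deriv (deriv g) t ≤ 0 := by
  by_contra! hpos
  have hmin := isLocalMin_of_deriv_deriv_pos hpos h.deriv_eq_zero hg
  have heq : g =ᶠ[nhds t] fun _ => g t := by
    filter_upwards [h, hmin] with s h1 h2
    exact le_antisymm h1 h2
  have : deriv (deriv g) t = 0 := by
    have h1 : deriv g =ᶠ[nhds t] fun _ => 0 := by
      filter_upwards [heq.eventuallyEq_nhds] with s hs
      rw [hs.deriv_eq]; simp
    rw [h1.deriv_eq]; simp
  linarith

lemma hasDerivAt_line (hv : DifferentiableAt ℝ v x) (i : Fin n) (y : EuclideanSpace ℝ (Fin n))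
    (t : ℝ) (hx : y + t • EuclideanSpace.single i 1 = x) :
    HasDerivAt (fun s : ℝ => v (y + s • EuclideanSpace.single i 1)) (pder v i x) t := by
  subst hx
  have h1 : HasDerivAt (fun s : ℝ => y + s • EuclideanSpace.single i (1 : ℝ))
      (EuclideanSpace.single i 1) t := by
    simpa using ((hasDerivAt_id t).smul_const (EuclideanSpace.single i (1 : ℝ))).const_add y
  exact hv.hasFDerivAt.comp_hasDerivAt t h1

/-- Second derivative test: the Laplacian is nonpositive at a local maximum. -/
lemma lap_nonpos_of_isLocalMax (hv : ContDiffAt ℝ 2 v x) (h : IsLocalMax v x) :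
    lap v x ≤ 0 := by
  refine Finset.sum_nonpos fun i _ => ?_
  set L : ℝ → EuclideanSpace ℝ (Fin n) := fun s => x + s • EuclideanSpace.single i 1 with hL
  have hL0 : L 0 = x := by simp [hL]
  have hLc : ContinuousAt L 0 := by fun_prop
  have hLt : Tendsto L (nhds 0) (nhds x) := by simpa [ContinuousAt, hL0] using hLc
  have h1 : deriv (fun s => v (L s)) =ᶠ[nhds 0] fun s => pder v i (L s) := by
    filter_upwards [hLt.eventually (eventually_differentiableAt_of_contDiffAt_two hv)] with s hs
    exact (hasDerivAt_line hs i x s rfl).deriv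
  have h2 : deriv (deriv fun s => v (L s)) 0 = pder (pder v i) i x := by
    rw [h1.deriv_eq]
    exact (hasDerivAt_line (differentiableAt_pder hv i) i x 0 hL0).deriv
  rw [← h2]
  refine deriv_deriv_nonpos_of_isLocalMax ?_ ?_
  · exact ContinuousAt.comp (by rw [hL0]; exact hv.continuousAt) hLc
  · have := hLt.eventually h
    simpa [IsLocalMax, IsMaxFilter, hL0] using this

lemma pder_comp_normSq {ψ : ℝ → ℝ} {ψ' : ℝ} (hψ : HasDerivAt ψ ψ' (‖x‖ ^ 2)) (i : Fin n) :
    HasFDerivAt (fun y : EuclideanSpace ℝ (Fin n) => ψ (‖y‖ ^ 2)) (ψ' • (2 • innerSL ℝ x)) x ∧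
    pder (fun y => ψ (‖y‖ ^ 2)) i x = 2 * x i * ψ' := by
  have h := hψ.comp_hasFDerivAt x (hasStrictFDerivAt_norm_sq x).hasFDerivAt
  refine ⟨h, ?_⟩
  have h' : fderiv ℝ (fun y : EuclideanSpace ℝ (Fin n) => ψ (‖y‖ ^ 2)) x = _ := h.fderiv
  rw [pder, h']
  simp [EuclideanSpace.inner_single_right]
  ring

lemma pder_coord (i : Fin n) : pder (fun y : EuclideanSpace ℝ (Fin n) => y i) i x = 1 := by
  have : HasFDerivAt (fun y : EuclideanSpace ℝ (Fin n) => y i)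
    (EuclideanSpace.proj (𝕜 := ℝ) i) x := (EuclideanSpace.proj (𝕜 := ℝ) i).hasFDerivAt
  rw [pder, this.fderiv]; simp

lemma pder_mul (hv : DifferentiableAt ℝ v x) (hw : DifferentiableAt ℝ w x) (i : Fin n) :
    pder (fun y => v y * w y) i x = v x * pder w i x + w x * pder v i x := by
  simp [pder, fderiv_fun_mul hv hw]

lemma differentiableAt_coord (i : Fin n) :
    DifferentiableAt ℝ (fun y : EuclideanSpace ℝ (Fin n) => y i) x :=
  (EuclideanSpace.proj (𝕜 := ℝ) i).differentiableAt

lemma norm_rpow_eq (β : ℝ) (y : EuclideanSpace ℝ (Fin n)) :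
    ‖y‖ ^ β = (‖y‖ ^ 2) ^ (β / 2) := by
  rw [← Real.rpow_natCast, ← Real.rpow_mul (norm_nonneg _)]
  congr 1; push_cast; ring

lemma contDiffAt_norm_rpow (hx : x ≠ 0) (β : ℝ) :
    ContDiffAt ℝ 2 (fun y : EuclideanSpace ℝ (Fin n) => ‖y‖ ^ β) x :=
  (contDiffAt_norm ℝ hx).rpow_const_of_ne (norm_ne_zero_iff.2 hx)

lemma pder_norm_rpow (hx : x ≠ 0) (β : ℝ) (i : Fin n) :
    pder (fun y => ‖y‖ ^ β) i x = β * (x i * ‖x‖ ^ (β - 2)) := by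
  have h0 : ‖x‖ ^ 2 ≠ 0 := by simpa using hx
  simp only [norm_rpow_eq β]
  rw [(pder_comp_normSq (Real.hasDerivAt_rpow_const (p := β / 2) (Or.inl h0)) i).2,
    norm_rpow_eq (β - 2), show (β - 2) / 2 = β / 2 - 1 by ring]
  ring

/-- The Laplacian of a power of the norm. -/
lemma lap_norm_rpow (hx : x ≠ 0) (β : ℝ) :
    lap (fun y => ‖y‖ ^ β) x = β * (β + n - 2) * ‖x‖ ^ (β - 2) := by
  have hx' : 0 < ‖x‖ := norm_pos_iff.2 hx
  have key : ∀ i : Fin n, pder (pder (fun y => ‖y‖ ^ β) i) i x =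
      β * ‖x‖ ^ (β - 2) + β * (β - 2) * ‖x‖ ^ (β - 4) * (x i) ^ 2 := by
    intro i
    have h1 : pder (fun y => ‖y‖ ^ β) i =ᶠ[nhds x]
        fun y => β * (y i * ‖y‖ ^ (β - 2)) := by
      filter_upwards [eventually_ne_nhds hx] with y hy
      exact pder_norm_rpow hy β i
    have hd := (contDiffAt_norm_rpow hx (β - 2)).differentiableAt (by simp)
    rw [(pder_eventuallyEq h1 i).eq_of_nhds,
      pder_const_mul (v := fun y => y i * ‖y‖ ^ (β - 2)) ((differentiableAt_coord i).mul hd),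
      pder_mul (differentiableAt_coord i) hd, pder_coord, pder_norm_rpow hx,
      show β - 2 - 2 = β - 4 by ring]
    ring
  have h4 : ‖x‖ ^ (β - 4) * ‖x‖ ^ 2 = ‖x‖ ^ (β - 2) := by
    rw [← Real.rpow_natCast, ← Real.rpow_add hx']; congr 1; push_cast; ring
  rw [lap, Finset.sum_congr rfl fun i _ => key i, Finset.sum_add_distrib, ← Finset.mul_sum _ _ (β * (β - 2) * _),
    ← EuclideanSpace.real_norm_sq_eq, mul_assoc _ (‖x‖ ^ (β - 4)), h4]
  simp
  ring

end PartialDerivatives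

section PolynomialKernel

/-- The radial kernel `(1 - |z|²)₊ ^ k`, supported in the closed unit ball. -/
def ballKernel {n : ℕ} (k : ℕ) (z : EuclideanSpace ℝ (Fin n)) : ℝ :=
  (max 0 (1 - ‖z‖ ^ 2)) ^ k

variable {n : ℕ}

lemma hasDerivAt_max_zero_pow (k : ℕ) (t : ℝ) :
    HasDerivAt (fun s : ℝ => (max 0 s) ^ (k + 2)) ((k + 2) * (max 0 t) ^ (k + 1)) t := by
  rcases lt_trichotomy t 0 with ht | rfl | ht
  · rw [max_eq_left ht.le]
    have h : (fun s : ℝ => (max 0 s) ^ (k + 2)) =ᶠ[nhds t] fun _ => 0 := by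
      filter_upwards [eventually_lt_nhds ht] with s hs
      simp [max_eq_left hs.le]
    simpa using (hasDerivAt_const t (0 : ℝ)).congr_of_eventuallyEq h
  · rw [hasDerivAt_iff_tendsto_slope]
    have hc : Tendsto (fun s : ℝ => (max 0 s) ^ (k + 1)) (nhdsWithin 0 {0}ᶜ) (nhds 0) := by
      have : ContinuousAt (fun s : ℝ => (max 0 s) ^ (k + 1)) 0 := by fun_prop
      have h2 := this.tendsto.mono_left (nhdsWithin_le_nhds (s := {0}ᶜ))
      simpa using h2
    simp only [max_self, ne_eq, Nat.add_eq_zero_iff, one_ne_zero, and_false, not_false_eq_true,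
      zero_pow, mul_zero]
    refine hc.congr' ?_
    filter_upwards [self_mem_nhdsWithin] with s hs
    have hs' : s ≠ 0 := hs
    rw [slope_def_field]
    rcases le_total s 0 with h | h
    · simp [max_eq_left h]
    · simp only [max_eq_right h, max_self]
      field_simp
      ring
  · rw [max_eq_right ht.le]
    have h : (fun s : ℝ => (max 0 s) ^ (k + 2)) =ᶠ[nhds t] fun s => s ^ (k + 2) := by
      filter_upwards [eventually_gt_nhds ht] with s hs
      simp [max_eq_right (le_of_lt hs)]
    simpa using (hasDerivAt_pow (k + 2) t).congr_of_eventuallyEq h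

lemma ballKernel_differentiable_pder (k : ℕ) (z : EuclideanSpace ℝ (Fin n)) (i : Fin n) :
    DifferentiableAt ℝ (ballKernel (n := n) (k + 2)) z ∧
    pder (ballKernel (n := n) (k + 2)) i z = -(2 * (k + 2)) * (z i * ballKernel (k + 1) z) := by
  have h1 : HasDerivAt (fun s : ℝ => (max 0 (1 - s)) ^ (k + 2))
      (-((k + 2) * (max 0 (1 - ‖z‖ ^ 2)) ^ (k + 1))) (‖z‖ ^ 2) := by
    have := (hasDerivAt_max_zero_pow k (1 - ‖z‖ ^ 2)).comp (‖z‖ ^ 2)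
      ((hasDerivAt_id (‖z‖ ^ 2)).const_sub 1)
    simpa [Function.comp_def] using this
  have h2 := pder_comp_normSq h1 i
  refine ⟨h2.1.differentiableAt, ?_⟩
  have h3 : pder (ballKernel (n := n) (k + 2)) i z = _ := h2.2
  rw [h3, ballKernel]
  ring

@[fun_prop]
lemma continuous_ballKernel (k : ℕ) : Continuous (ballKernel (n := n) k) := by
  unfold ballKernel; fun_prop

lemma ballKernel_nonneg (k : ℕ) (z : EuclideanSpace ℝ (Fin n)) : 0 ≤ ballKernel k z := by
  unfold ballKernel; positivity

lemma max_zero_one_sub_le_one (z : EuclideanSpace ℝ (Fin n)) : max 0 (1 - ‖z‖ ^ 2) ≤ 1 := by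
  have := sq_nonneg ‖z‖
  exact max_le zero_le_one (by linarith)

lemma ballKernel_le_one (k : ℕ) (z : EuclideanSpace ℝ (Fin n)) : ballKernel k z ≤ 1 :=
  pow_le_one₀ (le_max_left _ _) (max_zero_one_sub_le_one z)

lemma ballKernel_succ_le (k : ℕ) (z : EuclideanSpace ℝ (Fin n)) :
    ballKernel (k + 1) z ≤ ballKernel k z :=
  pow_le_pow_of_le_one (le_max_left _ _) (max_zero_one_sub_le_one z) (Nat.le_succ k)

lemma ballKernel_eq_zero {k : ℕ} (hk : k ≠ 0) {z : EuclideanSpace ℝ (Fin n)} (hz : 1 ≤ ‖z‖) :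
    ballKernel k z = 0 := by
  rw [ballKernel, max_eq_left (by nlinarith), zero_pow hk]

lemma hasCompactSupport_ballKernel {k : ℕ} (hk : k ≠ 0) :
    HasCompactSupport (ballKernel (n := n) k) := by
  refine HasCompactSupport.intro (isCompact_closedBall 0 1) fun z hz => ?_
  exact ballKernel_eq_zero hk (by simpa using (not_le.1 fun h => hz (by simpa using h)).le)

lemma integrable_mul_ballKernel {k : ℕ} (hk : k ≠ 0) {g : EuclideanSpace ℝ (Fin n) → ℝ}
    (hg : Continuous g) : Integrable fun z => g z * ballKernel k z :=
  (hg.mul (continuous_ballKernel k)).integrable_of_hasCompactSupport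
    (hasCompactSupport_ballKernel hk).mul_left

lemma integrable_ballKernel {k : ℕ} (hk : k ≠ 0) : Integrable (ballKernel (n := n) k) :=
  (continuous_ballKernel k).integrable_of_hasCompactSupport (hasCompactSupport_ballKernel hk)

lemma integral_ballKernel_pos {k : ℕ} (hk : k ≠ 0) :
    0 < ∫ z : EuclideanSpace ℝ (Fin n), ballKernel k z :=
  (continuous_ballKernel k).integral_pos_of_hasCompactSupport_nonneg_nonzero (x := 0)
    (hasCompactSupport_ballKernel hk) (ballKernel_nonneg k) (by simp [ballKernel])

/-- A function bounded by `S` on the unit ball has weighted integral at most `S ∫ ballKernel`. -/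
lemma abs_integral_mul_ballKernel_le {k : ℕ} (hk : k ≠ 0) {g : EuclideanSpace ℝ (Fin n) → ℝ}
    {S : ℝ} (hS : ∀ z, ‖z‖ ≤ 1 → |g z| ≤ S) :
    |∫ z, g z * ballKernel k z| ≤ S * ∫ z : EuclideanSpace ℝ (Fin n), ballKernel k z := by
  rw [← integral_const_mul, ← Real.norm_eq_abs]
  refine norm_integral_le_of_norm_le ((integrable_ballKernel hk).const_mul S) ?_
  refine Eventually.of_forall fun z => ?_
  rw [norm_mul, Real.norm_eq_abs, Real.norm_of_nonneg (ballKernel_nonneg k z)]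
  rcases le_total ‖z‖ 1 with h | h
  · exact mul_le_mul_of_nonneg_right (hS z h) (ballKernel_nonneg k z)
  · simp [ballKernel_eq_zero hk h]

/-- Integration by parts against the kernel. -/
lemma integral_pder_mul_ballKernel {g : EuclideanSpace ℝ (Fin n) → ℝ} (hg : ContDiff ℝ 1 g)
    (k : ℕ) (i : Fin n) :
    ∫ z, pder g i z * ballKernel (k + 2) z =
      2 * (k + 2) * ∫ z, g z * z i * ballKernel (k + 1) z := by
  have hd : ∀ z, fderiv ℝ (ballKernel (n := n) (k + 2)) z (EuclideanSpace.single i 1) =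
    -(2 * (k + 2)) * (z i * ballKernel (k + 1) z) :=
      fun z => (ballKernel_differentiable_pder k z i).2
  have hcoord : Continuous fun z : EuclideanSpace ℝ (Fin n) => z i := by fun_prop
  have hmul : ∀ z : EuclideanSpace ℝ (Fin n), g z * (-(2 * (k + 2)) * (z i * ballKernel (k + 1) z))
      = -(2 * (k + 2)) * (g z * z i * ballKernel (k + 1) z) := fun z => by ring
  have h := integral_mul_fderiv_eq_neg_fderiv_mul_of_integrable (𝕜 := ℝ)
    (μ := (volume : Measure (EuclideanSpace ℝ (Fin n))))
    (f := g) (g := ballKernel (k + 2)) (v := EuclideanSpace.single i 1)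
    (integrable_mul_ballKernel (by simp)
      ((contDiff_pder (k := 0) (l := 1) (by simp) hg i).continuous))
    (by simp_rw [hd, hmul]
        exact (integrable_mul_ballKernel (by simp) (hg.continuous.mul hcoord)).const_mul _)
    (integrable_mul_ballKernel (by simp) hg.continuous)
    (fun z _ => hg.differentiable (by simp) z)
    (fun z _ => (ballKernel_differentiable_pder k z i).1)
  simp_rw [hd, hmul] at h
  rw [integral_const_mul] at h
  simp only [pder]
  linarith

end PolynomialKernel

section MeanValue

variable {n : ℕ} {v : EuclideanSpace ℝ (Fin n) → ℝ}

lemma pder_comp_affine {g : EuclideanSpace ℝ (Fin n) → ℝ} {y z : EuclideanSpace ℝ (Fin n)} {r : ℝ}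
    (hg : DifferentiableAt ℝ g (y + r • z)) (i : Fin n) :
    pder (fun z => g (y + r • z)) i z = r * pder g i (y + r • z) := by
  have h1 : HasFDerivAt (fun z : EuclideanSpace ℝ (Fin n) => y + r • z)
      (r • ContinuousLinearMap.id ℝ _) z := ((hasFDerivAt_id z).const_smul r).const_add y
  have h2 : fderiv ℝ (fun z => g (y + r • z)) z = _ := (hg.hasFDerivAt.comp z h1).fderiv
  rw [pder, h2]
  simp [pder]

lemma fderiv_apply_eq_sum_pder (x z : EuclideanSpace ℝ (Fin n)) :
    fderiv ℝ v x z = ∑ i, pder v i x * z i := by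
  conv_lhs => rw [← (EuclideanSpace.basisFun (Fin n) ℝ).sum_repr z]
  simp [pder, mul_comm]

lemma contDiff_lap {k l : ℕ∞} (hkl : k + 2 ≤ l) (hv : ContDiff ℝ l v) : ContDiff ℝ k (lap v) := by
  have h2 : k + 1 + 1 ≤ l := by rw [add_assoc]; exact hkl
  exact ContDiff.sum fun i _ => contDiff_pder le_rfl (contDiff_pder h2 hv i) i

/-- The kernel mean over balls of radius `r` has derivative given by the mean of the Laplacian. -/
lemma hasDerivAt_kernelMean (hv : ContDiff ℝ 2 v) (y : EuclideanSpace ℝ (Fin n)) (r : ℝ) :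
    HasDerivAt (fun s : ℝ => ∫ z, v (y + s • z) * ballKernel 2 z)
      (r / 6 * ∫ z, lap v (y + r • z) * ballKernel 3 z) r := by
  have hv1 : Continuous fun x => fderiv ℝ v x := hv.continuous_fderiv (by simp)
  have hF' : Continuous fun a : ℝ × EuclideanSpace ℝ (Fin n) =>
      fderiv ℝ v (y + a.1 • a.2) a.2 := by fun_prop
  obtain ⟨B, hB⟩ := ((isCompact_closedBall r 1).prod
    (isCompact_closedBall (0 : EuclideanSpace ℝ (Fin n)) 1)).exists_bound_of_continuousOn
      hF'.continuousOn
  have hvc := hv.continuous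
  have key := (hasDerivAt_integral_of_dominated_loc_of_deriv_le (μ := volume)
    (F := fun (s : ℝ) (z : EuclideanSpace ℝ (Fin n)) => v (y + s • z) * ballKernel 2 z)
    (F' := fun (s : ℝ) (z : EuclideanSpace ℝ (Fin n)) =>
      fderiv ℝ v (y + s • z) z * ballKernel 2 z)
    (x₀ := r) (s := Metric.closedBall r 1) (bound := fun z => B * ballKernel 2 z)
    (Metric.closedBall_mem_nhds r one_pos)
    (Eventually.of_forall fun s => by
      refine Continuous.aestronglyMeasurable ?_
      fun_prop)
    (integrable_mul_ballKernel (by simp) (by fun_prop))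
    (by refine Continuous.aestronglyMeasurable ?_
        fun_prop)
    (Eventually.of_forall fun z s hs => by
      rw [norm_mul, Real.norm_of_nonneg (ballKernel_nonneg 2 z)]
      rcases le_total ‖z‖ 1 with h | h
      · exact mul_le_mul_of_nonneg_right (hB (s, z) ⟨hs, by simpa using h⟩) (ballKernel_nonneg 2 z)
      · simp [ballKernel_eq_zero two_ne_zero h])
    ((integrable_ballKernel two_ne_zero).const_mul B)
    (Eventually.of_forall fun z s _ => by
      have h1 : HasDerivAt (fun s : ℝ => y + s • z) z s := by
        simpa using ((hasDerivAt_id s).smul_const z).const_add y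
      exact (((hv.differentiable (by simp) _).hasFDerivAt).comp_hasDerivAt s h1).mul_const _)).2
  suffices heq : r / 6 * ∫ z, lap v (y + r • z) * ballKernel 3 z =
      ∫ z, fderiv ℝ v (y + r • z) z * ballKernel 2 z by
    rw [heq]
    exact key
  have hcg : ∀ i, ContDiff ℝ 1 fun z => pder v i (y + r • z) := fun i =>
    (contDiff_pder (k := 1) (l := 2) (by norm_num) hv i).comp (by fun_prop)
  have hpc : ∀ i, Continuous fun z => pder (fun z => pder v i (y + r • z)) i z := fun i =>
    (contDiff_pder (k := 0) (l := 1) (by simp) (hcg i) i).continuous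
  have h1 : ∀ i : Fin n, ∫ z, pder v i (y + r • z) * z i * ballKernel 2 z =
      1 / 6 * ∫ z, pder (fun z => pder v i (y + r • z)) i z * ballKernel 3 z := by
    intro i
    have h := integral_pder_mul_ballKernel (hcg i) 1 i
    norm_num at h
    rw [h]; ring
  have h2 : ∀ z : EuclideanSpace ℝ (Fin n), fderiv ℝ v (y + r • z) z * ballKernel 2 z =
      ∑ i, pder v i (y + r • z) * z i * ballKernel 2 z := fun z => by
    rw [fderiv_apply_eq_sum_pder, Finset.sum_mul]
  have h3 : ∀ z : EuclideanSpace ℝ (Fin n), r * (lap v (y + r • z) * ballKernel 3 z) =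
      ∑ i, pder (fun z => pder v i (y + r • z)) i z * ballKernel 3 z := fun z => by
    rw [lap, Finset.sum_mul, Finset.mul_sum]
    refine Finset.sum_congr rfl fun i _ => ?_
    rw [pder_comp_affine (differentiableAt_pder hv.contDiffAt i)]
    ring
  rw [integral_congr_ae (Eventually.of_forall h2)]
  have h4 : ∀ i ∈ Finset.univ, Integrable fun z : EuclideanSpace ℝ (Fin n) =>
      pder v i (y + r • z) * z i * ballKernel 2 z := fun i _ =>
    integrable_mul_ballKernel two_ne_zero
      ((hcg i).continuous.mul (by fun_prop : Continuous fun z : EuclideanSpace ℝ (Fin n) => z i))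
  rw [integral_finsetSum _ h4, Finset.sum_congr rfl fun i _ => h1 i,
    ← Finset.mul_sum, ← integral_finsetSum _ fun i _ =>
      integrable_mul_ballKernel three_ne_zero (hpc i),
    ← integral_congr_ae (Eventually.of_forall h3), integral_const_mul]
  ring

lemma kernelMean_zero (y : EuclideanSpace ℝ (Fin n)) :
    ∫ z, v (y + (0 : ℝ) • z) * ballKernel 2 z =
      v y * ∫ z : EuclideanSpace ℝ (Fin n), ballKernel 2 z := by
  simp [integral_const_mul]

/-- Mean value inequality with an error controlled by the Laplacian. -/
lemma abs_kernelMean_sub_le (hv : ContDiff ℝ 2 v) (y : EuclideanSpace ℝ (Fin n)) {ρ S : ℝ}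
    (hρ : 0 ≤ ρ) (hS : ∀ x ∈ Metric.closedBall y ρ, |lap v x| ≤ S) :
    |(∫ z, v (y + ρ • z) * ballKernel 2 z) -
      v y * ∫ z : EuclideanSpace ℝ (Fin n), ballKernel 2 z| ≤
      ρ ^ 2 * S * ∫ z : EuclideanSpace ℝ (Fin n), ballKernel 2 z := by
  set c := ∫ z : EuclideanSpace ℝ (Fin n), ballKernel 2 z with hc
  have hS0 : 0 ≤ S := (abs_nonneg _).trans (hS y (by simpa using hρ))
  have h3 : ∫ z : EuclideanSpace ℝ (Fin n), ballKernel 3 z ≤ c :=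
    integral_mono (integrable_ballKernel three_ne_zero) (integrable_ballKernel two_ne_zero)
      fun z => ballKernel_succ_le 2 z
  have hc0 : 0 ≤ c := (integral_ballKernel_pos two_ne_zero).le
  have hbd : ∀ r ∈ Set.Ico 0 ρ,
      ‖r / 6 * ∫ z, lap v (y + r • z) * ballKernel 3 z‖ ≤ ρ * S * c := by
    intro r hr
    rw [norm_mul, Real.norm_of_nonneg (by linarith [hr.1] : 0 ≤ r / 6), Real.norm_eq_abs]
    have h4 : |∫ z, lap v (y + r • z) * ballKernel 3 z| ≤ S * c := by
      refine (abs_integral_mul_ballKernel_le three_ne_zero (S := S) fun z hz => hS _ ?_).trans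
        (mul_le_mul_of_nonneg_left h3 hS0)
      rw [Metric.mem_closedBall, dist_self_add_left, norm_smul, Real.norm_of_nonneg hr.1]
      nlinarith [hr.1, hr.2, norm_nonneg z]
    calc r / 6 * _ ≤ ρ * (S * c) :=
          mul_le_mul (by linarith [hr.1, hr.2]) h4 (abs_nonneg _) hρ
      _ = _ := by ring
  have := norm_image_sub_le_of_norm_deriv_le_segment'
    (fun r _ => (hasDerivAt_kernelMean hv y r).hasDerivWithinAt) hbd ρ ⟨hρ, le_rfl⟩
  rw [kernelMean_zero, Real.norm_eq_abs] at this
  calc _ ≤ _ := this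
    _ = _ := by ring

lemma pder_comm (hv : ContDiff ℝ 2 v) (i l : Fin n) : pder (pder v i) l = pder (pder v l) i := by
  ext x
  have hd : DifferentiableAt ℝ (fderiv ℝ v) x :=
    (hv.fderiv_right (m := 1) (by norm_num)).differentiable (by simp) x
  have h : ∀ a b : Fin n, pder (pder v a) b x =
      fderiv ℝ (fderiv ℝ v) x (EuclideanSpace.single b 1) (EuclideanSpace.single a 1) := by
    intro a b
    have h1 : HasFDerivAt (fun x => fderiv ℝ v x (EuclideanSpace.single a 1)) _ x :=
      hd.hasFDerivAt.clm_apply (hasFDerivAt_const _ x)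
    have h2 : fderiv ℝ (pder v a) x = _ := h1.fderiv
    rw [pder, h2]
    simp
  rw [h, h]
  exact (hv.contDiffAt.isSymmSndFDerivAt (by simp)).eq _ _

lemma lap_pder (hv : ContDiff ℝ 3 v) (l : Fin n) : lap (pder v l) = pder (lap v) l := by
  ext x
  have h2 : ∀ i, ContDiff ℝ 2 (pder v i) :=
    fun i => contDiff_pder (k := 2) (l := 3) (by norm_num) hv i
  have hd : ∀ i, DifferentiableAt ℝ (pder (pder v i) i) x :=
    fun i => differentiableAt_pder (h2 i).contDiffAt i
  have h3 : pder (lap v) l x = ∑ i, pder (pder (pder v i) i) l x := by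
    have : fderiv ℝ (lap v) x = _ := fderiv_fun_sum (u := Finset.univ) fun i _ => hd i
    rw [pder, this]
    simp [pder]
  rw [h3, lap]
  refine Finset.sum_congr rfl fun i _ => ?_
  rw [pder_comm (hv.of_le (by norm_num)) l i, pder_comm (h2 i) l i]

lemma abs_coord_le_norm (z : EuclideanSpace ℝ (Fin n)) (l : Fin n) : |z l| ≤ ‖z‖ := by
  simpa using PiLp.norm_apply_le z l

/-- Interior gradient estimate. -/
lemma abs_pder_mul_le (hv : ContDiff ℝ 3 v) (y : EuclideanSpace ℝ (Fin n)) (l : Fin n)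
    {ρ S T : ℝ} (hρ : 0 < ρ) (hT : ∀ x ∈ Metric.closedBall y ρ, |v x| ≤ T)
    (hS : ∀ x ∈ Metric.closedBall y ρ, |lap v x| ≤ S) :
    |pder v l y| * ∫ z : EuclideanSpace ℝ (Fin n), ballKernel 2 z ≤
      4 * T / ρ * (∫ z : EuclideanSpace ℝ (Fin n), ballKernel 1 z) +
      ρ * S * ∫ z : EuclideanSpace ℝ (Fin n), ballKernel 2 z := by
  set c := ∫ z : EuclideanSpace ℝ (Fin n), ballKernel 2 z with hc
  have hp2 : ContDiff ℝ 2 (pder v l) := contDiff_pder (k := 2) (l := 3) (by norm_num) hv l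
  have hlap : ContDiff ℝ 1 (lap v) := contDiff_lap (k := 1) (l := 3) (by norm_num) hv
  have hmem : ∀ r : ℝ, 0 ≤ r → r ≤ ρ → ∀ z : EuclideanSpace ℝ (Fin n), ‖z‖ ≤ 1 →
      y + r • z ∈ Metric.closedBall y ρ := by
    intro r h0 h1 z hz
    rw [Metric.mem_closedBall, dist_self_add_left, norm_smul, Real.norm_of_nonneg h0]
    nlinarith [norm_nonneg z]
  have hcoord : ∀ {g : EuclideanSpace ℝ (Fin n) → ℝ} {B : ℝ}, (∀ z, ‖z‖ ≤ 1 → |g z| ≤ B) →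
      ∀ z : EuclideanSpace ℝ (Fin n), ‖z‖ ≤ 1 → |g z * z l| ≤ B := by
    intro g B hB z hz
    rw [abs_mul]
    have h1 := hB z hz
    have h2 := (abs_coord_le_norm z l).trans hz
    nlinarith [abs_nonneg (g z), abs_nonneg (z l)]
  have hbd : ∀ r ∈ Set.Ico 0 ρ,
      ‖r / 6 * ∫ z, lap (pder v l) (y + r • z) * ballKernel 3 z‖ ≤ S * c := by
    intro r hr
    have hg : ContDiff ℝ 1 fun z => lap v (y + r • z) := hlap.comp (by fun_prop)
    have h := integral_pder_mul_ballKernel hg 1 l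
    have h5 : r / 6 * ∫ z, lap (pder v l) (y + r • z) * ballKernel 3 z =
        ∫ z, lap v (y + r • z) * z l * ballKernel 2 z := by
      rw [lap_pder hv]
      simp_rw [pder_comp_affine (hlap.differentiable (by simp) _), mul_assoc r] at h
      rw [integral_const_mul] at h
      norm_num at h
      linarith
    rw [h5, Real.norm_eq_abs]
    exact abs_integral_mul_ballKernel_le two_ne_zero
      (hcoord fun z hz => hS _ (hmem r hr.1 hr.2.le z hz))
  have h1 := norm_image_sub_le_of_norm_deriv_le_segment'
    (fun r _ => (hasDerivAt_kernelMean hp2 y r).hasDerivWithinAt) hbd ρ ⟨hρ.le, le_rfl⟩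
  rw [kernelMean_zero, Real.norm_eq_abs, sub_zero] at h1
  have h2 : |∫ z, pder v l (y + ρ • z) * ballKernel 2 z| ≤
      4 * T / ρ * ∫ z : EuclideanSpace ℝ (Fin n), ballKernel 1 z := by
    have hg : ContDiff ℝ 1 fun z => v (y + ρ • z) := (hv.of_le (by norm_num)).comp (by fun_prop)
    have h := integral_pder_mul_ballKernel hg 0 l
    simp_rw [pder_comp_affine (hv.differentiable (by simp) _), mul_assoc ρ] at h
    rw [integral_const_mul] at h
    norm_num at h
    have h6 := abs_integral_mul_ballKernel_le one_ne_zero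
      (hcoord fun z hz => hT _ (hmem ρ hρ.le le_rfl z hz))
    have h7 : ∫ z, pder v l (y + ρ • z) * ballKernel 2 z =
        4 / ρ * ∫ z, v (y + ρ • z) * z l * ballKernel 1 z := by
      field_simp
      linarith
    rw [h7, abs_mul, abs_of_pos (by positivity)]
    calc _ ≤ 4 / ρ * (T * _) := mul_le_mul_of_nonneg_left h6 (by positivity)
      _ = _ := by ring
  have h3 : |pder v l y| * c = |pder v l y * c| := by
    rw [abs_mul, abs_of_pos (integral_ballKernel_pos two_ne_zero)]
  have h4 := abs_sub_abs_le_abs_sub (pder v l y * c)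
    (∫ z, pder v l (y + ρ • z) * ballKernel 2 z)
  rw [abs_sub_comm] at h4
  linarith

end MeanValue

section Comparison

variable {n m : ℕ} {u : EuclideanSpace ℝ (Fin n) → EuclideanSpace ℝ (Fin m)}

/-- Maximum principle in an exterior domain for a vector-valued function satisfying a differential
inequality, compared with a strict positive supersolution. -/
lemma norm_le_mul_of_strict_supersolution (hu : ContDiff ℝ 2 u) {R M : ℝ}
    {c h : EuclideanSpace ℝ (Fin n) → ℝ}
    (hc : ∀ x, R < ‖x‖ → ∀ e : EuclideanSpace ℝ (Fin m), ‖e‖ = 1 →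
      |lap (fun y => inner ℝ e (u y)) x| ≤ c x * ‖u x‖)
    (hh : ∀ x, R ≤ ‖x‖ → ContDiffAt ℝ 2 h x) (hpos : ∀ x, R ≤ ‖x‖ → 0 < h x)
    (hsup : ∀ x, R < ‖x‖ → lap h x < -(c x * h x)) (hM : 0 ≤ M)
    (hbd : ∀ x, ‖x‖ = R → ‖u x‖ ≤ M * h x)
    (hinf : ∀ ε > 0, ∃ R', ∀ x, R' ≤ ‖x‖ → ‖u x‖ ≤ ε * h x) (x : EuclideanSpace ℝ (Fin n))
    (hx : R ≤ ‖x‖) : ‖u x‖ ≤ M * h x := by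
  by_contra! hlt
  have hhx := hpos x hx
  have htx : M < ‖u x‖ / h x := by rwa [lt_div_iff₀ hhx]
  obtain ⟨R', hR'⟩ := hinf (‖u x‖ / h x) (hM.trans_lt htx)
  have hcomp : IsCompact {y : EuclideanSpace ℝ (Fin n) | R ≤ ‖y‖ ∧ ‖y‖ ≤ max R' ‖x‖} := by
    refine (isCompact_closedBall (0 : EuclideanSpace ℝ (Fin n)) (max R' ‖x‖)).of_isClosed_subset
      ((isClosed_le continuous_const continuous_norm).inter
        (isClosed_le continuous_norm continuous_const)) fun y hy => by simpa using hy.2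
  obtain ⟨z, hz, hzmax⟩ := hcomp.exists_isMaxOn (f := fun y => ‖u y‖ / h y)
    ⟨x, hx, le_max_right _ _⟩ (fun y hy => by
      refine ContinuousAt.continuousWithinAt ?_
      exact (hu.continuous.norm.continuousAt).div (hh y hy.1).continuousAt (hpos y hy.1).ne')
  have hxz : ‖u x‖ / h x ≤ ‖u z‖ / h z := hzmax ⟨hx, le_max_right _ _⟩
  set t := ‖u z‖ / h z with ht
  have hhz := hpos z hz.1
  have hMt : M < t := htx.trans_le hxz
  have hall : ∀ y, R ≤ ‖y‖ → ‖u y‖ ≤ t * h y := by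
    intro y hy
    rcases le_total ‖y‖ (max R' ‖x‖) with hy' | hy'
    · have := hzmax ⟨hy, hy'⟩
      rwa [Set.mem_ofPred_eq, div_le_iff₀ (hpos y hy)] at this
    · exact (hR' y ((le_max_left _ _).trans hy')).trans
        (mul_le_mul_of_nonneg_right hxz (hpos y hy).le)
  have huz : ‖u z‖ = t * h z := by rw [ht]; field_simp
  have hzR : R < ‖z‖ := by
    refine lt_of_le_of_ne hz.1 fun h => ?_
    have := hbd z h.symm
    rw [huz] at this
    nlinarith
  have huz0 : 0 < ‖u z‖ := by rw [huz]; exact mul_pos (hM.trans_lt hMt) hhz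
  set e : EuclideanSpace ℝ (Fin m) := ‖u z‖⁻¹ • u z with he
  have he1 : ‖e‖ = 1 := by
    rw [he, norm_smul, norm_inv, norm_norm, inv_mul_cancel₀ huz0.ne']
  have hez : inner ℝ e (u z) = ‖u z‖ := by
    rw [he, real_inner_smul_left, real_inner_self_eq_norm_sq]
    field_simp
  have hsm : ContDiffAt ℝ 2 (fun y => inner ℝ e (u y)) z :=
    contDiffAt_const.inner ℝ hu.contDiffAt
  have hmax : IsLocalMax (fun y => inner ℝ e (u y) - t * h y) z := by
    filter_upwards [(isOpen_lt continuous_const continuous_norm).mem_nhds hzR] with y hy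
    have h1 := real_inner_le_norm e (u y)
    rw [he1, one_mul] at h1
    have h2 := hall y (le_of_lt hy)
    rw [hez, huz]
    linarith
  have h1 := lap_nonpos_of_isLocalMax (hsm.sub (contDiffAt_const.mul (hh z hz.1))) hmax
  rw [lap_sub hsm (contDiffAt_const.mul (hh z hz.1)), lap_const_mul (hh z hz.1)] at h1
  have h2 := neg_le_of_abs_le (hc z hzR e he1)
  have h3 := mul_lt_mul_of_pos_left (hsup z hzR) (hM.trans_lt hMt)
  rw [huz] at h2
  nlinarith

/-- Comparison with a supersolution `h`, given decay faster than a slower supersolution `|x|^{-β}`. -/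
lemma exists_norm_le_mul_of_supersolution (hu : ContDiff ℝ 2 u) {R β : ℝ} (hR : 0 < R)
    {c h : EuclideanSpace ℝ (Fin n) → ℝ}
    (hc : ∀ x, R < ‖x‖ → ∀ e : EuclideanSpace ℝ (Fin m), ‖e‖ = 1 →
      |lap (fun y => inner ℝ e (u y)) x| ≤ c x * ‖u x‖)
    (hcβ : ∀ x, R < ‖x‖ → c x < β * (n - 2 - β) * ‖x‖ ^ (-2 : ℝ))
    (hh : ∀ x, R ≤ ‖x‖ → ContDiffAt ℝ 2 h x) (hpos : ∀ x, R ≤ ‖x‖ → 0 < h x)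
    (hsup : ∀ x, R < ‖x‖ → lap h x ≤ -(c x * h x))
    (hinf : ∀ ε > 0, ∃ R', ∀ x, R' ≤ ‖x‖ → ‖u x‖ ≤ ε * ‖x‖ ^ (-β)) :
    ∃ M, 0 ≤ M ∧ ∀ x, R ≤ ‖x‖ → ‖u x‖ ≤ M * h x := by
  have hne : ∀ x : EuclideanSpace ℝ (Fin n), R ≤ ‖x‖ → x ≠ 0 := fun x hx h0 => by
    rw [h0, norm_zero] at hx; linarith
  obtain ⟨B, hB⟩ := (isCompact_sphere (0 : EuclideanSpace ℝ (Fin n)) R).exists_bound_of_continuousOn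
    (f := fun y => ‖u y‖ / h y) (fun y hy => by
      have hy' : R ≤ ‖y‖ := by rw [mem_sphere_zero_iff_norm.1 hy]
      refine ContinuousAt.continuousWithinAt ?_
      exact (hu.continuous.norm.continuousAt).div (hh y hy').continuousAt (hpos y hy').ne')
  have hM : 0 ≤ max B 0 := le_max_right _ _
  refine ⟨max B 0, hM, fun x hx => ?_⟩
  set M := max B 0
  have hε : ∀ ε > 0, ‖u x‖ ≤ M * (h x + ε * ‖x‖ ^ (-β)) := by
    intro ε hε
    have hpp : ∀ y : EuclideanSpace ℝ (Fin n), R ≤ ‖y‖ → 0 < ‖y‖ ^ (-β) := fun y hy =>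
      Real.rpow_pos_of_pos (hR.trans_le hy) _
    refine norm_le_mul_of_strict_supersolution hu (h := fun y => h y + ε * ‖y‖ ^ (-β)) hc
      (fun y hy => (hh y hy).add (contDiffAt_const.mul (contDiffAt_norm_rpow (hne y hy) _)))
      (fun y hy => add_pos (hpos y hy) (mul_pos hε (hpp y hy))) ?_ hM ?_ ?_ x hx
    · intro y hy
      have hpw := contDiffAt_norm_rpow (hne y hy.le) (-β)
      rw [lap_add (hh y hy.le) (contDiffAt_const.mul hpw), lap_const_mul hpw,
        lap_norm_rpow (hne y hy.le)]
      have h1 := hsup y hy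
      have h2 : ‖y‖ ^ (-β - 2) = ‖y‖ ^ (-2 : ℝ) * ‖y‖ ^ (-β) := by
        rw [← Real.rpow_add (hR.trans hy)]; ring_nf
      have h3 := mul_lt_mul_of_pos_right (hcβ y hy) (mul_pos hε (hpp y hy.le))
      rw [h2]
      nlinarith
    · intro y hy
      have h1 := (le_abs_self _).trans (hB y (by simpa using hy))
      rw [div_le_iff₀ (hpos y hy.ge)] at h1
      have h2 : B * h y ≤ M * h y :=
        mul_le_mul_of_nonneg_right (le_max_left _ _) (hpos y hy.ge).le
      have h3 : 0 ≤ M * (ε * ‖y‖ ^ (-β)) := mul_nonneg hM (mul_pos hε (hpp y hy.ge)).le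
      linarith
    · intro δ hδ
      obtain ⟨R', hR'⟩ := hinf (δ * ε) (by positivity)
      refine ⟨max R R', fun y hy => (hR' y ((le_max_right _ _).trans hy)).trans ?_⟩
      have := hpos y ((le_max_left _ _).trans hy)
      nlinarith
  have hlim : Tendsto (fun ε : ℝ => M * (h x + ε * ‖x‖ ^ (-β))) (nhdsWithin 0 (Set.Ioi 0))
      (nhds (M * h x)) := by
    have : ContinuousAt (fun ε : ℝ => M * (h x + ε * ‖x‖ ^ (-β))) 0 := by fun_prop
    simpa using this.tendsto.mono_left (nhdsWithin_le_nhds (s := Set.Ioi 0))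
  exact ge_of_tendsto hlim (by filter_upwards [self_mem_nhdsWithin] with ε h using hε ε h)

/-- Improvement of subcritical decay to the decay rate of the fundamental solution. -/
lemma exists_norm_le_rpow_of_decay (hu : ContDiff ℝ 2 u) {q α C R₁ : ℝ} (hq : 1 < q)
    (hα : α = 2 / (q - 1)) (hαn : α < n - 2) (hC : 0 ≤ C)
    (hlap : ∀ x, R₁ ≤ ‖x‖ → ∀ e : EuclideanSpace ℝ (Fin m), ‖e‖ = 1 →
      |lap (fun y => inner ℝ e (u y)) x| ≤ C * ‖u x‖ ^ q)
    (hdecay : ∀ η > 0, ∃ R, ∀ x, R ≤ ‖x‖ → ‖u x‖ ≤ η * ‖x‖ ^ (-α)) :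
    ∃ M, 0 ≤ M ∧ ∃ R, ∀ x, R ≤ ‖x‖ → ‖u x‖ ≤ M * ‖x‖ ^ (-((n : ℝ) - 2)) := by
  have hq1 : 0 < q - 1 := by linarith
  have hα0 : 0 < α := by rw [hα]; positivity
  have hαq : α * (q - 1) = 2 := by rw [hα]; field_simp
  obtain ⟨β₁, hβ₁⟩ : ∃ β₁, β₁ = α / 2 := ⟨_, rfl⟩
  obtain ⟨β₂, hβ₂⟩ : ∃ β₂, β₂ = (α + (n - 2)) / 2 := ⟨_, rfl⟩
  have hκ₁ : 0 < β₁ * (n - 2 - β₁) := mul_pos (by linarith) (by linarith)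
  have hκ₂ : 0 < β₂ * (n - 2 - β₂) := mul_pos (by linarith) (by linarith)
  obtain ⟨κ, hκ0, hκ1, hκ2⟩ : ∃ κ > 0, κ < β₁ * (n - 2 - β₁) ∧ κ ≤ β₂ * (n - 2 - β₂) :=
    ⟨min (β₁ * (n - 2 - β₁) / 2) (β₂ * (n - 2 - β₂)), lt_min (by linarith) hκ₂,
      (min_le_left _ _).trans_lt (by linarith), min_le_right _ _⟩
  have hlap' : ∀ {r : ℝ} {B : ℝ}, ∀ x, R₁ ≤ ‖x‖ → 0 < ‖x‖ → 0 ≤ B → ‖u x‖ ≤ B * ‖x‖ ^ (-r) →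
      ∀ e : EuclideanSpace ℝ (Fin m), ‖e‖ = 1 →
      |lap (fun y => inner ℝ e (u y)) x| ≤
        C * B ^ (q - 1) * ‖x‖ ^ (-(r * (q - 1))) * ‖u x‖ := by
    intro r B x hx hx0 hB hux e he
    refine (hlap x hx e he).trans ?_
    have h1 : ‖u x‖ ^ q = ‖u x‖ ^ (q - 1) * ‖u x‖ := by
      conv_rhs => rw [← Real.rpow_one ‖u x‖, ← Real.rpow_mul (norm_nonneg _), one_mul,
        ← Real.rpow_add' (norm_nonneg _) (by linarith)]
      ring_nf
    have h2 : ‖u x‖ ^ (q - 1) ≤ B ^ (q - 1) * ‖x‖ ^ (-(r * (q - 1))) := by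
      refine (Real.rpow_le_rpow (norm_nonneg _) hux hq1.le).trans_eq ?_
      rw [Real.mul_rpow hB (by positivity), ← Real.rpow_mul (norm_nonneg _)]
      ring_nf
    calc C * ‖u x‖ ^ q ≤ C * (B ^ (q - 1) * ‖x‖ ^ (-(r * (q - 1))) * ‖u x‖) := by
          rw [h1]; gcongr
      _ = _ := by ring
  have hinf : ∀ ε > 0, ∃ R', ∀ x, R' ≤ ‖x‖ → ‖u x‖ ≤ ε * ‖x‖ ^ (-β₁) := by
    intro ε hε
    obtain ⟨R', hR'⟩ := hdecay ε hε
    refine ⟨max R' 1, fun x hx => (hR' x ((le_max_left _ _).trans hx)).trans ?_⟩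
    gcongr
    · exact (le_max_right _ _).trans hx
    · linarith
  obtain ⟨η, hη0, hη⟩ : ∃ η > 0, C * η ^ (q - 1) ≤ κ := by
    refine ⟨(κ / (C + 1)) ^ (q - 1)⁻¹, by positivity, ?_⟩
    rw [← Real.rpow_mul (by positivity), inv_mul_cancel₀ hq1.ne', Real.rpow_one]
    rw [mul_div_assoc', div_le_iff₀ (by linarith)]
    nlinarith
  obtain ⟨R', hR'⟩ := hdecay η hη0
  obtain ⟨R₂, hR₂1, hR₂R, hR₂R'⟩ : ∃ R₂ : ℝ, 1 ≤ R₂ ∧ R₁ ≤ R₂ ∧ R' ≤ R₂ :=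
    ⟨max 1 (max R₁ R'), le_max_left _ _, (le_max_left _ _).trans (le_max_right _ _),
      (le_max_right _ _).trans (le_max_right _ _)⟩
  have hne : ∀ x : EuclideanSpace ℝ (Fin n), R₂ ≤ ‖x‖ → x ≠ 0 := fun x hx h0 => by
    rw [h0, norm_zero] at hx; linarith
  obtain ⟨M, hM, hMu⟩ := exists_norm_le_mul_of_supersolution hu (R := R₂) (β := β₁)
    (c := fun x => κ * ‖x‖ ^ (-2 : ℝ)) (h := fun x => ‖x‖ ^ (-β₂)) (by linarith)
    (by
      intro x hx e he
      have hx0 : 0 < ‖x‖ := by linarith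
      refine (hlap' x (hR₂R.trans hx.le) hx0 hη0.le (hR' x (hR₂R'.trans hx.le)) e he).trans ?_
      rw [hαq]
      gcongr)
    (fun x hx => mul_lt_mul_of_pos_right hκ1 (Real.rpow_pos_of_pos (by linarith) _))
    (fun x hx => contDiffAt_norm_rpow (hne x hx) _)
    (fun x hx => Real.rpow_pos_of_pos (by linarith) _)
    (by
      intro x hx
      rw [lap_norm_rpow (hne x hx.le), mul_assoc κ, ← Real.rpow_add (by linarith),
        show -2 + -β₂ = -β₂ - 2 by ring]
      have : 0 < ‖x‖ ^ (-β₂ - 2) := Real.rpow_pos_of_pos (by linarith) _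
      nlinarith)
    hinf
  obtain ⟨s, hs⟩ : ∃ s, s = (β₂ - α) * (q - 1) := ⟨_, rfl⟩
  have hs0 : 0 < s := by rw [hs]; exact mul_pos (by linarith) hq1
  have hβ₂q : β₂ * (q - 1) = 2 + s := by rw [hs]; linarith
  obtain ⟨γ, hγ⟩ : ∃ γ, γ = (n : ℝ) - 2 + s / 2 := ⟨_, rfl⟩
  have hγ0 : 0 < γ := by linarith
  have hD : 0 ≤ C * M ^ (q - 1) := by positivity
  set D := C * M ^ (q - 1)
  obtain ⟨τ, hτ0, hτ1, hτ2⟩ : ∃ τ > 0, τ < β₁ * (n - 2 - β₁) ∧ τ ≤ γ * (s / 2) :=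
    ⟨min (β₁ * (n - 2 - β₁) / 2) (γ * (s / 2)), lt_min (by linarith) (by positivity),
      (min_le_left _ _).trans_lt (by linarith), min_le_right _ _⟩
  obtain ⟨R₃, hR₃⟩ : ∃ R₃ : ℝ, ∀ r, R₃ ≤ r → D * r ^ (-(s / 2)) ≤ τ := by
    have h1 := (tendsto_rpow_neg_atTop (half_pos hs0)).const_mul D
    rw [mul_zero] at h1
    obtain ⟨R₃, h⟩ := eventually_atTop.1 (h1.eventually (eventually_le_nhds hτ0))
    exact ⟨R₃, h⟩
  obtain ⟨R₄, hR₄1, hR₄2, hR₄3⟩ : ∃ R₄ : ℝ, 1 < R₄ ∧ R₂ ≤ R₄ ∧ R₃ ≤ R₄ :=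
    ⟨max 2 (max R₂ R₃), lt_of_lt_of_le (by norm_num) (le_max_left _ _),
      (le_max_left _ _).trans (le_max_right _ _), (le_max_right _ _).trans (le_max_right _ _)⟩
  have hne4 : ∀ x : EuclideanSpace ℝ (Fin n), R₄ ≤ ‖x‖ → x ≠ 0 := fun x hx =>
    hne x (hR₄2.trans hx)
  obtain ⟨M', hM', hMu'⟩ := exists_norm_le_mul_of_supersolution hu (R := R₄) (β := β₁)
    (c := fun x => D * ‖x‖ ^ (-(2 + s)))
    (h := fun x => ‖x‖ ^ (-((n : ℝ) - 2)) - ‖x‖ ^ (-γ)) (by linarith)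
    (by
      intro x hx e he
      have h1 : R₂ ≤ ‖x‖ := hR₄2.trans hx.le
      have h := hlap' x (hR₂R.trans h1) (by linarith) hM (hMu x h1) e he
      rwa [hβ₂q] at h)
    (by
      intro x hx
      have hx0 : 0 < ‖x‖ := by linarith
      have h1 : ‖x‖ ^ (-(2 + s)) ≤ ‖x‖ ^ (-(s / 2)) * ‖x‖ ^ (-2 : ℝ) := by
        rw [← Real.rpow_add hx0]
        exact Real.rpow_le_rpow_of_exponent_le (by linarith) (by linarith)
      have h2 := hR₃ ‖x‖ (hR₄3.trans hx.le)
      have h3 : 0 < ‖x‖ ^ (-2 : ℝ) := Real.rpow_pos_of_pos hx0 _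
      calc D * ‖x‖ ^ (-(2 + s)) ≤ D * (‖x‖ ^ (-(s / 2)) * ‖x‖ ^ (-2 : ℝ)) := by gcongr
        _ = D * ‖x‖ ^ (-(s / 2)) * ‖x‖ ^ (-2 : ℝ) := by ring
        _ < _ := mul_lt_mul_of_pos_right (h2.trans_lt hτ1) h3)
    (fun x hx => (contDiffAt_norm_rpow (hne4 x hx) _).sub (contDiffAt_norm_rpow (hne4 x hx) _))
    (fun x hx => sub_pos.2 (Real.rpow_lt_rpow_of_exponent_lt (by linarith) (by linarith)))
    (by
      intro x hx
      have hx0 : 0 < ‖x‖ := by linarith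
      rw [lap_sub (contDiffAt_norm_rpow (hne4 x hx.le) _) (contDiffAt_norm_rpow (hne4 x hx.le) _),
        lap_norm_rpow (hne4 x hx.le), lap_norm_rpow (hne4 x hx.le)]
      have h1 : ‖x‖ ^ (-(2 + s)) * ‖x‖ ^ (-((n : ℝ) - 2)) =
          ‖x‖ ^ (-(s / 2)) * ‖x‖ ^ (-γ - 2) := by
        rw [← Real.rpow_add hx0, ← Real.rpow_add hx0, hγ]; ring_nf
      have h2 := (hR₃ ‖x‖ (hR₄3.trans hx.le)).trans hτ2
      have h3 : 0 < ‖x‖ ^ (-γ - 2) := Real.rpow_pos_of_pos hx0 _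
      have h4 : 0 ≤ D * ‖x‖ ^ (-(2 + s)) * ‖x‖ ^ (-γ) := by positivity
      have h5 := mul_le_mul_of_nonneg_right h2 h3.le
      have h6 : s / 2 = γ - (n - 2) := by linarith
      have h7 : D * (‖x‖ ^ (-(2 + s)) * ‖x‖ ^ (-((n : ℝ) - 2))) ≤
          γ * (γ - (n - 2)) * ‖x‖ ^ (-γ - 2) := by
        rw [h1, ← mul_assoc, ← h6]; exact h5
      linarith)
    hinf
  refine ⟨M', hM', R₄, fun x hx => (hMu' x hx).trans ?_⟩
  gcongr
  have : 0 ≤ ‖x‖ ^ (-γ) := by positivity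
  linarith

end Comparison

section EpsilonRegularity

variable {n m : ℕ} {u : EuclideanSpace ℝ (Fin n) → EuclideanSpace ℝ (Fin m)}

lemma integral_comp_add_smul (g : EuclideanSpace ℝ (Fin n) → ℝ) (y : EuclideanSpace ℝ (Fin n))
    {ρ : ℝ} (hρ : 0 < ρ) : ∫ z, g (y + ρ • z) = (ρ ^ n)⁻¹ * ∫ z, g z := by
  have h := Measure.integral_comp_smul (volume : Measure (EuclideanSpace ℝ (Fin n)))
    (fun z => g (y + z)) ρ
  rw [h, integral_add_left_eq_self g y, finrank_euclideanSpace_fin, abs_of_pos (by positivity),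
    smul_eq_mul]

lemma integrable_comp_add_smul {g : EuclideanSpace ℝ (Fin n) → ℝ} (hg : Integrable g)
    (y : EuclideanSpace ℝ (Fin n)) {ρ : ℝ} (hρ : 0 < ρ) : Integrable fun z => g (y + ρ • z) :=
  (hg.comp_add_left y).comp_smul hρ.ne'

lemma le_add_rpow_mul_rpow {p a t : ℝ} (hp : 1 ≤ p) (ha : 0 ≤ a) (ht : 0 < t) :
    a ≤ t + t ^ (1 - p) * a ^ p := by
  rcases le_total a t with h | h
  · have : 0 ≤ t ^ (1 - p) * a ^ p := by positivity
    linarith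
  · have ha0 : 0 < a := ht.trans_le h
    have h1 : a ^ (1 - p) ≤ t ^ (1 - p) := Real.rpow_le_rpow_of_nonpos ht h (by linarith)
    have h2 : a ^ (1 - p) * a ^ p = a := by rw [← Real.rpow_add ha0]; simp
    have h3 : 0 ≤ a ^ p := by positivity
    nlinarith

/-- If the Laplacian is small compared to the value at the centre of a ball, this value is
controlled by the `L^p` mean. -/
lemma norm_rpow_mul_pow_le (hu : ContDiff ℝ 2 u) {p S ρ : ℝ} (hp : 1 ≤ p) (hρ : 0 < ρ)
    {y : EuclideanSpace ℝ (Fin n)} (huy : 0 < ‖u y‖)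
    (hS : ∀ e : EuclideanSpace ℝ (Fin m), ‖e‖ = 1 → ∀ x ∈ Metric.closedBall y ρ,
      |lap (fun y => inner ℝ e (u y)) x| ≤ S)
    (hSρ : ρ ^ 2 * S ≤ ‖u y‖ / 2) {g : EuclideanSpace ℝ (Fin n) → ℝ} (hg : Integrable g)
    (hg0 : ∀ x, 0 ≤ g x) (hgu : ∀ x ∈ Metric.closedBall y ρ, ‖u x‖ ^ p ≤ g x) :
    ‖u y‖ ^ p * ρ ^ n ≤
      4 ^ p / (∫ z : EuclideanSpace ℝ (Fin n), ballKernel 2 z) * ∫ x, g x := by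
  set N := ‖u y‖ with hN
  set c := ∫ z : EuclideanSpace ℝ (Fin n), ballKernel 2 z with hc
  have hc0 : 0 < c := integral_ballKernel_pos two_ne_zero
  set e : EuclideanSpace ℝ (Fin m) := N⁻¹ • u y with he
  have he1 : ‖e‖ = 1 := by rw [he, norm_smul, norm_inv, hN, norm_norm, inv_mul_cancel₀ huy.ne']
  have hey : inner ℝ e (u y) = N := by
    rw [he, real_inner_smul_left, real_inner_self_eq_norm_sq, ← hN]
    field_simp
  have hv : ContDiff ℝ 2 fun y => inner ℝ e (u y) := contDiff_const.inner ℝ hu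
  have h1 := (abs_le.1 (abs_kernelMean_sub_le hv y hρ.le (hS e he1))).1
  rw [hey, ← hc] at h1
  have hgi := integrable_comp_add_smul hg y hρ
  have h2 : ∫ z, inner ℝ e (u (y + ρ • z)) * ballKernel 2 z ≤
      N / 4 * c + (N / 4) ^ (1 - p) * ((ρ ^ n)⁻¹ * ∫ x, g x) := by
    rw [← integral_comp_add_smul g y hρ, hc, ← integral_const_mul, ← integral_const_mul,
      ← integral_add ((integrable_ballKernel two_ne_zero).const_mul _) (hgi.const_mul _)]
    have hvc : Continuous fun z => inner ℝ e (u (y + ρ • z)) :=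
      hv.continuous.comp (by fun_prop : Continuous fun z => y + ρ • z)
    refine integral_mono (integrable_mul_ballKernel two_ne_zero hvc)
      (((integrable_ballKernel two_ne_zero).const_mul _).add (hgi.const_mul _)) fun z => ?_
    have hpw : 0 ≤ (N / 4) ^ (1 - p) := by positivity
    rcases le_total ‖z‖ 1 with hz | hz
    · have hmem : y + ρ • z ∈ Metric.closedBall y ρ := by
        rw [Metric.mem_closedBall, dist_self_add_left, norm_smul, Real.norm_of_nonneg hρ.le]
        nlinarith
      have h3 := real_inner_le_norm e (u (y + ρ • z))
      rw [he1, one_mul] at h3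
      have h4 := le_add_rpow_mul_rpow hp (norm_nonneg (u (y + ρ • z))) (by positivity : 0 < N / 4)
      have h5 := mul_le_mul_of_nonneg_left (hgu _ hmem) hpw
      have h6 := mul_nonneg hpw (hg0 (y + ρ • z))
      have hk0 := ballKernel_nonneg 2 z
      have hk1 := ballKernel_le_one 2 z
      have h7 : inner ℝ e (u (y + ρ • z)) ≤ N / 4 + (N / 4) ^ (1 - p) * g (y + ρ • z) := by
        linarith
      calc _ ≤ (N / 4 + (N / 4) ^ (1 - p) * g (y + ρ • z)) * ballKernel 2 z :=
            mul_le_mul_of_nonneg_right h7 hk0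
        _ ≤ _ := by nlinarith
    · simp only [ballKernel_eq_zero two_ne_zero hz, mul_zero, zero_add]
      exact mul_nonneg hpw (hg0 _)
  have h3 : ρ ^ 2 * S * c ≤ N / 2 * c := mul_le_mul_of_nonneg_right hSρ hc0.le
  have h4 : N / 4 * c ≤ (N / 4) ^ (1 - p) * ((ρ ^ n)⁻¹ * ∫ x, g x) := by linarith
  have hN4 : 0 < N / 4 := by positivity
  have h5 := mul_le_mul_of_nonneg_left h4
    (by positivity : 0 ≤ (N / 4) ^ (p - 1) * ρ ^ n)
  have h6 : (N / 4) ^ (p - 1) * ρ ^ n * (N / 4 * c) = N ^ p / 4 ^ p * ρ ^ n * c := by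
    have : (N / 4) ^ (p - 1) * (N / 4) = N ^ p / 4 ^ p := by
      rw [← Real.div_rpow huy.le (by norm_num)]
      conv_lhs => rw [← Real.rpow_add_one hN4.ne', sub_add_cancel]
    rw [← this]; ring
  have h7 : (N / 4) ^ (p - 1) * ρ ^ n * ((N / 4) ^ (1 - p) * ((ρ ^ n)⁻¹ * ∫ x, g x)) =
      ∫ x, g x := by
    have : (N / 4) ^ (p - 1) * (N / 4) ^ (1 - p) = 1 := by
      rw [← Real.rpow_add hN4]; simp
    have hρn : ρ ^ n * (ρ ^ n)⁻¹ = 1 := mul_inv_cancel₀ (by positivity)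
    calc _ = ((N / 4) ^ (p - 1) * (N / 4) ^ (1 - p)) * (ρ ^ n * (ρ ^ n)⁻¹) * ∫ x, g x := by ring
      _ = _ := by rw [this, hρn]; ring
  rw [h6, h7] at h5
  have h8 : (0 : ℝ) < 4 ^ p := by positivity
  calc N ^ p * ρ ^ n = 4 ^ p / c * (N ^ p / 4 ^ p * ρ ^ n * c) := by field_simp
    _ ≤ _ := mul_le_mul_of_nonneg_left h5 (by positivity)

lemma exists_setIntegral_norm_ge_lt {g : EuclideanSpace ℝ (Fin n) → ℝ} {R₁ : ℝ}
    (hg : IntegrableOn g {x | R₁ ≤ ‖x‖}) {ε : ℝ} (hε : 0 < ε) :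
    ∃ R, R₁ ≤ R ∧ 1 ≤ R ∧ ∫ x in {x | R ≤ ‖x‖}, g x < ε := by
  have hmeas : ∀ R : ℝ, MeasurableSet {x : EuclideanSpace ℝ (Fin n) | R ≤ ‖x‖} := fun R =>
    (isClosed_le continuous_const continuous_norm).measurableSet
  have h := tendsto_setIntegral_of_antitone (μ := volume) (f := g)
    (s := fun k : ℕ => {x : EuclideanSpace ℝ (Fin n) | max R₁ k ≤ ‖x‖})
    (fun k => hmeas _) (fun i j hij x hx => by
      have : (i : ℝ) ≤ j := by exact_mod_cast hij
      exact (max_le_max_left R₁ this).trans hx)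
    ⟨0, hg.mono_set fun x hx => (le_max_left R₁ _).trans (Set.mem_ofPred_eq ▸ hx)⟩
  have hempty : (⋂ k : ℕ, {x : EuclideanSpace ℝ (Fin n) | max R₁ k ≤ ‖x‖}) = ∅ := by
    refine Set.eq_empty_of_forall_notMem fun x hx => ?_
    obtain ⟨k, hk⟩ := exists_nat_gt ‖x‖
    have := Set.mem_iInter.1 hx k
    exact absurd ((le_max_right _ _).trans this) (not_le.2 hk)
  rw [hempty, Measure.restrict_empty, integral_zero_measure] at h
  obtain ⟨k, hk, hk1⟩ := ((h.eventually (eventually_lt_nhds hε)).and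
    (eventually_ge_atTop 1)).exists
  exact ⟨max R₁ k, le_max_left _ _, le_max_of_le_right (by exact_mod_cast hk1), hk⟩

/-- Scale-invariant decay from critical integrability, by point selection. -/
lemma exists_norm_le_of_integrableOn (hu : ContDiff ℝ 2 u) {q p α C R₁ : ℝ} (hq : 1 < q)
    (hα : α = 2 / (q - 1)) (hpα : α * p = n) (hp : 1 ≤ p) (hC : 0 ≤ C)
    (hlap : ∀ x, R₁ ≤ ‖x‖ → ∀ e : EuclideanSpace ℝ (Fin m), ‖e‖ = 1 →
      |lap (fun y => inner ℝ e (u y)) x| ≤ C * ‖u x‖ ^ q)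
    (hint : IntegrableOn (fun x => ‖u x‖ ^ p) {x | R₁ ≤ ‖x‖}) {η : ℝ} (hη : 0 < η) :
    ∃ R, ∀ x, R ≤ ‖x‖ → ‖u x‖ ≤ η * ‖x‖ ^ (-α) := by
  have hq1 : 0 < q - 1 := by linarith
  have hα0 : 0 < α := by rw [hα]; positivity
  have hp0 : 0 < p := by linarith
  set c := 4 ^ p / ∫ z : EuclideanSpace ℝ (Fin n), ballKernel 2 z with hc
  have hc0 : 0 < c := div_pos (by positivity) (integral_ballKernel_pos two_ne_zero)
  obtain ⟨δ, hδ0, hδ⟩ : ∃ δ > 0, δ ^ 2 * (C * (2 ^ α) ^ q) ≤ 1 / 2 := by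
    have h0 : 0 ≤ C * (2 ^ α : ℝ) ^ q := by positivity
    refine ⟨Real.sqrt (1 / 2 / (C * (2 ^ α) ^ q + 1)), Real.sqrt_pos.2 (by positivity), ?_⟩
    rw [Real.sq_sqrt (by positivity), div_mul_eq_mul_div, div_le_iff₀ (by positivity)]
    linarith
  obtain ⟨ε, hε0, hεδ, hεη⟩ : ∃ ε > 0, c * ε < δ ^ n ∧ 4 ^ n * (c * ε) ≤ η ^ p := by
    refine ⟨min (δ ^ n / (2 * c)) (η ^ p / (4 ^ n * c)), lt_min (by positivity) (by positivity),
      ?_, ?_⟩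
    · calc c * _ ≤ c * (δ ^ n / (2 * c)) := by gcongr; exact min_le_left _ _
        _ = δ ^ n / 2 := by field_simp
        _ < δ ^ n := half_lt_self (by positivity)
    · calc _ ≤ 4 ^ n * (c * (η ^ p / (4 ^ n * c))) := by gcongr; exact min_le_right _ _
        _ = η ^ p := by field_simp
  obtain ⟨R, hR₁, hR1, hRε⟩ := exists_setIntegral_norm_ge_lt hint hε0
  have hmeas : MeasurableSet {x : EuclideanSpace ℝ (Fin n) | R ≤ ‖x‖} :=
    (isClosed_le continuous_const continuous_norm).measurableSet
  set g : EuclideanSpace ℝ (Fin n) → ℝ :=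
    Set.indicator {x | R ≤ ‖x‖} fun x => ‖u x‖ ^ p with hgdef
  have hgi : Integrable g :=
    (hint.mono_set fun x (hx : R ≤ ‖x‖) => hR₁.trans hx).integrable_indicator hmeas
  have hg0 : ∀ x, 0 ≤ g x := fun x => Set.indicator_nonneg (fun y _ => by positivity) x
  have hgε : ∫ x, g x < ε := by rwa [hgdef, integral_indicator hmeas]
  refine ⟨2 * R, fun x hx => ?_⟩
  have hx0 : 0 < ‖x‖ := by linarith
  set r := ‖x‖ / 2 with hr
  have hr0 : 0 < r := by positivity
  rcases (norm_nonneg (u x)).eq_or_lt with hux | hux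
  · rw [← hux]; positivity
  obtain ⟨y, hy, hymax⟩ := (isCompact_closedBall x r).exists_isMaxOn
    (f := fun y => (r - dist y x) ^ α * ‖u y‖) ⟨x, by simpa using hr0.le⟩
    (Continuous.continuousOn
      (((continuous_const.sub (continuous_id.dist continuous_const)).rpow_const
        fun _ => Or.inr hα0.le).mul hu.continuous.norm))
  obtain ⟨s, hs⟩ : ∃ s, s = r - dist y x := ⟨_, rfl⟩
  have hs0' : 0 ≤ s := by rw [hs]; exact sub_nonneg.2 hy
  have hFx : r ^ α * ‖u x‖ ≤ s ^ α * ‖u y‖ := by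
    have := hymax (Metric.mem_closedBall_self hr0.le)
    simpa [← hs] using this
  have hFpos : 0 < s ^ α * ‖u y‖ := lt_of_lt_of_le (by positivity) hFx
  have hs0 : 0 < s := by
    refine lt_of_le_of_ne hs0' fun h => ?_
    rw [← h, Real.zero_rpow hα0.ne', zero_mul] at hFpos
    exact lt_irrefl _ hFpos
  have hN0 : 0 < ‖u y‖ := by
    refine lt_of_le_of_ne (norm_nonneg _) fun h => ?_
    rw [← h, mul_zero] at hFpos
    exact lt_irrefl _ hFpos
  set N := ‖u y‖ with hN
  have hball : ∀ z ∈ Metric.closedBall y (s / 2), R ≤ ‖z‖ ∧ ‖u z‖ ≤ 2 ^ α * N := by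
    intro z hz
    have hz1 : dist z x ≤ r - s / 2 := by
      have := dist_triangle z y x
      have h2 : dist z y ≤ s / 2 := hz
      linarith
    constructor
    · have h3 := norm_sub_norm_le x z
      rw [← dist_eq_norm, dist_comm] at h3
      linarith
    · have h3 : (r - dist z x) ^ α * ‖u z‖ ≤ s ^ α * N := by
        have := hymax (show z ∈ Metric.closedBall x r by
          rw [Metric.mem_closedBall]; linarith)
        simpa [← hs] using this
      have h4 : (s / 2) ^ α * ‖u z‖ ≤ s ^ α * N := by
        refine le_trans ?_ h3
        gcongr
        linarith
      have h5 : s ^ α = (s / 2) ^ α * 2 ^ α := by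
        rw [← Real.mul_rpow (by positivity) (by norm_num)]; congr 1; ring
      rw [h5, mul_assoc] at h4
      exact le_of_mul_le_mul_left h4 (by positivity)
  have hαq : 2 / α = q - 1 := by rw [hα]; field_simp
  have main : ∀ ρ, 0 < ρ → ρ ≤ s / 2 → ρ ≤ δ * N ^ (-(1 / α)) → N ^ p * ρ ^ n ≤ c * ε := by
    intro ρ hρ hρs hρδ
    have hb : ∀ z ∈ Metric.closedBall y ρ, R ≤ ‖z‖ ∧ ‖u z‖ ≤ 2 ^ α * N := fun z hz =>
      hball z (Metric.closedBall_subset_closedBall hρs hz)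
    refine (norm_rpow_mul_pow_le hu (S := C * (2 ^ α * N) ^ q) hp hρ hN0 ?_ ?_ hgi hg0 ?_).trans
      (mul_le_mul_of_nonneg_left hgε.le hc0.le)
    · intro e he z hz
      refine (hlap z (hR₁.trans (hb z hz).1) e he).trans ?_
      have := (hb z hz).2
      gcongr
    · have h1 : ρ ^ 2 ≤ δ ^ 2 * N ^ (-(q - 1)) := by
        have h2 : ρ ^ 2 ≤ (δ * N ^ (-(1 / α))) ^ 2 := by gcongr
        refine h2.trans_eq ?_
        rw [mul_pow, ← Real.rpow_natCast (N ^ _), ← Real.rpow_mul hN0.le, ← hαq]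
        congr 2; push_cast; ring
      have h3 : N ^ (-(q - 1)) * N ^ q = N := by
        rw [← Real.rpow_add hN0]; ring_nf; simp
      calc ρ ^ 2 * (C * (2 ^ α * N) ^ q) ≤ δ ^ 2 * N ^ (-(q - 1)) * (C * (2 ^ α * N) ^ q) := by
            gcongr
        _ = δ ^ 2 * (C * (2 ^ α) ^ q) * (N ^ (-(q - 1)) * N ^ q) := by
            rw [Real.mul_rpow (by positivity) hN0.le]; ring
        _ ≤ 1 / 2 * N := by rw [h3]; gcongr
        _ = N / 2 := by ring
    · intro z hz
      rw [hgdef, Set.indicator_of_mem (show z ∈ {x | R ≤ ‖x‖} from (hb z hz).1)]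
  have hcase : s / 2 ≤ δ * N ^ (-(1 / α)) := by
    by_contra! hlt
    have h1 := main _ (by positivity) hlt.le le_rfl
    have h2 : N ^ p * (δ * N ^ (-(1 / α))) ^ n = δ ^ n := by
      rw [mul_pow, ← Real.rpow_natCast (N ^ _), ← Real.rpow_mul hN0.le, mul_left_comm,
        ← Real.rpow_add hN0]
      have : p + -(1 / α) * n = 0 := by rw [← hpα]; field_simp; ring
      rw [this]; simp
    linarith
  have h1 := main _ (by positivity) le_rfl hcase
  have hrpow : ∀ t : ℝ, 0 ≤ t → (t ^ α) ^ p = t ^ n := fun t ht => by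
    rw [← Real.rpow_mul ht, hpα, Real.rpow_natCast]
  have h2 : (r ^ α * ‖u x‖) ^ p ≤ 2 ^ n * (c * ε) := by
    calc (r ^ α * ‖u x‖) ^ p ≤ (s ^ α * N) ^ p := by gcongr
      _ = 2 ^ n * (N ^ p * (s / 2) ^ n) := by
          rw [Real.mul_rpow (by positivity) hN0.le, hrpow s hs0', div_pow]; field_simp
      _ ≤ _ := by gcongr
  have h3 : (‖x‖ ^ α * ‖u x‖) ^ p ≤ η ^ p := by
    calc (‖x‖ ^ α * ‖u x‖) ^ p = 2 ^ n * (r ^ α * ‖u x‖) ^ p := by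
          rw [Real.mul_rpow (by positivity) hux.le, Real.mul_rpow (by positivity) hux.le,
            hrpow _ hx0.le, hrpow _ hr0.le, hr, div_pow]
          field_simp
      _ ≤ 2 ^ n * (2 ^ n * (c * ε)) := by gcongr
      _ = 4 ^ n * (c * ε) := by rw [← mul_assoc, ← mul_pow]; norm_num
      _ ≤ _ := hεη
  have h4 : ‖x‖ ^ α * ‖u x‖ ≤ η := (Real.rpow_le_rpow_iff (by positivity) hη.le hp0).1 h3
  rw [Real.rpow_neg hx0.le, ← div_eq_mul_inv, le_div_iff₀ (by positivity)]
  linarith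

end EpsilonRegularity

section Reduction

variable {n m : ℕ}

/-- A function smooth outside a compact set agrees near infinity with a globally smooth one. -/
lemma exists_contDiff_eventuallyEq {K : Set (EuclideanSpace ℝ (Fin n))} (hK : IsCompact K)
    {V : EuclideanSpace ℝ (Fin n) → EuclideanSpace ℝ (Fin m)}
    (hV : ContDiffOn ℝ (⊤ : ℕ∞) V Kᶜ) :
    ∃ u : EuclideanSpace ℝ (Fin n) → EuclideanSpace ℝ (Fin m), ContDiff ℝ (⊤ : ℕ∞) u ∧
      ∃ R : ℝ, ∀ x, R ≤ ‖x‖ → x ∈ Kᶜ ∧ u =ᶠ[nhds x] V := by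
  obtain ⟨R, hR0, hR⟩ := hK.isBounded.subset_closedBall_lt 0 0
  let b : ContDiffBump (0 : EuclideanSpace ℝ (Fin n)) := ⟨R + 1, R + 2, by linarith, by linarith⟩
  have hKc : ∀ x : EuclideanSpace ℝ (Fin n), R < ‖x‖ → x ∈ Kᶜ := fun x hx hxK => by
    have := hR hxK
    rw [mem_closedBall_zero_iff] at this
    linarith
  refine ⟨fun x => (1 - b x) • V x, contDiff_iff_contDiffAt.2 fun x => ?_, R + 3, fun x hx => ?_⟩
  · rcases lt_or_ge R ‖x‖ with hx | hx
    · exact (contDiffAt_const.sub b.contDiff.contDiffAt).smul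
        (hV.contDiffAt (hK.isClosed.isOpen_compl.mem_nhds (hKc x hx)))
    · refine (contDiffAt_const (c := (0 : EuclideanSpace ℝ (Fin m)))).congr_of_eventuallyEq ?_
      filter_upwards [Metric.isOpen_ball.mem_nhds
        (show x ∈ Metric.ball (0 : EuclideanSpace ℝ (Fin n)) (R + 1) by
          rw [mem_ball_zero_iff]; linarith)] with y hy
      rw [b.one_of_mem_closedBall (Metric.ball_subset_closedBall hy), sub_self, zero_smul]
  · refine ⟨hKc x (by linarith), ?_⟩
    filter_upwards [(isOpen_lt continuous_const continuous_norm).mem_nhds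
      (show R + 2 < ‖x‖ by linarith)] with y hy
    rw [b.zero_of_le_dist (by rw [dist_zero_right]; exact le_of_lt hy), sub_zero, one_smul]

variable {u : EuclideanSpace ℝ (Fin n) → EuclideanSpace ℝ (Fin m)}

lemma abs_lap_inner_le (hu : ContDiff ℝ 2 u) {A : Matrix (Fin m) (Fin m) ℝ} (hA : A.PosDef)
    {F : Fin m → ℝ} {B : ℝ} (hF : ∀ i, |F i| ≤ B) {x : EuclideanSpace ℝ (Fin n)}
    (hsol : ∀ i, ∑ j, A i j * lap (fun y => u y j) x = F i)
    {e : EuclideanSpace ℝ (Fin m)} (he : ‖e‖ = 1) :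
    |lap (fun y => inner ℝ e (u y)) x| ≤ (∑ i, ∑ j, |A⁻¹ i j|) * B := by
  have hcomp : ∀ j, ContDiff ℝ 2 fun y => u y j := fun j =>
    (EuclideanSpace.proj (𝕜 := ℝ) j : EuclideanSpace ℝ (Fin m) →L[ℝ] ℝ).contDiff.comp hu
  have h1 : lap (fun y => inner ℝ e (u y)) x = ∑ i, e i * lap (fun y => u y i) x := by
    have : (fun y => inner ℝ e (u y)) = fun y => ∑ i, e i * u y i := by
      ext y
      simp [PiLp.inner_apply, mul_comm]
    rw [this, lap_sum _ fun i _ => contDiffAt_const.mul (hcomp i).contDiffAt]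
    exact Finset.sum_congr rfl fun i _ => lap_const_mul (hcomp i).contDiffAt _
  have h2 : (fun i => lap (fun y => u y i) x) = A⁻¹.mulVec F := by
    have h : A.mulVec (fun i => lap (fun y => u y i) x) = F := by
      ext i; exact hsol i
    rw [← h, Matrix.mulVec_mulVec, Matrix.nonsing_inv_mul _ hA.det_pos.ne'.isUnit,
      Matrix.one_mulVec]
  rw [h1, Finset.sum_mul]
  refine (Finset.abs_sum_le_sum_abs _ _).trans (Finset.sum_le_sum fun i _ => ?_)
  have h3 : lap (fun y => u y i) x = ∑ j, A⁻¹ i j * F j := congrFun h2 i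
  rw [abs_mul, h3, Finset.sum_mul]
  have h4 : |e i| ≤ 1 := (abs_coord_le_norm e i).trans_eq he
  calc |e i| * |∑ j, A⁻¹ i j * F j| ≤ 1 * |∑ j, A⁻¹ i j * F j| := by gcongr
    _ ≤ ∑ j, |A⁻¹ i j * F j| := by rw [one_mul]; exact Finset.abs_sum_le_sum_abs _ _
    _ ≤ _ := Finset.sum_le_sum fun j _ => by
      rw [abs_mul]
      exact mul_le_mul_of_nonneg_left (hF j) (abs_nonneg _)

/-- Decay of the gradient from decay of the function. -/
lemma exists_abs_pder_le (hu : ContDiff ℝ 3 u) {q α C M R : ℝ} (hq : 1 < q)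
    (hα : α = 2 / (q - 1)) (hC : 0 ≤ C) (hM : 0 ≤ M) (hR : 0 < R)
    (hlap : ∀ x, R ≤ ‖x‖ → ∀ e : EuclideanSpace ℝ (Fin m), ‖e‖ = 1 →
      |lap (fun y => inner ℝ e (u y)) x| ≤ C * ‖u x‖ ^ q)
    (hdecay : ∀ x, R ≤ ‖x‖ → ‖u x‖ ≤ ‖x‖ ^ (-α))
    (hM' : ∀ x, R ≤ ‖x‖ → ‖u x‖ ≤ M * ‖x‖ ^ (-((n : ℝ) - 2))) (hn : 3 ≤ n) :
    ∃ B, 0 ≤ B ∧ ∀ x, 2 * R ≤ ‖x‖ → ∀ l j,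
      |pder (fun y => u y j) l x| ≤ B * ‖x‖ ^ (-((n : ℝ) - 1)) := by
  have hn' : (3 : ℝ) ≤ n := by exact_mod_cast hn
  have hq1 : 0 < q - 1 := by linarith
  have hαq : α * (q - 1) = 2 := by rw [hα]; field_simp
  set c := ∫ z : EuclideanSpace ℝ (Fin n), ballKernel 2 z with hc
  have hc0 : 0 < c := integral_ballKernel_pos two_ne_zero
  set c₁ := ∫ z : EuclideanSpace ℝ (Fin n), ballKernel 1 z with hc₁
  have hc₁0 : 0 < c₁ := integral_ballKernel_pos one_ne_zero
  refine ⟨(4 * M * c₁ + C * M * c) / c * 2 ^ ((n : ℝ) - 1), by positivity, fun x hx l j => ?_⟩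
  have hx0 : 0 < ‖x‖ := by linarith
  obtain ⟨ρ, hρ⟩ : ∃ ρ, ρ = ‖x‖ / 2 := ⟨_, rfl⟩
  have hρ0 : 0 < ρ := by rw [hρ]; positivity
  set e : EuclideanSpace ℝ (Fin m) := EuclideanSpace.single j 1 with he
  have he1 : ‖e‖ = 1 := by simp [he]
  have hue : (fun y => u y j) = fun y => inner ℝ e (u y) := by
    ext y; simp [he, EuclideanSpace.inner_single_left]
  have hv : ContDiff ℝ 3 fun y => u y j := by
    rw [hue]; exact contDiff_const.inner ℝ hu
  have hball : ∀ y ∈ Metric.closedBall x ρ, ρ ≤ ‖y‖ := by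
    intro y hy
    have h3 := norm_sub_norm_le x y
    rw [← dist_eq_norm, dist_comm] at h3
    have h4 : dist y x ≤ ρ := hy
    linarith
  have hT : ∀ y ∈ Metric.closedBall x ρ, ‖u y‖ ≤ M * ρ ^ (-((n : ℝ) - 2)) := by
    intro y hy
    refine (hM' y (by linarith [hball y hy])).trans ?_
    exact mul_le_mul_of_nonneg_left
      (Real.rpow_le_rpow_of_nonpos hρ0 (hball y hy) (by linarith)) hM
  have hS : ∀ y ∈ Metric.closedBall x ρ,
      |lap (fun y => u y j) y| ≤ C * (ρ ^ (-2 : ℝ) * (M * ρ ^ (-((n : ℝ) - 2)))) := by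
    intro y hy
    have hy1 := hball y hy
    have hyR : R ≤ ‖y‖ := by linarith
    rw [hue]
    refine (hlap y hyR e he1).trans ?_
    have h1 : ‖u y‖ ^ q = ‖u y‖ ^ (q - 1) * ‖u y‖ := by
      conv_rhs => rw [← Real.rpow_one ‖u y‖, ← Real.rpow_mul (norm_nonneg _), one_mul,
        ← Real.rpow_add' (norm_nonneg _) (by linarith)]
      ring_nf
    have h2 : ‖u y‖ ^ (q - 1) ≤ ρ ^ (-2 : ℝ) := by
      refine (Real.rpow_le_rpow (norm_nonneg _) (hdecay y hyR) hq1.le).trans ?_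
      rw [← Real.rpow_mul (norm_nonneg _), neg_mul, hαq]
      exact Real.rpow_le_rpow_of_nonpos hρ0 hy1 (by norm_num)
    rw [h1]
    exact mul_le_mul_of_nonneg_left
      (mul_le_mul h2 (hT y hy) (norm_nonneg _) (by positivity)) hC
  have key := abs_pder_mul_le hv x l hρ0
    (fun y hy => (abs_coord_le_norm (u y) j).trans (hT y hy)) hS
  rw [← hc, ← hc₁] at key
  have h5 : ρ ^ (-((n : ℝ) - 2)) = ρ * ρ ^ (-((n : ℝ) - 1)) := by
    conv_rhs => rw [mul_comm, ← Real.rpow_add_one hρ0.ne']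
    ring_nf
  have h6 : ρ * ρ ^ (-2 : ℝ) * ρ = 1 := by
    rw [Real.rpow_neg hρ0.le, Real.rpow_two]; field_simp
  have h7 : ρ ^ (-((n : ℝ) - 1)) = ‖x‖ ^ (-((n : ℝ) - 1)) * 2 ^ ((n : ℝ) - 1) := by
    rw [hρ, Real.div_rpow hx0.le (by norm_num), Real.rpow_neg (by norm_num : (0 : ℝ) ≤ 2),
      div_inv_eq_mul]
  have h8 : 4 * (M * ρ ^ (-((n : ℝ) - 2))) / ρ * c₁ +
      ρ * (C * (ρ ^ (-2 : ℝ) * (M * ρ ^ (-((n : ℝ) - 2))))) * c =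
      (4 * M * c₁ + C * M * c) * ρ ^ (-((n : ℝ) - 1)) := by
    rw [h5]
    calc _ = 4 * M * c₁ * ρ ^ (-((n : ℝ) - 1)) * (ρ / ρ) +
          C * M * c * ρ ^ (-((n : ℝ) - 1)) * (ρ * ρ ^ (-2 : ℝ) * ρ) := by ring
      _ = _ := by rw [h6, div_self hρ0.ne']; ring
  rw [h8, h7, ← le_div_iff₀ hc0] at key
  calc _ ≤ _ := key
    _ = _ := by ring

lemma sqrt_gradNormSq_le {x : EuclideanSpace ℝ (Fin n)} {B : ℝ} (hB : 0 ≤ B)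
    (h : ∀ l j, |pder (fun y => u y j) l x| ≤ B) :
    Real.sqrt (gradNormSq u x) ≤ Real.sqrt (n * m) * B := by
  have h1 : gradNormSq u x ≤ n * m * B ^ 2 := by
    calc gradNormSq u x ≤ ∑ _l : Fin n, ∑ _j : Fin m, B ^ 2 :=
          Finset.sum_le_sum fun l _ => Finset.sum_le_sum fun j _ =>
            sq_le_sq' (abs_le.1 (h l j)).1 (abs_le.1 (h l j)).2
      _ = _ := by simp [mul_assoc]
  refine (Real.sqrt_le_sqrt h1).trans_eq ?_
  rw [Real.sqrt_mul (by positivity), Real.sqrt_sq hB]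

end Reduction

/-- **Theorem 1 (asymptotic decay).** Let `n ≥ 3`, `A` positive definite symmetric,
`q > (n+2)/n`, `p = (n/2)(q-1)`, `f` a `C¹` map with `|fⁱ(V)| ≤ C|V|^q` and
`|∇fⁱ(V)| ≤ C|V|^{q-1}`. If `V ∈ Lᵖ(ℝⁿ \ K)` is a smooth solution of
`∑ⱼ Aᵢⱼ ΔVⱼ = fⁱ(V)` outside the compact set `K`, then `|V(x)| = O(|x|^{-(n-2)})`
and `|∇V(x)| = O(|x|^{-(n-1)})` at infinity. -/
theorem asymptotic_decay
    (n m : ℕ) (hn : 3 ≤ n) (hm : 1 ≤ m)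
    (A : Matrix (Fin m) (Fin m) ℝ) (hA : A.PosDef) (hAsymm : A.IsSymm)
    (q p C : ℝ) (hq : ((n : ℝ) + 2) / n < q) (hp : p = ((n : ℝ) / 2) * (q - 1)) (hC : 0 < C)
    (f : EuclideanSpace ℝ (Fin m) → EuclideanSpace ℝ (Fin m)) (hf : ContDiff ℝ 1 f)
    (hf1 : ∀ v : EuclideanSpace ℝ (Fin m), ∀ i, |f v i| ≤ C * ‖v‖ ^ q)
    (hf2 : ∀ v : EuclideanSpace ℝ (Fin m), ∀ i,
      ‖fderiv ℝ (fun w => f w i) v‖ ≤ C * ‖v‖ ^ (q - 1))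
    (K : Set (EuclideanSpace ℝ (Fin n))) (hK : IsCompact K)
    (V : EuclideanSpace ℝ (Fin n) → EuclideanSpace ℝ (Fin m))
    (hV : ContDiffOn ℝ (⊤ : ℕ∞) V Kᶜ)
    (hsol : ∀ x ∈ Kᶜ, ∀ i, ∑ j, A i j * lap (fun y => V y j) x = f (V x) i)
    (hLp : IntegrableOn (fun x => ‖V x‖ ^ p) Kᶜ) :
    ∃ C' > (0 : ℝ), ∃ R > (0 : ℝ), ∀ x : EuclideanSpace ℝ (Fin n), R ≤ ‖x‖ →
      ‖V x‖ ≤ C' * ‖x‖ ^ (-((n : ℝ) - 2)) ∧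
      Real.sqrt (gradNormSq V x) ≤ C' * ‖x‖ ^ (-((n : ℝ) - 1)) := by
  have hn' : (3 : ℝ) ≤ n := by exact_mod_cast hn
  have hn0 : (0 : ℝ) < n := by linarith
  have hqn : 2 < n * (q - 1) := by
    rw [div_lt_iff₀ hn0] at hq
    linarith
  have hq1 : 0 < q - 1 := by
    by_contra! h
    nlinarith
  obtain ⟨α, hα⟩ : ∃ α, α = 2 / (q - 1) := ⟨_, rfl⟩
  have hp1 : 1 ≤ p := by rw [hp]; linarith
  have hpα : α * p = n := by rw [hα, hp]; field_simp
  obtain ⟨u, hu, R₀, hR₀⟩ := exists_contDiff_eventuallyEq hK hV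
  have hu3 : ContDiff ℝ 3 u := contDiff_infty.1 hu 3
  have hu2 : ContDiff ℝ 2 u := hu3.of_le (by norm_num)
  have hcomp : ∀ x, R₀ ≤ ‖x‖ → ∀ j, (fun y => u y j) =ᶠ[nhds x] fun y => V y j :=
    fun x hx j => (hR₀ x hx).2.mono fun y hy => by simp only [hy]
  set D := (∑ i, ∑ j, |A⁻¹ i j|) * C with hD
  have hD0 : 0 ≤ D := mul_nonneg
    (Finset.sum_nonneg fun i _ => Finset.sum_nonneg fun j _ => abs_nonneg _) hC.le
  have hlap : ∀ x, R₀ ≤ ‖x‖ → ∀ e : EuclideanSpace ℝ (Fin m), ‖e‖ = 1 →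
      |lap (fun y => inner ℝ e (u y)) x| ≤ D * ‖u x‖ ^ q := by
    intro x hx e he
    rw [hD, mul_assoc]
    refine abs_lap_inner_le hu2 hA (hf1 (u x)) (fun i => ?_) he
    rw [(hR₀ x hx).2.eq_of_nhds, ← hsol x (hR₀ x hx).1 i]
    exact Finset.sum_congr rfl fun j _ => by rw [lap_congr (hcomp x hx j)]
  have hint : IntegrableOn (fun x => ‖u x‖ ^ p) {x | R₀ ≤ ‖x‖} := by
    refine (hLp.mono_set fun x hx => (hR₀ x hx).1).congr_fun (fun x hx => ?_)
      (isClosed_le continuous_const continuous_norm).measurableSet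
    simp only [(hR₀ x hx).2.eq_of_nhds]
  have hdecay : ∀ η > 0, ∃ R, ∀ x, R ≤ ‖x‖ → ‖u x‖ ≤ η * ‖x‖ ^ (-α) := fun η hη =>
    exists_norm_le_of_integrableOn hu2 (by linarith) hα hpα hp1 hD0 hlap hint hη
  obtain ⟨R₁, hR₁⟩ := hdecay 1 one_pos
  simp only [one_mul] at hR₁
  obtain ⟨M, hM0, R₂, hM⟩ : ∃ M, 0 ≤ M ∧ ∃ R, ∀ x, R ≤ ‖x‖ →
      ‖u x‖ ≤ M * ‖x‖ ^ (-((n : ℝ) - 2)) := by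
    rcases lt_or_ge α ((n : ℝ) - 2) with h | h
    · exact exists_norm_le_rpow_of_decay hu2 (by linarith) hα h hD0 hlap hdecay
    · refine ⟨1, zero_le_one, max R₁ 1, fun x hx => ?_⟩
      rw [one_mul]
      exact (hR₁ x ((le_max_left _ _).trans hx)).trans
        (Real.rpow_le_rpow_of_exponent_le ((le_max_right _ _).trans hx) (by linarith))
  obtain ⟨R, hR0, hRR₀, hRR₁, hRR₂⟩ : ∃ R : ℝ, 0 < R ∧ R₀ ≤ R ∧ R₁ ≤ R ∧ R₂ ≤ R :=
    ⟨max 1 (max R₀ (max R₁ R₂)), lt_max_of_lt_left one_pos, by simp, by simp, by simp⟩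
  obtain ⟨B, hB0, hB⟩ := exists_abs_pder_le hu3 (by linarith) hα hD0 hM0 hR0
    (fun x hx => hlap x (hRR₀.trans hx)) (fun x hx => hR₁ x (hRR₁.trans hx))
    (fun x hx => hM x (hRR₂.trans hx)) hn
  refine ⟨max 1 (max M (Real.sqrt (n * m) * B)), lt_max_of_lt_left one_pos, 2 * R,
    by linarith, fun x hx => ?_⟩
  have hx0 : 0 < ‖x‖ := by linarith
  have hxR₀ : R₀ ≤ ‖x‖ := by linarith
  constructor
  · rw [← (hR₀ x hxR₀).2.eq_of_nhds]
    refine (hM x (by linarith)).trans ?_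
    gcongr
    simp
  · have h1 : gradNormSq V x = gradNormSq u x :=
      Finset.sum_congr rfl fun l _ => Finset.sum_congr rfl fun j _ => by
        rw [(pder_eventuallyEq (hcomp x hxR₀ j) l).eq_of_nhds]
    rw [h1]
    refine (sqrt_gradNormSq_le (by positivity) fun l j => hB x hx l j).trans ?_
    rw [← mul_assoc]
    gcongr
    simp
end
end

section
/- Let n ≥ 3, m ≥ 1, and let A be a constant positive definite symmetric m×m real matrix. Let q > (n+2)/n with q ≠ (n+2)/(n-2), and set p = (n/2)(q-1). Let P : ℝ^m → ℝ be a C^2 function that is positively homogeneous of degree q+1, and set f^i = ∂P/∂V_i. Suppose V : ℝ^n → ℝ^m is a smooth solution of Σ_j A_{ij} ΔV_j = f^i(V) on all of ℝ^n with V ∈ L^p(ℝ^n). Then V ≡ 0. -/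
open MeasureTheory Metric Finset Filter Asymptotics
open scoped RealInnerProductSpace

noncomputable section

open scoped ContDiff Topology

section PartialDerivatives

variable {n : ℕ} {F : Type*} [NormedAddCommGroup F] [InnerProductSpace ℝ F]

/-- The partial derivative in the `l`-th coordinate direction of a vector-valued map. -/
def dirD (l : Fin n) (W : EuclideanSpace ℝ (Fin n) → F) (x : EuclideanSpace ℝ (Fin n)) : F :=
  fderiv ℝ W x (EuclideanSpace.single l 1)

/-- The Laplacian of a vector-valued map. -/
def vecLap (W : EuclideanSpace ℝ (Fin n) → F) (x : EuclideanSpace ℝ (Fin n)) : F :=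
  ∑ l, dirD l (dirD l W) x

/-- The squared Hilbert–Schmidt norm of the derivative of a vector-valued map. -/
def gradSq (W : EuclideanSpace ℝ (Fin n) → F) (x : EuclideanSpace ℝ (Fin n)) : ℝ :=
  ∑ l, ‖dirD l W x‖ ^ 2

theorem gradSq_nonneg (W : EuclideanSpace ℝ (Fin n) → F) (x : EuclideanSpace ℝ (Fin n)) :
    0 ≤ gradSq W x :=
  Finset.sum_nonneg fun _ _ => sq_nonneg _

theorem ContDiff.dirD {W : EuclideanSpace ℝ (Fin n) → F} {k r : WithTop ℕ∞} (hW : ContDiff ℝ k W)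
    (hr : r + 1 ≤ k) (l : Fin n) : ContDiff ℝ r (dirD l W) :=
  (hW.fderiv_right hr).clm_apply contDiff_const

theorem Continuous.gradSq {W : EuclideanSpace ℝ (Fin n) → F} (hW : ContDiff ℝ 1 W) :
    Continuous (gradSq W) :=
  continuous_finsetSum _ fun l _ =>
    ((hW.dirD (r := 0) (by simp) l).continuous.norm.pow 2)

theorem dirD_add {U W : EuclideanSpace ℝ (Fin n) → F} {x : EuclideanSpace ℝ (Fin n)}
    (hU : DifferentiableAt ℝ U x) (hW : DifferentiableAt ℝ W x) (l : Fin n) :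
    dirD l (fun y => U y + W y) x = dirD l U x + dirD l W x := by
  simp only [dirD, fderiv_fun_add hU hW, add_apply]

theorem dirD_sub {U W : EuclideanSpace ℝ (Fin n) → F} {x : EuclideanSpace ℝ (Fin n)}
    (hU : DifferentiableAt ℝ U x) (hW : DifferentiableAt ℝ W x) (l : Fin n) :
    dirD l (fun y => U y - W y) x = dirD l U x - dirD l W x := by
  simp only [dirD, fderiv_fun_sub hU hW, sub_apply]

theorem dirD_mul {f g : EuclideanSpace ℝ (Fin n) → ℝ} {x : EuclideanSpace ℝ (Fin n)}
    (hf : DifferentiableAt ℝ f x) (hg : DifferentiableAt ℝ g x) (l : Fin n) :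
    dirD l (fun y => f y * g y) x = dirD l f x * g x + f x * dirD l g x := by
  simp only [dirD, fderiv_fun_mul hf hg, add_apply,
    smul_apply, smul_eq_mul]
  ring

theorem dirD_smul {f : EuclideanSpace ℝ (Fin n) → ℝ} {W : EuclideanSpace ℝ (Fin n) → F}
    {x : EuclideanSpace ℝ (Fin n)}
    (hf : DifferentiableAt ℝ f x) (hW : DifferentiableAt ℝ W x) (l : Fin n) :
    dirD l (fun y => f y • W y) x = dirD l f x • W x + f x • dirD l W x := by
  simp [dirD, fderiv_fun_smul hf hW, add_comm]

theorem dirD_inner {U W : EuclideanSpace ℝ (Fin n) → F} {x : EuclideanSpace ℝ (Fin n)}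
    (hU : DifferentiableAt ℝ U x) (hW : DifferentiableAt ℝ W x) (l : Fin n) :
    dirD l (fun y => ⟪U y, W y⟫) x = ⟪U x, dirD l W x⟫ + ⟪dirD l U x, W x⟫ :=
  fderiv_inner_apply ℝ hU hW _

theorem dirD_norm_sq {W : EuclideanSpace ℝ (Fin n) → F} {x : EuclideanSpace ℝ (Fin n)}
    (hW : DifferentiableAt ℝ W x) (l : Fin n) :
    dirD l (fun y => ‖W y‖ ^ 2) x = 2 * ⟪W x, dirD l W x⟫ := by
  simp only [← real_inner_self_eq_norm_sq]
  rw [dirD_inner hW hW, real_inner_comm (W x) (dirD l W x)]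
  ring

theorem dirD_sum {ι : Type*} (s : Finset ι) {f : ι → EuclideanSpace ℝ (Fin n) → F}
    {x : EuclideanSpace ℝ (Fin n)} (hf : ∀ i, DifferentiableAt ℝ (f i) x) (l : Fin n) :
    dirD l (fun y => ∑ i ∈ s, f i y) x = ∑ i ∈ s, dirD l (f i) x := by
  simp only [dirD]
  rw [fderiv_fun_sum fun i _ => hf i, _root_.sum_apply]

theorem dirD_coord (l k : Fin n) (x : EuclideanSpace ℝ (Fin n)) :
    dirD l (fun y : EuclideanSpace ℝ (Fin n) => y k) x = if k = l then 1 else 0 := by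
  have : (fun y : EuclideanSpace ℝ (Fin n) => y k)
      = (EuclideanSpace.proj k : EuclideanSpace ℝ (Fin n) →L[ℝ] ℝ) := rfl
  rw [dirD, this, ContinuousLinearMap.fderiv]
  simp

theorem dirD_norm_sq_id (l : Fin n) (x : EuclideanSpace ℝ (Fin n)) :
    dirD l (fun y : EuclideanSpace ℝ (Fin n) => ‖y‖ ^ 2) x = 2 * x l := by
  have h := dirD_norm_sq (W := fun y : EuclideanSpace ℝ (Fin n) => y) (x := x)
    differentiableAt_id l
  rw [h]
  simp [dirD, EuclideanSpace.inner_single_right]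

theorem dirD_comp {h : ℝ → ℝ} {g : EuclideanSpace ℝ (Fin n) → ℝ} {x : EuclideanSpace ℝ (Fin n)}
    {h' : ℝ} (hh : HasDerivAt h h' (g x)) (hg : DifferentiableAt ℝ g x) (l : Fin n) :
    dirD l (fun y => h (g y)) x = h' * dirD l g x := by
  have := (hh.comp_hasFDerivAt x hg.hasFDerivAt).fderiv
  simp only [dirD]
  change fderiv ℝ (h ∘ g) x _ = _
  rw [this]
  simp

theorem dirD_comp_fderiv {Q : F → ℝ} {W : EuclideanSpace ℝ (Fin n) → F}
    {x : EuclideanSpace ℝ (Fin n)}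
    (hQ : DifferentiableAt ℝ Q (W x)) (hW : DifferentiableAt ℝ W x) (l : Fin n) :
    dirD l (fun y => Q (W y)) x = fderiv ℝ Q (W x) (dirD l W x) := by
  simp only [dirD]
  rw [fderiv_fun_comp x hQ hW]
  rfl

theorem dirD_comm {W : EuclideanSpace ℝ (Fin n) → F} (hW : ContDiff ℝ 2 W) (k l : Fin n)
    (x : EuclideanSpace ℝ (Fin n)) : dirD k (dirD l W) x = dirD l (dirD k W) x := by
  have hd : DifferentiableAt ℝ (fderiv ℝ W) x :=
    ((hW.fderiv_right (m := 1) (by norm_num)).differentiable (by norm_num)) x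
  have key : ∀ i j : Fin n, dirD i (dirD j W) x
      = fderiv ℝ (fderiv ℝ W) x (EuclideanSpace.single i 1) (EuclideanSpace.single j 1) := by
    intro i j
    unfold dirD
    rw [fderiv_clm_apply hd (differentiableAt_const _)]
    simp
  rw [key, key]
  exact (hW.contDiffAt.isSymmSndFDerivAt (by simp)).eq _ _

theorem norm_fderiv_sq_le_gradSq (W : EuclideanSpace ℝ (Fin n) → F)
    (x : EuclideanSpace ℝ (Fin n)) : ‖fderiv ℝ W x‖ ^ 2 ≤ gradSq W x := by
  have h : ‖fderiv ℝ W x‖ ≤ Real.sqrt (gradSq W x) := by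
    refine ContinuousLinearMap.opNorm_le_bound _ (Real.sqrt_nonneg _) fun v => ?_
    have hv : v = ∑ l, v l • EuclideanSpace.single l (1 : ℝ) := by
      ext i
      simp [Pi.single_apply]
    have h1 : fderiv ℝ W x v = ∑ l, v l • dirD l W x := by
      conv_lhs => rw [hv]
      simp [dirD, map_sum]
    rw [h1]
    calc ‖∑ l, v l • dirD l W x‖ ≤ ∑ l, ‖dirD l W x‖ * ‖v l‖ := by
          refine (norm_sum_le _ _).trans (Finset.sum_le_sum fun l _ => ?_)
          rw [norm_smul, mul_comm]
      _ ≤ Real.sqrt (∑ l, ‖dirD l W x‖ ^ 2) * Real.sqrt (∑ l, ‖v l‖ ^ 2) :=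
          Real.sum_mul_le_sqrt_mul_sqrt _ _ _
      _ = _ := by rw [EuclideanSpace.norm_eq v]; rfl
  calc ‖fderiv ℝ W x‖ ^ 2 ≤ Real.sqrt (gradSq W x) ^ 2 := by gcongr
    _ = _ := Real.sq_sqrt (gradSq_nonneg W x)

theorem HasCompactSupport.dirD {W : EuclideanSpace ℝ (Fin n) → F} (hW : HasCompactSupport W)
    (l : Fin n) : HasCompactSupport (dirD l W) := by
  refine (hW.fderiv (𝕜 := ℝ)).mono' fun x hx => subset_tsupport _ ?_
  contrapose! hx
  have hx0 : fderiv ℝ W x = 0 := by simpa using hx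
  simp [_root_.dirD, hx0]

theorem HasCompactSupport.gradSq {W : EuclideanSpace ℝ (Fin n) → F} (hW : HasCompactSupport W) :
    HasCompactSupport (gradSq W) := by
  refine (hW.fderiv (𝕜 := ℝ)).mono' fun x hx => subset_tsupport _ ?_
  contrapose! hx
  have hx0 : fderiv ℝ W x = 0 := by simpa using hx
  simp [_root_.gradSq, _root_.dirD, hx0]

theorem integral_dirD_eq_zero {g : EuclideanSpace ℝ (Fin n) → ℝ} (hg : ContDiff ℝ 1 g)
    (hc : HasCompactSupport g) (l : Fin n) : ∫ x, dirD l g x = 0 := by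
  have hi : Integrable (dirD l g) :=
    (hg.dirD (r := 0) (by simp) l).continuous.integrable_of_hasCompactSupport (hc.dirD l)
  have hi' : Integrable g := hg.continuous.integrable_of_hasCompactSupport hc
  have h := integral_mul_fderiv_eq_neg_fderiv_mul_of_integrable
    (μ := (volume : Measure (EuclideanSpace ℝ (Fin n)))) (𝕜 := ℝ)
    (f := fun _ => (1 : ℝ)) (g := g) (v := EuclideanSpace.single l 1) (by simp)
    (by simp only [one_mul]; exact hi) (by simpa using hi') (fun x _ => differentiableAt_const _)
    (fun x _ => (hg.differentiable (by norm_num)) x)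
  simpa [dirD] using h

theorem integral_sum_dirD_eq_zero {G : Fin n → EuclideanSpace ℝ (Fin n) → ℝ}
    (hG : ∀ l, ContDiff ℝ 1 (G l)) (hc : ∀ l, HasCompactSupport (G l)) :
    Integrable (fun x => ∑ l, dirD l (G l) x) ∧ ∫ x, ∑ l, dirD l (G l) x = 0 := by
  have hi : ∀ l, Integrable (dirD l (G l)) := fun l =>
    ((hG l).dirD (r := 0) (by simp) l).continuous.integrable_of_hasCompactSupport ((hc l).dirD l)
  refine ⟨integrable_finsetSum _ fun l _ => hi l, ?_⟩
  rw [integral_finsetSum _ fun l _ => hi l]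
  exact Finset.sum_eq_zero fun l _ => integral_dirD_eq_zero (hG l) (hc l) l

end PartialDerivatives

section Identities

variable {n : ℕ} {F : Type*} [NormedAddCommGroup F] [InnerProductSpace ℝ F]

theorem gradSq_smul_eq {φ : EuclideanSpace ℝ (Fin n) → ℝ} {W : EuclideanSpace ℝ (Fin n) → F}
    (hφ : ContDiff ℝ 1 φ) (hW : ContDiff ℝ 2 W) (x : EuclideanSpace ℝ (Fin n)) :
    gradSq (fun y => φ y • W y) x = gradSq φ x * ‖W x‖ ^ 2 - φ x ^ 2 * ⟪W x, vecLap W x⟫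
      + ∑ l, dirD l (fun y => φ y * (φ y * ⟪W y, dirD l W y⟫)) x := by
  have dφ := hφ.differentiable (by norm_num) x
  have dW := hW.differentiable (by norm_num) x
  have dW' : ∀ l, DifferentiableAt ℝ (dirD l W) x := fun l =>
    (hW.dirD (r := 1) (by norm_num) l).differentiable (by norm_num) x
  simp only [gradSq, vecLap, inner_sum, Finset.mul_sum, Finset.sum_mul]
  rw [← Finset.sum_sub_distrib, ← Finset.sum_add_distrib]
  refine Finset.sum_congr rfl fun l _ => ?_
  rw [dirD_smul dφ dW, dirD_mul dφ (dφ.fun_mul (dW.inner ℝ (dW' l))),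
    dirD_mul dφ (dW.inner ℝ (dW' l)), dirD_inner dW (dW' l), norm_add_sq_real, norm_smul,
    norm_smul, inner_smul_left, inner_smul_right, real_inner_self_eq_norm_sq, mul_pow, mul_pow,
    Real.norm_eq_abs, Real.norm_eq_abs, sq_abs, sq_abs]
  simp only [conj_trivial]
  ring

theorem Continuous.vecLap {W : EuclideanSpace ℝ (Fin n) → F} (hW : ContDiff ℝ 2 W) :
    Continuous (vecLap W) :=
  continuous_finsetSum _ fun l _ =>
    ((hW.dirD (r := 1) (by norm_num) l).dirD (r := 0) (by simp) l).continuous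

theorem integral_gradSq_smul {φ : EuclideanSpace ℝ (Fin n) → ℝ} {W : EuclideanSpace ℝ (Fin n) → F}
    (hφ : ContDiff ℝ 1 φ) (hc : HasCompactSupport φ) (hW : ContDiff ℝ 2 W) :
    ∫ x, gradSq (fun y => φ y • W y) x
      = (∫ x, gradSq φ x * ‖W x‖ ^ 2) - ∫ x, φ x ^ 2 * ⟪W x, vecLap W x⟫ := by
  have hdiv := integral_sum_dirD_eq_zero
    (G := fun l y => φ y * (φ y * ⟪W y, dirD l W y⟫))
    (fun l => hφ.mul (hφ.mul ((hW.of_le (by norm_num)).inner ℝ (hW.dirD (by norm_num) l))))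
    (fun l => hc.mul_right)
  have hlap := Continuous.vecLap hW
  have h1 : Integrable fun x => gradSq φ x * ‖W x‖ ^ 2 :=
    ((Continuous.gradSq hφ).mul (hW.continuous.norm.pow 2)).integrable_of_hasCompactSupport
      hc.gradSq.mul_right
  have h2 : Integrable fun x => φ x ^ 2 * ⟪W x, vecLap W x⟫ := by
    refine Continuous.integrable_of_hasCompactSupport ?_ ?_
    · exact (hφ.continuous.pow 2).mul (hW.continuous.inner hlap)
    · simp only [pow_two, mul_assoc]
      exact hc.mul_right
  simp_rw [gradSq_smul_eq hφ hW]
  rw [integral_add (h1.sub' h2) hdiv.1, hdiv.2, integral_sub h1 h2, add_zero]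

theorem sum_coord_sq (x : EuclideanSpace ℝ (Fin n)) : ∑ l, x l * x l = ‖x‖ ^ 2 := by
  rw [EuclideanSpace.norm_sq_eq]
  simp [pow_two]

theorem contDiff_coord {r : WithTop ℕ∞} (k : Fin n) :
    ContDiff ℝ r fun y : EuclideanSpace ℝ (Fin n) => y k :=
  (EuclideanSpace.proj k : EuclideanSpace ℝ (Fin n) →L[ℝ] ℝ).contDiff

theorem one_add_norm_sq_pos (x : EuclideanSpace ℝ (Fin n)) : 0 < 1 + ‖x‖ ^ 2 := by positivity

theorem contDiff_one_add_norm_sq {r : WithTop ℕ∞} :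
    ContDiff ℝ r fun y : EuclideanSpace ℝ (Fin n) => 1 + ‖y‖ ^ 2 :=
  contDiff_const.add (contDiff_norm_sq ℝ)

/-- Hardy's inequality with the regular weight `(1 + |x|²)⁻¹`. -/
theorem hardy_inequality (hn : 2 ≤ n) {w : EuclideanSpace ℝ (Fin n) → F}
    (hw : ContDiff ℝ 1 w) (hc : HasCompactSupport w) :
    (((n : ℝ) - 2) / 2) ^ 2 * ∫ x, (1 + ‖x‖ ^ 2)⁻¹ * ‖w x‖ ^ 2 ≤ ∫ x, gradSq w x := by
  set h : ℝ := ((n : ℝ) - 2) / 2 with hh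
  have h0 : 0 ≤ h := by
    have : (2 : ℝ) ≤ n := by exact_mod_cast hn
    rw [hh]; linarith
  have hnn : (n : ℝ) = 2 * h + 2 := by rw [hh]; ring
  have hρ : ContDiff ℝ 1 fun y : EuclideanSpace ℝ (Fin n) => (1 + ‖y‖ ^ 2)⁻¹ :=
    contDiff_one_add_norm_sq.inv fun x => (one_add_norm_sq_pos x).ne'
  have hN : ContDiff ℝ 1 fun y => ‖w y‖ ^ 2 := hw.norm_sq ℝ
  have hcN : HasCompactSupport fun y => ‖w y‖ ^ 2 :=
    hc.comp_left (g := fun v : F => ‖v‖ ^ 2) (by simp)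
  have hdiv := integral_sum_dirD_eq_zero
    (G := fun l y => y l * ((1 + ‖y‖ ^ 2)⁻¹ * ‖w y‖ ^ 2))
    (fun l => (contDiff_coord l).mul (hρ.mul hN)) (fun l => hcN.mul_left.mul_left)
  have hpt : ∀ x, h ^ 2 * ((1 + ‖x‖ ^ 2)⁻¹ * ‖w x‖ ^ 2) ≤ gradSq w x
      + h * ∑ l, dirD l (fun y => y l * ((1 + ‖y‖ ^ 2)⁻¹ * ‖w y‖ ^ 2)) x := by
    intro x
    have dw := hw.differentiable (by norm_num) x
    have dρ := hρ.differentiable (by norm_num) x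
    have dN := hN.differentiable (by norm_num) x
    have d1 : DifferentiableAt ℝ (fun y : EuclideanSpace ℝ (Fin n) => 1 + ‖y‖ ^ 2) x :=
      (contDiff_one_add_norm_sq (r := 1)).differentiable (by norm_num) x
    set t : ℝ := (1 + ‖x‖ ^ 2)⁻¹ with ht
    have ht0 : 0 < t := inv_pos.2 (one_add_norm_sq_pos x)
    have htr : t * ‖x‖ ^ 2 = 1 - t := by
      rw [ht]; field_simp; ring
    have e1 : ∀ l, dirD l (fun y : EuclideanSpace ℝ (Fin n) => (1 + ‖y‖ ^ 2)⁻¹) x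
        = -(t ^ 2) * (2 * x l) := by
      intro l
      rw [dirD_comp (hasDerivAt_inv (one_add_norm_sq_pos x).ne') d1]
      have : dirD l (fun y : EuclideanSpace ℝ (Fin n) => 1 + ‖y‖ ^ 2) x = 2 * x l := by
        rw [← dirD_norm_sq_id]
        simp only [dirD]
        rw [fderiv_const_add]
      rw [this, ht, inv_pow]
    have e2 : ∀ l, dirD l (fun y => y l * ((1 + ‖y‖ ^ 2)⁻¹ * ‖w y‖ ^ 2)) x
        = t * ‖w x‖ ^ 2 - 2 * t ^ 2 * ‖w x‖ ^ 2 * (x l * x l)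
          + 2 * (t * (x l * ⟪w x, dirD l w x⟫)) := by
      intro l
      rw [dirD_mul ((contDiff_coord (r := 1) l).differentiable (by norm_num) x) (dρ.fun_mul dN),
        dirD_mul dρ dN, e1, dirD_norm_sq dw, dirD_coord, if_pos rfl]
      ring
    have e3 : 0 ≤ gradSq w x + 2 * h * ∑ l, t * (x l * ⟪w x, dirD l w x⟫)
        + h ^ 2 * t ^ 2 * ‖w x‖ ^ 2 * ∑ l, x l * x l := by
      rw [gradSq, Finset.mul_sum, Finset.mul_sum, ← Finset.sum_add_distrib,
        ← Finset.sum_add_distrib]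
      refine Finset.sum_nonneg fun l _ => ?_
      have := sq_nonneg ‖dirD l w x + (h * t * x l) • w x‖
      rw [norm_add_sq_real, norm_smul, inner_smul_right, real_inner_comm, mul_pow,
        Real.norm_eq_abs, sq_abs] at this
      nlinarith [this]
    simp_rw [e2]
    rw [Finset.sum_add_distrib, Finset.sum_sub_distrib]
    simp only [← Finset.mul_sum, sum_coord_sq] at e3 ⊢
    simp only [Finset.sum_const, Finset.card_univ, Fintype.card_fin, nsmul_eq_mul]
    rw [hnn]
    have e4 : t ^ 2 * ‖w x‖ ^ 2 * ‖x‖ ^ 2 = t * (1 - t) * ‖w x‖ ^ 2 := by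
      rw [← htr]; ring
    have e5 : 0 ≤ (2 * h + h ^ 2) * t ^ 2 * ‖w x‖ ^ 2 := by positivity
    linear_combination e3 + e5 + (h ^ 2 + 2 * h) * e4
  have hi1 : Integrable fun x => (1 + ‖x‖ ^ 2)⁻¹ * ‖w x‖ ^ 2 :=
    (hρ.continuous.mul hN.continuous).integrable_of_hasCompactSupport hcN.mul_left
  have hi2 : Integrable (gradSq w) :=
    (Continuous.gradSq hw).integrable_of_hasCompactSupport hc.gradSq
  have := integral_mono (hi1.const_mul (h ^ 2)) (hi2.add (hdiv.1.const_mul h)) hpt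
  rw [integral_const_mul] at this
  simp only [Pi.add_apply] at this
  rw [integral_add hi2 (hdiv.1.const_mul h), integral_const_mul, hdiv.2] at this
  linarith

theorem integral_nehari {ψ : EuclideanSpace ℝ (Fin n) → ℝ} {W : EuclideanSpace ℝ (Fin n) → F}
    (hψ : ContDiff ℝ 1 ψ) (hc : HasCompactSupport ψ) (hW : ContDiff ℝ 2 W) :
    ∫ x, (ψ x * (gradSq W x + ⟪W x, vecLap W x⟫) + ∑ l, dirD l ψ x * ⟪W x, dirD l W x⟫) = 0 := by
  rw [← (integral_sum_dirD_eq_zero (G := fun l y => ψ y * ⟪W y, dirD l W y⟫)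
    (fun l => hψ.mul ((hW.of_le (by norm_num)).inner ℝ (hW.dirD (by norm_num) l)))
    (fun l => hc.mul_right)).2]
  congr 1
  ext x
  have dψ := hψ.differentiable (by norm_num) x
  have dW := hW.differentiable (by norm_num) x
  have dW' : ∀ l, DifferentiableAt ℝ (dirD l W) x := fun l =>
    (hW.dirD (r := 1) (by norm_num) l).differentiable (by norm_num) x
  simp only [gradSq, vecLap, inner_sum]
  rw [← Finset.sum_add_distrib, Finset.mul_sum, ← Finset.sum_add_distrib]
  refine Finset.sum_congr rfl fun l _ => ?_
  rw [dirD_mul dψ (dW.inner ℝ (dW' l)), dirD_inner dW (dW' l), real_inner_self_eq_norm_sq]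
  ring

theorem integral_pohozaev {ψ H : EuclideanSpace ℝ (Fin n) → ℝ}
    {W : EuclideanSpace ℝ (Fin n) → F}
    (hψ : ContDiff ℝ 1 ψ) (hc : HasCompactSupport ψ) (hW : ContDiff ℝ 2 W) (hH : ContDiff ℝ 1 H)
    (hHW : ∀ l x, dirD l H x = ⟪vecLap W x, dirD l W x⟫) :
    ∫ x, (ψ x * ((1 - n / 2) * gradSq W x - n * H x)
      + ∑ l, dirD l ψ x * (∑ k, x k * ⟪dirD k W x, dirD l W x⟫
          - x l * (gradSq W x / 2 + H x))) = 0 := by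
  have hW' : ∀ l, ContDiff ℝ 1 (dirD l W) := fun l => hW.dirD (by norm_num) l
  have hg : ContDiff ℝ 1 (gradSq W) := ContDiff.sum fun l _ => (hW' l).norm_sq ℝ
  have hT1 : ∀ l, ContDiff ℝ 1 fun y : EuclideanSpace ℝ (Fin n) =>
      ∑ k, y k * ⟪dirD k W y, dirD l W y⟫ := fun l =>
    ContDiff.sum fun k _ => (contDiff_coord k).mul ((hW' k).inner ℝ (hW' l))
  have hT2 : ∀ l, ContDiff ℝ 1 fun y : EuclideanSpace ℝ (Fin n) =>
      y l * (gradSq W y / 2 + H y) := fun l =>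
    (contDiff_coord l).mul ((hg.div_const 2).add hH)
  rw [← (integral_sum_dirD_eq_zero
    (G := fun l y => ψ y * (∑ k, y k * ⟪dirD k W y, dirD l W y⟫
      - y l * (gradSq W y / 2 + H y)))
    (fun l => hψ.mul ((hT1 l).sub (hT2 l))) (fun l => hc.mul_right)).2]
  congr 1
  ext x
  have dψ := hψ.differentiable (by norm_num) x
  have dH := hH.differentiable (by norm_num) x
  have dg := hg.differentiable (by norm_num) x
  have dg2 : DifferentiableAt ℝ (fun y => gradSq W y / 2) x :=
    (hg.div_const 2).differentiable (by norm_num) x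
  have dW' : ∀ l, DifferentiableAt ℝ (dirD l W) x := fun l =>
    (hW' l).differentiable (by norm_num) x
  have dx : ∀ l, DifferentiableAt ℝ (fun y : EuclideanSpace ℝ (Fin n) => y l) x := fun l =>
    (contDiff_coord (r := 1) l).differentiable (by norm_num) x
  have eg : ∀ l, dirD l (gradSq W) x = 2 * ∑ k, ⟪dirD k W x, dirD l (dirD k W) x⟫ := by
    intro l
    change dirD l (fun y => ∑ k, ‖dirD k W y‖ ^ 2) x = _
    rw [dirD_sum _ fun k => ((hW' k).norm_sq ℝ).differentiable (by norm_num) x, Finset.mul_sum]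
    exact Finset.sum_congr rfl fun k _ => dirD_norm_sq (dW' k) l
  have e2 : ∀ l, dirD l (fun y => y l * (gradSq W y / 2 + H y)) x
      = gradSq W x / 2 + H x + x l * (∑ k, ⟪dirD k W x, dirD l (dirD k W) x⟫)
        + x l * ⟪vecLap W x, dirD l W x⟫ := by
    intro l
    rw [dirD_mul (dx l) (dg2.fun_add dH), dirD_coord, if_pos rfl]
    have : dirD l (fun y => gradSq W y / 2 + H y) x
        = (∑ k, ⟪dirD k W x, dirD l (dirD k W) x⟫) + ⟪vecLap W x, dirD l W x⟫ := by
      have h2 : dirD l (fun y => gradSq W y / 2) x = dirD l (gradSq W) x / 2 := by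
        rw [dirD_comp (h := fun s => s / 2) ((hasDerivAt_id' (gradSq W x)).div_const (2 : ℝ)) dg]
        ring
      rw [dirD_add dg2 dH, h2, hHW, eg]
      ring
    rw [this]
    ring
  have e1 : ∀ l, dirD l (fun y : EuclideanSpace ℝ (Fin n) =>
      ∑ k, y k * ⟪dirD k W y, dirD l W y⟫) x
      = ‖dirD l W x‖ ^ 2 + ∑ k, x k * (⟪dirD k W x, dirD l (dirD l W) x⟫
        + ⟪dirD k (dirD l W) x, dirD l W x⟫) := by
    intro l
    rw [dirD_sum _ fun k => (dx k).fun_mul ((dW' k).inner ℝ (dW' l))]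
    have : ∀ k, dirD l (fun y : EuclideanSpace ℝ (Fin n) => y k * ⟪dirD k W y, dirD l W y⟫) x
        = (if k = l then ⟪dirD k W x, dirD l W x⟫ else 0)
          + x k * (⟪dirD k W x, dirD l (dirD l W) x⟫ + ⟪dirD k (dirD l W) x, dirD l W x⟫) := by
      intro k
      rw [dirD_mul (dx k) ((dW' k).inner ℝ (dW' l)), dirD_inner (dW' k) (dW' l), dirD_coord,
        dirD_comm hW l k]
      split_ifs <;> ring
    simp_rw [this]
    rw [Finset.sum_add_distrib, Finset.sum_ite_eq' Finset.univ l, if_pos (Finset.mem_univ l),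
      real_inner_self_eq_norm_sq]
  have e3 : ∀ l, dirD l (fun y => ψ y * (∑ k, y k * ⟪dirD k W y, dirD l W y⟫
      - y l * (gradSq W y / 2 + H y))) x
      = dirD l ψ x * (∑ k, x k * ⟪dirD k W x, dirD l W x⟫ - x l * (gradSq W x / 2 + H x))
        + ψ x * (‖dirD l W x‖ ^ 2 + ∑ k, x k * ⟪dirD k W x, dirD l (dirD l W) x⟫
          + ∑ k, x k * ⟪dirD k (dirD l W) x, dirD l W x⟫
          - (gradSq W x / 2 + H x) - x l * (∑ k, ⟪dirD k W x, dirD l (dirD k W) x⟫)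
          - x l * ⟪vecLap W x, dirD l W x⟫) := by
    intro l
    have d1 := (hT1 l).differentiable (by norm_num) x
    have d2 := (hT2 l).differentiable (by norm_num) x
    rw [dirD_mul dψ (d1.fun_sub d2)]
    rw [dirD_sub d1 d2, e1, e2]
    simp only [mul_add, Finset.sum_add_distrib]
    ring
  simp_rw [e3]
  rw [Finset.sum_add_distrib, ← Finset.mul_sum, add_comm]
  congr 2
  simp only [Finset.sum_add_distrib, Finset.sum_sub_distrib]
  have f1 : ∑ l, ∑ k, x k * ⟪dirD k W x, dirD l (dirD l W) x⟫
      = ∑ l, x l * ⟪vecLap W x, dirD l W x⟫ := by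
    rw [Finset.sum_comm]
    refine Finset.sum_congr rfl fun k _ => ?_
    rw [← Finset.mul_sum, ← inner_sum, real_inner_comm]
    rfl
  have f2 : ∑ l, ∑ k, x k * ⟪dirD k (dirD l W) x, dirD l W x⟫
      = ∑ l, x l * ∑ k, ⟪dirD k W x, dirD l (dirD k W) x⟫ := by
    rw [Finset.sum_comm]
    refine Finset.sum_congr rfl fun k _ => ?_
    rw [← Finset.mul_sum]
    congr 1
    exact Finset.sum_congr rfl fun l _ => real_inner_comm _ _
  rw [f1, f2]
  have f3 : ∑ l, ‖dirD l W x‖ ^ 2 = gradSq W x := rfl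
  rw [f3]
  simp only [Finset.sum_const, Finset.card_univ, Fintype.card_fin, nsmul_eq_mul]
  ring

end Identities

section Absorption

variable {n : ℕ} {F : Type*} [NormedAddCommGroup F] [InnerProductSpace ℝ F]

theorem tendsto_setIntegral_compl_ball {H : EuclideanSpace ℝ (Fin n) → ℝ} (hH : Integrable H) :
    Tendsto (fun R : ℝ => ∫ x in (ball (0 : EuclideanSpace ℝ (Fin n)) R)ᶜ, H x) atTop (𝓝 0) := by
  have h := tendsto_setIntegral_of_antitone (μ := volume) (f := H)
    (s := fun R : ℝ => (ball (0 : EuclideanSpace ℝ (Fin n)) R)ᶜ)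
    (fun R => measurableSet_ball.compl)
    (fun a b hab => Set.compl_subset_compl.2 (ball_subset_ball hab)) ⟨0, hH.integrableOn⟩
  have he : ⋂ R : ℝ, (ball (0 : EuclideanSpace ℝ (Fin n)) R)ᶜ = ∅ := by
    refine Set.eq_empty_of_forall_notMem fun x hx => ?_
    have := Set.mem_iInter.1 hx (‖x‖ + 1)
    simp at this
  rwa [he, setIntegral_empty] at h

/-- The Sobolev inequality with exponent `2 n / (n - 2)` for compactly supported maps. -/
theorem exists_sobolev_const [CompleteSpace F] (hn : 3 ≤ n) :
    ∃ S : ℝ, 0 ≤ S ∧ ∀ w : EuclideanSpace ℝ (Fin n) → F, ContDiff ℝ 1 w → HasCompactSupport w →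
      (∫ x, (‖w x‖ ^ 2) ^ ((n : ℝ) / (n - 2))) ^ (((n : ℝ) - 2) / n) ≤ S * ∫ x, gradSq w x := by
  have hn' : (3 : ℝ) ≤ n := by exact_mod_cast hn
  have hr0 : (0 : ℝ) < 2 * n / (n - 2) := by
    apply div_pos <;> linarith
  set r : NNReal := ⟨2 * n / (n - 2), hr0.le⟩ with hr
  have hrr : (r : ℝ) = 2 * n / (n - 2) := rfl
  set K := eLpNormLESNormFDerivOfEqInnerConst
    (volume : Measure (EuclideanSpace ℝ (Fin n))) ((2 : NNReal) : ℝ) with hK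
  refine ⟨(K : ℝ) ^ 2, by positivity, fun w hw hc => ?_⟩
  have hd : Continuous (fderiv ℝ w) := hw.continuous_fderiv (by norm_num)
  have hm1 : MemLp w r volume := hw.continuous.memLp_of_hasCompactSupport hc
  have hm2 : MemLp (fderiv ℝ w) (2 : NNReal) volume :=
    hd.memLp_of_hasCompactSupport (hc.fderiv (𝕜 := ℝ))
  have hsob := eLpNorm_le_eLpNorm_fderiv_of_eq_inner
    (volume : Measure (EuclideanSpace ℝ (Fin n))) hw hc (p := 2) (p' := r) (by norm_num)
    (by simp; omega) (by
      rw [hrr, finrank_euclideanSpace_fin]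
      have : (n : ℝ) - 2 ≠ 0 := by linarith
      push_cast
      field_simp)
  have hr00 : r ≠ 0 := by
    intro h
    exact hr0.ne' (by rw [← hrr, h]; simp)
  rw [hm1.eLpNorm_eq_integral_rpow_norm (by exact_mod_cast hr00) (by simp),
    hm2.eLpNorm_eq_integral_rpow_norm (by norm_num) (by simp), ← hK,
    ← ENNReal.ofReal_coe_nnreal (p := K), ← ENNReal.ofReal_mul (by positivity),
    ENNReal.ofReal_le_ofReal_iff (by positivity)] at hsob
  simp only [ENNReal.coe_toReal, hrr, NNReal.coe_ofNat] at hsob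
  have hI : ∫ x, ‖fderiv ℝ w x‖ ^ (2 : ℝ) ≤ ∫ x, gradSq w x := by
    refine integral_mono ?_ ((Continuous.gradSq hw).integrable_of_hasCompactSupport hc.gradSq) ?_
    · have := hm2.integrable_norm_rpow (by norm_num) (by simp)
      simpa using this
    · intro x
      simpa using norm_fderiv_sq_le_gradSq w x
  have h0 : 0 ≤ ∫ x, ‖w x‖ ^ (2 * (n : ℝ) / (n - 2)) := integral_nonneg fun x => by positivity
  have h0' : 0 ≤ ∫ x, ‖fderiv ℝ w x‖ ^ (2 : ℝ) := integral_nonneg fun x => by positivity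
  have e : ∀ x, (‖w x‖ ^ 2) ^ ((n : ℝ) / (n - 2)) = ‖w x‖ ^ (2 * (n : ℝ) / (n - 2)) := by
    intro x
    rw [← Real.rpow_natCast, ← Real.rpow_mul (norm_nonneg _)]
    congr 1
    push_cast
    ring
  simp_rw [e]
  calc (∫ x, ‖w x‖ ^ (2 * (n : ℝ) / (n - 2))) ^ (((n : ℝ) - 2) / n)
      = ((∫ x, ‖w x‖ ^ (2 * (n : ℝ) / (n - 2))) ^ (2 * (n : ℝ) / (n - 2))⁻¹) ^ 2 := by
        rw [← Real.rpow_natCast, ← Real.rpow_mul h0]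
        congr 1
        push_cast
        field_simp
    _ ≤ ((K : ℝ) * (∫ x, ‖fderiv ℝ w x‖ ^ (2 : ℝ)) ^ (2 : ℝ)⁻¹) ^ 2 := by gcongr
    _ = (K : ℝ) ^ 2 * ∫ x, ‖fderiv ℝ w x‖ ^ (2 : ℝ) := by
        rw [mul_pow, ← Real.rpow_natCast (_ ^ (2 : ℝ)⁻¹), ← Real.rpow_mul h0']
        norm_num
    _ ≤ (K : ℝ) ^ 2 * ∫ x, gradSq w x := by gcongr

/-- A superlinear power whose critical Lebesgue norm is finite is absorbed by the Dirichlet energy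
of cut-offs, up to an additive constant. -/
theorem exists_absorption_const [CompleteSpace F] (hn : 3 ≤ n) {q : ℝ} (hq : 1 < q)
    {W : EuclideanSpace ℝ (Fin n) → F} (hW : ContDiff ℝ 1 W)
    (hLp : Integrable fun x => ‖W x‖ ^ ((n : ℝ) / 2 * (q - 1))) {δ : ℝ} (hδ : 0 < δ) :
    ∃ C : ℝ, 0 ≤ C ∧ ∀ φ : EuclideanSpace ℝ (Fin n) → ℝ, ContDiff ℝ 1 φ → HasCompactSupport φ →
      (∀ x, 0 ≤ φ x) → (∀ x, φ x ≤ 1) →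
      ∫ x, φ x ^ 2 * ‖W x‖ ^ (q + 1) ≤ C + δ * ∫ x, gradSq (fun y => φ y • W y) x := by
  obtain ⟨S, hS0, hS⟩ := exists_sobolev_const (F := F) hn
  have hn' : (3 : ℝ) ≤ n := by exact_mod_cast hn
  have hlim : Tendsto (fun R : ℝ => (∫ x in (ball (0 : EuclideanSpace ℝ (Fin n)) R)ᶜ,
      ‖W x‖ ^ ((n : ℝ) / 2 * (q - 1))) ^ (1 / ((n : ℝ) / 2)) * S) atTop (𝓝 0) := by
    have := ((tendsto_setIntegral_compl_ball hLp).rpow_const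
      (p := 1 / ((n : ℝ) / 2)) (Or.inr (by positivity))).mul_const S
    rwa [Real.zero_rpow (by positivity), zero_mul] at this
  obtain ⟨M, hM⟩ := (hlim.eventually_le_const hδ).exists
  set B := ball (0 : EuclideanSpace ℝ (Fin n)) M with hB
  have hWc := hW.continuous
  have hcq : Continuous fun x => ‖W x‖ ^ (q + 1) :=
    hWc.norm.rpow_const fun _ => Or.inr (by linarith)
  have hcq' : Continuous fun x => ‖W x‖ ^ (q - 1) :=
    hWc.norm.rpow_const fun _ => Or.inr (by linarith)
  have hBi : IntegrableOn (fun x => ‖W x‖ ^ (q + 1)) B :=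
    (hcq.continuousOn.integrableOn_compact (isCompact_closedBall 0 M)).mono_set
      ball_subset_closedBall
  refine ⟨∫ x in B, ‖W x‖ ^ (q + 1), integral_nonneg fun x => by positivity,
    fun φ hφ hc hφ0 hφ1 => ?_⟩
  have hw : ContDiff ℝ 1 fun y => φ y • W y := hφ.smul hW
  have hwc : HasCompactSupport fun y => φ y • W y := hc.smul_right
  have hi : Integrable fun x => φ x ^ 2 * ‖W x‖ ^ (q + 1) := by
    refine ((hφ.continuous.pow 2).mul hcq).integrable_of_hasCompactSupport ?_
    simp only [pow_two, mul_assoc]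
    exact hc.mul_right
  rw [← integral_add_compl (measurableSet_ball (x := (0 : EuclideanSpace ℝ (Fin n))) (ε := M)) hi]
  refine add_le_add ?_ ?_
  · refine setIntegral_mono hi.integrableOn hBi fun x => ?_
    have : φ x ^ 2 ≤ 1 := pow_le_one₀ (hφ0 x) (hφ1 x)
    exact mul_le_of_le_one_left (by positivity) this
  · have hpq : ((n : ℝ) / 2).HolderConjugate ((n : ℝ) / (n - 2)) := by
      rw [Real.holderConjugate_iff]
      refine ⟨by linarith, ?_⟩
      have : (n : ℝ) - 2 ≠ 0 := by linarith
      field_simp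
      ring
    have hg : Continuous fun x => ‖φ x • W x‖ ^ 2 := hw.continuous.norm.pow 2
    have hgc : HasCompactSupport fun x => ‖φ x • W x‖ ^ 2 :=
      hwc.comp_left (g := fun v : F => ‖v‖ ^ 2) (by simp)
    have e1 : ∀ x, (‖W x‖ ^ (q - 1)) ^ ((n : ℝ) / 2) = ‖W x‖ ^ ((n : ℝ) / 2 * (q - 1)) := by
      intro x
      rw [← Real.rpow_mul (norm_nonneg _), mul_comm]
    have hf : MemLp (fun x => ‖W x‖ ^ (q - 1)) (ENNReal.ofReal ((n : ℝ) / 2))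
        (volume.restrict Bᶜ) := by
      refine MemLp.restrict _ ?_
      rw [← integrable_norm_rpow_iff hcq'.aestronglyMeasurable
        (by simpa using by linarith) (by simp), ENNReal.toReal_ofReal (by positivity)]
      refine hLp.congr (Eventually.of_forall fun x => ?_)
      simp only
      rw [Real.norm_of_nonneg (by positivity), e1]
    have hH := integral_mul_le_Lp_mul_Lq_of_nonneg (μ := volume.restrict Bᶜ) hpq
      (f := fun x => ‖W x‖ ^ (q - 1)) (g := fun x => ‖φ x • W x‖ ^ 2)
      (Eventually.of_forall fun x => by positivity) (Eventually.of_forall fun x => by positivity)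
      hf ((hg.memLp_of_hasCompactSupport hgc).restrict _)
    simp_rw [e1] at hH
    have e2 : ∀ x, φ x ^ 2 * ‖W x‖ ^ (q + 1) = ‖W x‖ ^ (q - 1) * ‖φ x • W x‖ ^ 2 := by
      intro x
      rw [norm_smul, mul_pow, Real.norm_eq_abs, sq_abs]
      rcases (norm_nonneg (W x)).eq_or_lt with h | h
      · rw [← h, Real.zero_rpow (by linarith)]
        simp
      · have : ‖W x‖ ^ (q + 1) = ‖W x‖ ^ (q - 1) * ‖W x‖ ^ 2 := by
          rw [← Real.rpow_natCast, ← Real.rpow_add h]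
          congr 1
          push_cast
          ring
        rw [this]
        ring
    simp_rw [e2]
    have hgr : Continuous fun x => (‖φ x • W x‖ ^ 2) ^ ((n : ℝ) / (n - 2)) :=
      hg.rpow_const fun _ => Or.inr hpq.symm.nonneg
    have hgri : Integrable fun x => (‖φ x • W x‖ ^ 2) ^ ((n : ℝ) / (n - 2)) :=
      hgr.integrable_of_hasCompactSupport
        (hgc.comp_left (g := fun s : ℝ => s ^ ((n : ℝ) / (n - 2)))
          (Real.zero_rpow hpq.symm.ne_zero))
    have hle : ∫ x in Bᶜ, (‖φ x • W x‖ ^ 2) ^ ((n : ℝ) / (n - 2))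
        ≤ ∫ x, (‖φ x • W x‖ ^ 2) ^ ((n : ℝ) / (n - 2)) :=
      setIntegral_le_integral hgri (Eventually.of_forall fun x => by positivity)
    have hexp : 1 / ((n : ℝ) / (n - 2)) = ((n : ℝ) - 2) / n := by rw [one_div_div]
    have hE : 0 ≤ ∫ x, gradSq (fun y => φ y • W y) x :=
      integral_nonneg fun x => gradSq_nonneg _ x
    have hI0 : 0 ≤ ∫ x in Bᶜ, ‖W x‖ ^ ((n : ℝ) / 2 * (q - 1)) :=
      integral_nonneg fun x => by positivity
    have hI1 : 0 ≤ ∫ x in Bᶜ, (‖φ x • W x‖ ^ 2) ^ ((n : ℝ) / (n - 2)) :=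
      integral_nonneg fun x => by positivity
    refine hH.trans ?_
    calc _ ≤ (∫ x in Bᶜ, ‖W x‖ ^ ((n : ℝ) / 2 * (q - 1))) ^ (1 / ((n : ℝ) / 2))
          * (S * ∫ x, gradSq (fun y => φ y • W y) x) := by
          refine mul_le_mul_of_nonneg_left ?_ (Real.rpow_nonneg hI0 _)
          rw [hexp]
          refine le_trans ?_ (hS _ hw hwc)
          exact Real.rpow_le_rpow hI1 hle (div_nonneg (by linarith) (by linarith))
      _ ≤ δ * ∫ x, gradSq (fun y => φ y • W y) x := by
          rw [← mul_assoc]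
          exact mul_le_mul_of_nonneg_right hM hE

end Absorption

section Cutoffs

variable {n : ℕ}

theorem exists_abs_deriv_smoothTransition_le :
    ∃ M : ℝ, (∀ t, |deriv Real.smoothTransition t| ≤ M) ∧
      ∀ t, t < 0 ∨ 1 < t → deriv Real.smoothTransition t = 0 := by
  have hz : ∀ t, t < 0 ∨ 1 < t → deriv Real.smoothTransition t = 0 := by
    rintro t (ht | ht)
    · have : Real.smoothTransition =ᶠ[𝓝 t] fun _ => 0 := by
        filter_upwards [Iio_mem_nhds ht] with s hs
        exact Real.smoothTransition.zero_of_nonpos (le_of_lt hs)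
      rw [this.deriv_eq, deriv_const]
    · have : Real.smoothTransition =ᶠ[𝓝 t] fun _ => 1 := by
        filter_upwards [Ioi_mem_nhds ht] with s hs
        exact Real.smoothTransition.one_of_one_le (le_of_lt hs)
      rw [this.deriv_eq, deriv_const]
  have hcont : Continuous (deriv Real.smoothTransition) :=
    (Real.smoothTransition.contDiff (n := 1)).continuous_deriv (by norm_num)
  obtain ⟨M, hM⟩ := (isCompact_Icc (a := (0 : ℝ)) (b := 1)).exists_bound_of_continuousOn
    hcont.continuousOn
  refine ⟨M, fun t => ?_, hz⟩
  by_cases ht : t ∈ Set.Icc (0 : ℝ) 1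
  · exact hM t ht
  · have h0 : 0 ≤ M := (norm_nonneg _).trans (hM 0 (by simp))
    rw [hz t (by
      by_contra! h
      exact ht h), abs_zero]
    exact h0

/-- Cut-off functions at scale `R` whose gradient is bounded by a multiple of `(1 + |x|²)^(-1/2)`,
uniformly in `R`. -/
theorem exists_cutoff (n : ℕ) : ∃ K : ℝ, 0 ≤ K ∧ ∀ R : ℝ, 1 ≤ R →
    ∃ ψ : EuclideanSpace ℝ (Fin n) → ℝ, ContDiff ℝ 1 ψ ∧ HasCompactSupport ψ ∧
      (∀ x, 0 ≤ ψ x) ∧ (∀ x, ψ x ≤ 1) ∧ (∀ x, ‖x‖ ≤ R → ψ x = 1) ∧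
      (∀ x, ‖x‖ < R → ∀ l, dirD l ψ x = 0) ∧ ∀ x, gradSq ψ x ≤ K * (1 + ‖x‖ ^ 2)⁻¹ := by
  obtain ⟨M, hM, hz⟩ := exists_abs_deriv_smoothTransition_le
  refine ⟨24 * M ^ 2, by positivity, fun R hR => ?_⟩
  have hR0 : 0 < R := by linarith
  have hR2 : 0 < R ^ 2 := by positivity
  set u : EuclideanSpace ℝ (Fin n) → ℝ := fun x => 2 - ‖x‖ ^ 2 / R ^ 2 with hu
  have huC : ContDiff ℝ 1 u := contDiff_const.sub ((contDiff_norm_sq ℝ).div_const _)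
  have hd : ∀ l x, dirD l u x = -(2 * x l / R ^ 2) := by
    intro l x
    have d1 : DifferentiableAt ℝ (fun y : EuclideanSpace ℝ (Fin n) => ‖y‖ ^ 2) x :=
      (contDiff_norm_sq ℝ (n := 1)).differentiable (by norm_num) x
    have h1 : HasDerivAt (fun s : ℝ => 2 - s / R ^ 2) (-(1 / R ^ 2)) (‖x‖ ^ 2) :=
      ((hasDerivAt_id' (‖x‖ ^ 2)).div_const (R ^ 2)).const_sub 2
    rw [hu, dirD_comp h1 d1 l, dirD_norm_sq_id]
    ring
  have hψd : ∀ l x, dirD l (fun y => Real.smoothTransition (u y)) x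
      = deriv Real.smoothTransition (u x) * -(2 * x l / R ^ 2) := by
    intro l x
    rw [dirD_comp (((Real.smoothTransition.contDiff (n := 1)).differentiable
      (by norm_num)) (u x)).hasDerivAt (huC.differentiable (by norm_num) x), hd]
  refine ⟨fun x => Real.smoothTransition (u x), Real.smoothTransition.contDiff.comp huC,
    HasCompactSupport.intro (isCompact_closedBall (0 : EuclideanSpace ℝ (Fin n)) (2 * R))
      fun x hx => ?_, fun x => Real.smoothTransition.nonneg _,
    fun x => Real.smoothTransition.le_one _, fun x hx => ?_, fun x hx l => ?_, fun x => ?_⟩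
  · apply Real.smoothTransition.zero_of_nonpos
    have hx' : 2 * R < ‖x‖ := by simpa using hx
    have : 2 ≤ ‖x‖ ^ 2 / R ^ 2 := by
      rw [le_div_iff₀ hR2]
      nlinarith
    simp only [hu]
    linarith
  · apply Real.smoothTransition.one_of_one_le
    have : ‖x‖ ^ 2 / R ^ 2 ≤ 1 := by
      rw [div_le_one hR2]
      gcongr
    simp only [hu]
    linarith
  · rw [hψd, hz _ (Or.inr ?_), zero_mul]
    have : ‖x‖ ^ 2 / R ^ 2 < 1 := by
      rw [div_lt_one hR2]
      gcongr
    simp only [hu]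
    linarith
  · have e : gradSq (fun y => Real.smoothTransition (u y)) x
        = deriv Real.smoothTransition (u x) ^ 2 * (4 * ‖x‖ ^ 2 / R ^ 4) := by
      simp only [gradSq, hψd, Real.norm_eq_abs, sq_abs]
      rw [← sum_coord_sq x, Finset.mul_sum, Finset.sum_div, Finset.mul_sum]
      refine Finset.sum_congr rfl fun l _ => ?_
      field_simp
      ring
    rw [e]
    by_cases ht : u x < 0 ∨ 1 < u x
    · rw [hz _ ht]
      have := one_add_norm_sq_pos x
      simp only [ne_eq, OfNat.ofNat_ne_zero, not_false_eq_true, zero_pow, zero_mul]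
      positivity
    · push Not at ht
      have h2 : ‖x‖ ^ 2 ≤ 2 * R ^ 2 := by
        have : ‖x‖ ^ 2 / R ^ 2 ≤ 2 := by simp only [hu] at ht; linarith
        rwa [div_le_iff₀ hR2] at this
      have hM2 : deriv Real.smoothTransition (u x) ^ 2 ≤ M ^ 2 := by
        rw [← sq_abs]
        have := hM (u x)
        gcongr
      have h3 : 4 * ‖x‖ ^ 2 / R ^ 4 ≤ 24 * (1 + ‖x‖ ^ 2)⁻¹ := by
        rw [← div_eq_mul_inv, div_le_div_iff₀ (by positivity) (one_add_norm_sq_pos x)]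
        have hR1 : 1 ≤ R ^ 2 := one_le_pow₀ hR
        have : 1 + ‖x‖ ^ 2 ≤ 3 * R ^ 2 := by linarith
        calc 4 * ‖x‖ ^ 2 * (1 + ‖x‖ ^ 2) ≤ 4 * (2 * R ^ 2) * (3 * R ^ 2) := by gcongr
          _ = 24 * R ^ 4 := by ring
      calc _ ≤ M ^ 2 * (24 * (1 + ‖x‖ ^ 2)⁻¹) := by gcongr
        _ = _ := by ring

/-- The slowly decaying weight `(1 + |x|²/R²)^(-b/2)`. -/
def decayWeight (n : ℕ) (b R : ℝ) (x : EuclideanSpace ℝ (Fin n)) : ℝ :=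
  (1 + ‖x‖ ^ 2 / R ^ 2) ^ (-b / 2)

theorem contDiff_one_add_norm_sq_div (R : ℝ) {r : WithTop ℕ∞} :
    ContDiff ℝ r fun x : EuclideanSpace ℝ (Fin n) => 1 + ‖x‖ ^ 2 / R ^ 2 :=
  contDiff_const.add ((contDiff_norm_sq ℝ).div_const _)

theorem contDiff_decayWeight (b R : ℝ) : ContDiff ℝ 1 (decayWeight n b R) :=
  (contDiff_one_add_norm_sq_div R).rpow_const_of_ne fun x => by positivity

theorem decayWeight_pos (b R : ℝ) (x : EuclideanSpace ℝ (Fin n)) : 0 < decayWeight n b R x := by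
  unfold decayWeight
  positivity

theorem decayWeight_le_one {b : ℝ} (hb : 0 ≤ b) (R : ℝ) (x : EuclideanSpace ℝ (Fin n)) :
    decayWeight n b R x ≤ 1 :=
  Real.rpow_le_one_of_one_le_of_nonpos (by
    have : 0 ≤ ‖x‖ ^ 2 / R ^ 2 := by positivity
    linarith) (by linarith)

theorem le_decayWeight {b R : ℝ} (hb : 0 ≤ b) (hR : 0 < R) {x : EuclideanSpace ℝ (Fin n)}
    (hx : ‖x‖ ≤ R) : 2 ^ (-b / 2) ≤ decayWeight n b R x := by
  refine Real.rpow_le_rpow_of_nonpos (by positivity) ?_ (by linarith)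
  have : ‖x‖ ^ 2 / R ^ 2 ≤ 1 := by
    rw [div_le_one (by positivity)]
    gcongr
  linarith

theorem decayWeight_sq_le {b R : ℝ} (hb : 0 ≤ b) (hR : 1 ≤ R) (x : EuclideanSpace ℝ (Fin n)) :
    decayWeight n b R x ^ 2 ≤ (R ^ 2) ^ b * (1 + ‖x‖ ^ 2) ^ (-b) := by
  have hR2 : 1 ≤ R ^ 2 := one_le_pow₀ hR
  have h1 : decayWeight n b R x ^ 2 = (1 + ‖x‖ ^ 2 / R ^ 2) ^ (-b) := by
    rw [decayWeight, ← Real.rpow_natCast, ← Real.rpow_mul (by positivity)]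
    congr 1
    push_cast
    ring
  have h2 : (R ^ 2) ^ b * (1 + ‖x‖ ^ 2) ^ (-b) = ((1 + ‖x‖ ^ 2) / R ^ 2) ^ (-b) := by
    rw [Real.div_rpow (by positivity) (by positivity), Real.rpow_neg (x := R ^ 2) (by positivity),
      div_inv_eq_mul, mul_comm]
  rw [h1, h2]
  refine Real.rpow_le_rpow_of_nonpos (by positivity) ?_ (by linarith)
  rw [add_div]
  have : 1 / R ^ 2 ≤ 1 := by
    rw [div_le_one (by positivity)]
    exact hR2
  linarith

theorem gradSq_decayWeight_le (b : ℝ) {R : ℝ} (hR : 1 ≤ R) (x : EuclideanSpace ℝ (Fin n)) :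
    gradSq (decayWeight n b R) x ≤ b ^ 2 * (decayWeight n b R x ^ 2 * (1 + ‖x‖ ^ 2)⁻¹) := by
  have hR0 : 0 < R := by linarith
  have hR2 : 1 ≤ R ^ 2 := one_le_pow₀ hR
  set s : ℝ := 1 + ‖x‖ ^ 2 / R ^ 2 with hs
  have hs0 : 0 < s := by positivity
  have hsR : s * R ^ 2 = R ^ 2 + ‖x‖ ^ 2 := by
    rw [hs]; field_simp
  have hd : ∀ l, dirD l (decayWeight n b R) x
      = -b * decayWeight n b R x * x l / (s * R ^ 2) := by
    intro l
    have d1 : DifferentiableAt ℝ (fun y : EuclideanSpace ℝ (Fin n) => ‖y‖ ^ 2) x :=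
      (contDiff_norm_sq ℝ (n := 1)).differentiable (by norm_num) x
    have h1 : HasDerivAt (fun r : ℝ => (1 + r / R ^ 2) ^ (-b / 2))
        (1 / R ^ 2 * (-b / 2) * s ^ (-b / 2 - 1)) (‖x‖ ^ 2) :=
      (((hasDerivAt_id' (‖x‖ ^ 2)).div_const (R ^ 2)).const_add 1).rpow_const (Or.inl hs0.ne')
    have h2 := dirD_comp h1 d1 l
    rw [dirD_norm_sq_id, Real.rpow_sub_one hs0.ne'] at h2
    have h3 : dirD l (decayWeight n b R) x = _ := h2
    rw [h3, show decayWeight n b R x = s ^ (-b / 2) from rfl]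
    field_simp
  clear_value s
  have e : gradSq (decayWeight n b R) x
      = b ^ 2 * (decayWeight n b R x ^ 2 * (‖x‖ ^ 2 / (s * R ^ 2) ^ 2)) := by
    simp only [gradSq, hd, Real.norm_eq_abs, sq_abs]
    rw [← sum_coord_sq x, Finset.sum_div, Finset.mul_sum, Finset.mul_sum]
    refine Finset.sum_congr rfl fun l _ => ?_
    ring
  rw [e, hsR]
  gcongr
  rw [← one_div, div_le_div_iff₀ (by positivity) (one_add_norm_sq_pos x)]
  nlinarith [sq_nonneg ‖x‖]

theorem gradSq_mul_le {f g : EuclideanSpace ℝ (Fin n) → ℝ} {x : EuclideanSpace ℝ (Fin n)}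
    (hf : DifferentiableAt ℝ f x) (hg : DifferentiableAt ℝ g x) {ε : ℝ} (hε : 0 < ε) :
    gradSq (fun y => f y * g y) x
      ≤ (1 + ε) * (gradSq f x * g x ^ 2) + (1 + ε⁻¹) * (f x ^ 2 * gradSq g x) := by
  simp only [gradSq, Real.norm_eq_abs, sq_abs]
  rw [Finset.sum_mul, Finset.mul_sum, Finset.mul_sum, Finset.mul_sum, ← Finset.sum_add_distrib]
  refine Finset.sum_le_sum fun l _ => ?_
  rw [dirD_mul hf hg]
  set a := dirD l f x * g x
  set c := f x * dirD l g x with hc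
  have h1 : 0 ≤ ε⁻¹ * (ε * a - c) ^ 2 := by positivity
  have h2 : ε⁻¹ * (ε * a - c) ^ 2 = ε * a ^ 2 - 2 * a * c + ε⁻¹ * c ^ 2 := by
    field_simp
    ring
  have h3 : dirD l f x ^ 2 * g x ^ 2 = a ^ 2 := by ring
  have h4 : f x ^ 2 * dirD l g x ^ 2 = c ^ 2 := by ring
  rw [h3, h4]
  nlinarith

theorem gradSq_pow_succ {f : EuclideanSpace ℝ (Fin n) → ℝ} {x : EuclideanSpace ℝ (Fin n)}
    (hf : DifferentiableAt ℝ f x) (j : ℕ) :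
    gradSq (fun y => f y ^ (j + 1)) x = ((j : ℝ) + 1) ^ 2 * (f x ^ (2 * j) * gradSq f x) := by
  simp only [gradSq, Real.norm_eq_abs, sq_abs]
  rw [Finset.mul_sum, Finset.mul_sum]
  refine Finset.sum_congr rfl fun l _ => ?_
  rw [dirD_comp (hasDerivAt_pow (j + 1) (f x)) hf]
  simp only [Nat.add_sub_cancel]
  push_cast
  ring

end Cutoffs

section Energy

theorem Continuous.norm_rpow {X F : Type*} [TopologicalSpace X] [NormedAddCommGroup F] {W : X → F}
    (hW : Continuous W)
    {s : ℝ} (hs : 0 ≤ s) : Continuous fun x => ‖W x‖ ^ s :=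
  hW.norm.rpow_const fun _ => Or.inr hs

variable {n : ℕ} {F : Type*} [NormedAddCommGroup F] [InnerProductSpace ℝ F]

theorem integral_gradSq_smul_le {φ : EuclideanSpace ℝ (Fin n) → ℝ}
    {W : EuclideanSpace ℝ (Fin n) → F} {q L : ℝ} (hq : 1 < q) (hW : ContDiff ℝ 2 W)
    (hL : ∀ x, |⟪W x, vecLap W x⟫| ≤ L * ‖W x‖ ^ (q + 1))
    (hφ : ContDiff ℝ 1 φ) (hc : HasCompactSupport φ) :
    ∫ x, gradSq (fun y => φ y • W y) x
      ≤ (∫ x, gradSq φ x * ‖W x‖ ^ 2) + L * ∫ x, φ x ^ 2 * ‖W x‖ ^ (q + 1) := by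
  rw [integral_gradSq_smul hφ hc hW, sub_eq_add_neg, ← integral_neg, ← integral_const_mul]
  have hc2 : HasCompactSupport fun x => φ x ^ 2 := hc.comp_left (g := fun t => t ^ 2) (by simp)
  have hi : Integrable fun x => L * (φ x ^ 2 * ‖W x‖ ^ (q + 1)) :=
    (((hφ.continuous.pow 2).mul (hW.continuous.norm_rpow (by linarith))).integrable_of_hasCompactSupport
      hc2.mul_right).const_mul _
  have hi' : Integrable fun x => -(φ x ^ 2 * ⟪W x, vecLap W x⟫) :=
    (((hφ.continuous.pow 2).mul
      (hW.continuous.inner (Continuous.vecLap hW))).integrable_of_hasCompactSupport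
        hc2.mul_right).fun_neg
  refine add_le_add_right (integral_mono hi' hi fun x => ?_) _
  have h1 := neg_abs_le ⟪W x, vecLap W x⟫
  have h2 := hL x
  have h3 : 0 ≤ φ x ^ 2 := sq_nonneg _
  show -(φ x ^ 2 * ⟪W x, vecLap W x⟫) ≤ L * (φ x ^ 2 * ‖W x‖ ^ (q + 1))
  nlinarith

theorem exists_energy_le [CompleteSpace F] (hn : 3 ≤ n) {q L : ℝ} (hq : 1 < q) (hL0 : 0 ≤ L)
    {W : EuclideanSpace ℝ (Fin n) → F} (hW : ContDiff ℝ 2 W)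
    (hL : ∀ x, |⟪W x, vecLap W x⟫| ≤ L * ‖W x‖ ^ (q + 1))
    (hLp : Integrable fun x => ‖W x‖ ^ ((n : ℝ) / 2 * (q - 1))) {η : ℝ} (hη : 0 < η) :
    ∃ C : ℝ, 0 ≤ C ∧ ∀ φ : EuclideanSpace ℝ (Fin n) → ℝ, ContDiff ℝ 1 φ → HasCompactSupport φ →
      (∀ x, 0 ≤ φ x) → (∀ x, φ x ≤ 1) →
      (1 - η) * ∫ x, gradSq (fun y => φ y • W y) x ≤ (∫ x, gradSq φ x * ‖W x‖ ^ 2) + C := by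
  obtain ⟨C, hC0, hC⟩ := exists_absorption_const hn hq (hW.of_le (by norm_num)) hLp
    (δ := η / (L + 1)) (by positivity)
  refine ⟨L * C, by positivity, fun φ hφ hc h0 h1 => ?_⟩
  have e1 := integral_gradSq_smul_le hq hW hL hφ hc
  have e2 := mul_le_mul_of_nonneg_left (hC φ hφ hc h0 h1) hL0
  have hD : 0 ≤ ∫ x, gradSq (fun y => φ y • W y) x := integral_nonneg fun x => gradSq_nonneg _ _
  have e3 : L * (η / (L + 1)) ≤ η := by
    rw [← mul_div_assoc, div_le_iff₀ (by positivity)]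
    nlinarith
  have e4 := mul_le_mul_of_nonneg_right e3 hD
  linarith

theorem pow_mul_sq_le {s t p q : ℝ} {j : ℕ} (hs0 : 0 ≤ s) (hs1 : s ≤ 1) (ht : 0 ≤ t)
    (hp0 : 0 < p) (hp : p ≤ 2) (hj : 2 ≤ (q - 1) * j) :
    s ^ (2 * j) * t ^ 2 ≤ t ^ p + (s ^ (j + 1)) ^ 2 * t ^ (q + 1) := by
  have hA : 0 ≤ t ^ p := by positivity
  have hB : 0 ≤ (s ^ (j + 1)) ^ 2 * t ^ (q + 1) := by positivity
  rcases le_or_gt t 1 with h | h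
  · have h1 : t ^ 2 ≤ t ^ p := by
      rcases ht.eq_or_lt with rfl | ht
      · simpa using hA
      · rw [← Real.rpow_natCast]
        exact Real.rpow_le_rpow_of_exponent_ge ht h (by exact_mod_cast hp)
    have h2 : s ^ (2 * j) ≤ 1 := pow_le_one₀ hs0 hs1
    nlinarith [sq_nonneg t]
  · have ht0 : 0 < t := by linarith
    have e1 : t ^ (q + 1) = t ^ (q - 1) * t ^ 2 := by
      rw [← Real.rpow_natCast, ← Real.rpow_add ht0]
      congr 1
      push_cast
      ring
    rcases le_or_gt 1 (s ^ 2 * t ^ (q - 1)) with h1 | h1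
    · have e2 : (s ^ (j + 1)) ^ 2 * t ^ (q + 1) = s ^ (2 * j) * t ^ 2 * (s ^ 2 * t ^ (q - 1)) := by
        rw [e1]; ring
      rw [e2]
      have : 0 ≤ s ^ (2 * j) * t ^ 2 := by positivity
      nlinarith
    · have h2 : (s ^ 2 * t ^ (q - 1)) ^ j ≤ 1 := pow_le_one₀ (by positivity) h1.le
      have h3 : t ^ 2 ≤ (t ^ (q - 1)) ^ j := by
        rw [← Real.rpow_natCast (t ^ (q - 1)), ← Real.rpow_mul ht0.le, ← Real.rpow_natCast t]
        exact Real.rpow_le_rpow_of_exponent_le h.le (by exact_mod_cast hj)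
      have h4 : s ^ (2 * j) * t ^ 2 ≤ 1 := by
        calc s ^ (2 * j) * t ^ 2 ≤ s ^ (2 * j) * (t ^ (q - 1)) ^ j := by gcongr
          _ = (s ^ 2 * t ^ (q - 1)) ^ j := by rw [mul_pow, ← pow_mul]
          _ ≤ 1 := h2
      have h5 : 1 ≤ t ^ p := Real.one_le_rpow h.le hp0.le
      linarith

theorem rpow_mul_sq_le {a t s p : ℝ} (ha : 0 < a) (ht : 0 ≤ t) (hp : 2 < p) :
    a ^ (-s) * t ^ 2 ≤ t ^ p + a ^ (-(s * p / (p - 2))) := by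
  have hA : 0 ≤ t ^ p := by positivity
  have hp2 : 0 < p - 2 := by linarith
  rcases ht.eq_or_lt with rfl | ht
  · have : 0 ≤ a ^ (-(s * p / (p - 2))) := by positivity
    simp only [ne_eq, OfNat.ofNat_ne_zero, not_false_eq_true, zero_pow, mul_zero]
    positivity
  rcases le_or_gt (a ^ (-s)) (t ^ (p - 2)) with h | h
  · have : t ^ p = t ^ (p - 2) * t ^ 2 := by
      rw [← Real.rpow_natCast, ← Real.rpow_add ht]
      congr 1
      push_cast
      ring
    have h2 : a ^ (-s) * t ^ 2 ≤ t ^ p := by rw [this]; gcongr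
    have : 0 ≤ a ^ (-(s * p / (p - 2))) := by positivity
    linarith
  · have h1 : t ≤ (a ^ (-s)) ^ (p - 2)⁻¹ := by
      rw [Real.le_rpow_inv_iff_of_pos ht.le (by positivity) hp2]
      exact h.le
    have h2 : a ^ (-s) * t ^ 2 ≤ a ^ (-(s * p / (p - 2))) := by
      calc a ^ (-s) * t ^ 2 ≤ a ^ (-s) * ((a ^ (-s)) ^ (p - 2)⁻¹) ^ 2 := by gcongr
        _ = _ := by
          rw [← Real.rpow_mul ha.le, ← Real.rpow_natCast, ← Real.rpow_mul ha.le,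
            ← Real.rpow_add ha]
          congr 1
          push_cast
          field_simp
          ring
    linarith

theorem exists_energy_bounded_cutoffs_of_le_two [CompleteSpace F] (hn : 3 ≤ n) {q L : ℝ}
    (hq : 1 < q) (hL0 : 0 ≤ L) {W : EuclideanSpace ℝ (Fin n) → F} (hW : ContDiff ℝ 2 W)
    (hL : ∀ x, |⟪W x, vecLap W x⟫| ≤ L * ‖W x‖ ^ (q + 1))
    (hLp : Integrable fun x => ‖W x‖ ^ ((n : ℝ) / 2 * (q - 1)))
    (hp : (n : ℝ) / 2 * (q - 1) ≤ 2) :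
    ∃ c > 0, ∃ C : ℝ, ∀ R : ℝ, 1 ≤ R → ∃ φ : EuclideanSpace ℝ (Fin n) → ℝ, ContDiff ℝ 1 φ ∧
      HasCompactSupport φ ∧ (∀ x, 0 ≤ φ x) ∧ (∀ x, φ x ≤ 1) ∧ (∀ x, ‖x‖ ≤ R → c ≤ φ x) ∧
      ∫ x, gradSq (fun y => φ y • W y) x ≤ C := by
  set p : ℝ := (n : ℝ) / 2 * (q - 1) with hpdef
  have hn' : (3 : ℝ) ≤ n := by exact_mod_cast hn
  have hp0 : 0 < p := by
    have : 0 < q - 1 := by linarith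
    positivity
  obtain ⟨K, hK0, hK⟩ := exists_cutoff n
  obtain ⟨j, hj⟩ := exists_nat_ge (2 / (q - 1))
  have hj' : 2 ≤ (q - 1) * j := by
    rw [div_le_iff₀ (by linarith)] at hj
    linarith
  set A : ℝ := ((j : ℝ) + 1) ^ 2 * K with hA
  have hA0 : 0 ≤ A := by positivity
  obtain ⟨C₁, hC₁0, hC₁⟩ := exists_energy_le hn hq hL0 hW hL hLp (η := 1 / 4) (by norm_num)
  obtain ⟨C₂, hC₂0, hC₂⟩ := exists_absorption_const hn hq (hW.of_le (by norm_num)) hLp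
    (δ := 1 / (2 * (A + 1))) (by positivity)
  refine ⟨1, one_pos, 4 * (A * ∫ x, ‖W x‖ ^ p) + 4 * (A * C₂) + 4 * C₁, fun R hR => ?_⟩
  obtain ⟨ψ, hψ, hψc, hψ0, hψ1, hψR, -, hψK⟩ := hK R hR
  have hφ : ContDiff ℝ 1 fun x => ψ x ^ (j + 1) := hψ.pow _
  have hφc : HasCompactSupport fun x => ψ x ^ (j + 1) :=
    hψc.comp_left (g := fun t => t ^ (j + 1)) (by simp)
  have hφ0 : ∀ x, 0 ≤ ψ x ^ (j + 1) := fun x => pow_nonneg (hψ0 x) _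
  have hφ1 : ∀ x, ψ x ^ (j + 1) ≤ 1 := fun x => pow_le_one₀ (hψ0 x) (hψ1 x)
  refine ⟨_, hφ, hφc, hφ0, hφ1, fun x hx => by simp [hψR x hx], ?_⟩
  have e1 := hC₁ _ hφ hφc hφ0 hφ1
  have e2 := hC₂ _ hφ hφc hφ0 hφ1
  set D := ∫ x, gradSq (fun y => ψ y ^ (j + 1) • W y) x with hD
  have hD0 : 0 ≤ D := integral_nonneg fun x => gradSq_nonneg _ _
  have hφ2c : HasCompactSupport fun x => (ψ x ^ (j + 1)) ^ 2 :=
    hφc.comp_left (g := fun t => t ^ 2) (by simp)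
  have hi : Integrable fun x => (ψ x ^ (j + 1)) ^ 2 * ‖W x‖ ^ (q + 1) :=
    ((hφ.continuous.pow 2).mul
      (hW.continuous.norm_rpow (by linarith))).integrable_of_hasCompactSupport hφ2c.mul_right
  have hi1 : Integrable fun x => gradSq (fun y => ψ y ^ (j + 1)) x * ‖W x‖ ^ 2 :=
    ((Continuous.gradSq hφ).mul (hW.continuous.norm.pow 2)).integrable_of_hasCompactSupport
      hφc.gradSq.mul_right
  have e3 : ∫ x, gradSq (fun y => ψ y ^ (j + 1)) x * ‖W x‖ ^ 2
      ≤ A * ((∫ x, ‖W x‖ ^ p) + ∫ x, (ψ x ^ (j + 1)) ^ 2 * ‖W x‖ ^ (q + 1)) := by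
    rw [← integral_add hLp hi, ← integral_const_mul]
    refine integral_mono hi1 ((hLp.add hi).const_mul A) fun x => ?_
    have h1 := pow_mul_sq_le (hψ0 x) (hψ1 x) (norm_nonneg (W x)) hp0 hp hj'
    have h2 : gradSq ψ x ≤ K := by
      refine (hψK x).trans (mul_le_of_le_one_right hK0 (inv_le_one_of_one_le₀ ?_))
      nlinarith [sq_nonneg ‖x‖]
    have h3 := hψ0 x
    calc gradSq (fun y => ψ y ^ (j + 1)) x * ‖W x‖ ^ 2
        = ((j : ℝ) + 1) ^ 2 * (ψ x ^ (2 * j) * gradSq ψ x) * ‖W x‖ ^ 2 := by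
          rw [gradSq_pow_succ (hψ.differentiable (by norm_num) x)]
      _ ≤ ((j : ℝ) + 1) ^ 2 * (ψ x ^ (2 * j) * K) * ‖W x‖ ^ 2 := by gcongr
      _ = A * (ψ x ^ (2 * j) * ‖W x‖ ^ 2) := by rw [hA]; ring
      _ ≤ _ := by gcongr
  have e4 := mul_le_mul_of_nonneg_left e2 hA0
  have e5 : A * (1 / (2 * (A + 1)) * D) ≤ D / 2 := by
    have : A * (1 / (2 * (A + 1))) ≤ 1 / 2 := by
      rw [mul_one_div, div_le_div_iff₀ (by positivity) (by norm_num)]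
      linarith
    calc A * (1 / (2 * (A + 1)) * D) = A * (1 / (2 * (A + 1))) * D := by ring
      _ ≤ 1 / 2 * D := by gcongr
      _ = D / 2 := by ring
  linarith

theorem gradSq_decayWeight_mul_le {b R N K ε : ℝ} (hb : 0 ≤ b) (hR : 1 ≤ R) (hε : 0 < ε)
    {ψ : EuclideanSpace ℝ (Fin n) → ℝ} (hψ : ContDiff ℝ 1 ψ)
    (hN : ∀ x, ‖x‖ < N → ∀ l, dirD l ψ x = 0) (hK : ∀ x, gradSq ψ x ≤ K * (1 + ‖x‖ ^ 2)⁻¹)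
    (w : F) (x : EuclideanSpace ℝ (Fin n)) :
    gradSq (fun y => decayWeight n b R y * ψ y) x * ‖w‖ ^ 2
      ≤ (1 + ε) * b ^ 2 * ((1 + ‖x‖ ^ 2)⁻¹ * ‖(decayWeight n b R x * ψ x) • w‖ ^ 2)
        + (ball (0 : EuclideanSpace ℝ (Fin n)) N)ᶜ.indicator (fun y =>
          (1 + ε⁻¹) * K * (R ^ 2) ^ b * ((1 + ‖y‖ ^ 2) ^ (-(b + 1)) * ‖w‖ ^ 2)) x := by
  have h1 := gradSq_mul_le ((contDiff_decayWeight b R).differentiable (by norm_num) x)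
    (hψ.differentiable (by norm_num) x) hε
  have hpos := one_add_norm_sq_pos x
  have h2 : gradSq (decayWeight n b R) x * ψ x ^ 2
      ≤ b ^ 2 * (decayWeight n b R x ^ 2 * (1 + ‖x‖ ^ 2)⁻¹) * ψ x ^ 2 := by
    gcongr
    exact gradSq_decayWeight_le b hR x
  have h3 : (1 + ε⁻¹) * (decayWeight n b R x ^ 2 * gradSq ψ x) * ‖w‖ ^ 2
      ≤ (ball (0 : EuclideanSpace ℝ (Fin n)) N)ᶜ.indicator (fun y =>
          (1 + ε⁻¹) * K * (R ^ 2) ^ b * ((1 + ‖y‖ ^ 2) ^ (-(b + 1)) * ‖w‖ ^ 2)) x := by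
    by_cases hx : ‖x‖ < N
    · have : gradSq ψ x = 0 := by simp [gradSq, hN x hx]
      rw [this, Set.indicator_of_notMem (by simpa using hx)]
      simp
    · rw [Set.indicator_of_mem (by simpa using hx)]
      have e : (1 + ‖x‖ ^ 2) ^ (-(b + 1)) = (1 + ‖x‖ ^ 2) ^ (-b) * (1 + ‖x‖ ^ 2)⁻¹ := by
        rw [neg_add, Real.rpow_add hpos, Real.rpow_neg_one]
      calc (1 + ε⁻¹) * (decayWeight n b R x ^ 2 * gradSq ψ x) * ‖w‖ ^ 2
          ≤ (1 + ε⁻¹) * (((R ^ 2) ^ b * (1 + ‖x‖ ^ 2) ^ (-b)) * (K * (1 + ‖x‖ ^ 2)⁻¹)) * ‖w‖ ^ 2 := by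
            gcongr
            · exact gradSq_nonneg _ _
            · exact decayWeight_sq_le hb hR x
            · exact hK x
        _ = _ := by rw [e]; ring
  have h4 : ‖(decayWeight n b R x * ψ x) • w‖ ^ 2 = decayWeight n b R x ^ 2 * ψ x ^ 2 * ‖w‖ ^ 2 := by
    rw [norm_smul, mul_pow, Real.norm_eq_abs, sq_abs, mul_pow]
  calc _ ≤ ((1 + ε) * (gradSq (decayWeight n b R) x * ψ x ^ 2)
        + (1 + ε⁻¹) * (decayWeight n b R x ^ 2 * gradSq ψ x)) * ‖w‖ ^ 2 := by gcongr
    _ ≤ ((1 + ε) * (b ^ 2 * (decayWeight n b R x ^ 2 * (1 + ‖x‖ ^ 2)⁻¹) * ψ x ^ 2)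
        + (1 + ε⁻¹) * (decayWeight n b R x ^ 2 * gradSq ψ x)) * ‖w‖ ^ 2 := by gcongr
    _ = (1 + ε) * b ^ 2 * ((1 + ‖x‖ ^ 2)⁻¹ * ‖(decayWeight n b R x * ψ x) • w‖ ^ 2)
        + (1 + ε⁻¹) * (decayWeight n b R x ^ 2 * gradSq ψ x) * ‖w‖ ^ 2 := by rw [h4]; ring
    _ ≤ _ := by gcongr

theorem exists_energy_bounded_cutoffs_of_two_lt [CompleteSpace F] (hn : 3 ≤ n) {q L : ℝ}
    (hq : 1 < q) (hL0 : 0 ≤ L) {W : EuclideanSpace ℝ (Fin n) → F} (hW : ContDiff ℝ 2 W)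
    (hL : ∀ x, |⟪W x, vecLap W x⟫| ≤ L * ‖W x‖ ^ (q + 1))
    (hLp : Integrable fun x => ‖W x‖ ^ ((n : ℝ) / 2 * (q - 1)))
    (hp : 2 < (n : ℝ) / 2 * (q - 1)) :
    ∃ c > 0, ∃ C : ℝ, ∀ R : ℝ, 1 ≤ R → ∃ φ : EuclideanSpace ℝ (Fin n) → ℝ, ContDiff ℝ 1 φ ∧
      HasCompactSupport φ ∧ (∀ x, 0 ≤ φ x) ∧ (∀ x, φ x ≤ 1) ∧ (∀ x, ‖x‖ ≤ R → c ≤ φ x) ∧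
      ∫ x, gradSq (fun y => φ y • W y) x ≤ C := by
  set p : ℝ := (n : ℝ) / 2 * (q - 1) with hpdef
  have hn' : (3 : ℝ) ≤ n := by exact_mod_cast hn
  have hp0 : 0 < p := by linarith
  set h : ℝ := ((n : ℝ) - 2) / 2 with hh
  have hh0 : 0 < h := by rw [hh]; linarith
  obtain ⟨b, hb0, hbh, hbn⟩ : ∃ b : ℝ, 0 < b ∧ b < h ∧ h - n / p < b := by
    obtain ⟨b, hb, hb'⟩ := exists_between (a₁ := max 0 (h - n / p)) (a₂ := h) (max_lt hh0 (by
      have : 0 < n / p := by positivity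
      linarith))
    exact ⟨b, (le_max_left _ _).trans_lt hb, hb', (le_max_right _ _).trans_lt hb⟩
  have hG : Integrable fun x => (1 + ‖x‖ ^ 2) ^ (-(b + 1)) * ‖W x‖ ^ 2 := by
    have hr : (Module.finrank ℝ (EuclideanSpace ℝ (Fin n)) : ℝ) < 2 * ((b + 1) * p / (p - 2)) := by
      rw [finrank_euclideanSpace_fin, ← mul_div_assoc, lt_div_iff₀ (by linarith)]
      have h1 : (h - n / p) * p < b * p := by gcongr
      rw [sub_mul, div_mul_cancel₀ _ hp0.ne', hh] at h1
      linarith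
    have h1 := integrable_rpow_neg_one_add_norm_sq (μ := volume) hr
    refine (hLp.add h1).mono' ?_ (Eventually.of_forall fun x => ?_)
    · refine Continuous.aestronglyMeasurable (Continuous.mul ?_ (hW.continuous.norm.pow 2))
      exact (contDiff_one_add_norm_sq (r := 0)).continuous.rpow_const
        fun x => Or.inl (one_add_norm_sq_pos x).ne'
    · have := rpow_mul_sq_le (s := b + 1) (one_add_norm_sq_pos x) (norm_nonneg (W x)) hp
      have hpos := one_add_norm_sq_pos x
      rw [Real.norm_of_nonneg (by positivity)]
      rwa [← mul_div_cancel_left₀ ((b + 1) * p / (p - 2)) (two_ne_zero' ℝ), ← neg_div] at this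
  obtain ⟨K, hK0, hK⟩ := exists_cutoff n
  set ε : ℝ := (h ^ 2 - b ^ 2) / (2 * b ^ 2) with hε
  have hbh2 : b ^ 2 < h ^ 2 := by gcongr
  have hε0 : 0 < ε := div_pos (by linarith) (by positivity)
  have hεb : (1 + ε) * b ^ 2 = (h ^ 2 + b ^ 2) / 2 := by
    rw [hε]; field_simp; ring
  set η : ℝ := (h ^ 2 - b ^ 2) / (4 * h ^ 2) with hη
  have hη0 : 0 < η := div_pos (by linarith) (by positivity)
  obtain ⟨C, hC0, hC⟩ := exists_energy_le hn hq hL0 hW hL hLp hη0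
  refine ⟨2 ^ (-b / 2), by positivity, (1 + C) / η, fun R hR => ?_⟩
  set c : ℝ := (1 + ε⁻¹) * K * (R ^ 2) ^ b with hc
  obtain ⟨N, hNR, hN⟩ : ∃ N : ℝ, R ≤ N ∧
      c * ∫ x in (ball (0 : EuclideanSpace ℝ (Fin n)) N)ᶜ,
        (1 + ‖x‖ ^ 2) ^ (-(b + 1)) * ‖W x‖ ^ 2 < 1 := by
    have ht := (tendsto_setIntegral_compl_ball hG).const_mul c
    rw [mul_zero] at ht
    exact ((eventually_ge_atTop R).and (ht.eventually_lt_const one_pos)).exists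
  obtain ⟨ψ, hψ, hψc, hψ0, hψ1, hψR, hψN, hψK⟩ := hK N (hR.trans hNR)
  have hφ : ContDiff ℝ 1 fun x => decayWeight n b R x * ψ x := (contDiff_decayWeight b R).mul hψ
  have hφc : HasCompactSupport fun x => decayWeight n b R x * ψ x := hψc.mul_left
  have hφ0 : ∀ x, 0 ≤ decayWeight n b R x * ψ x := fun x =>
    mul_nonneg (decayWeight_pos b R x).le (hψ0 x)
  have hφ1 : ∀ x, decayWeight n b R x * ψ x ≤ 1 := fun x =>
    mul_le_one₀ (decayWeight_le_one hb0.le R x) (hψ0 x) (hψ1 x)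
  refine ⟨_, hφ, hφc, hφ0, hφ1, fun x hx => ?_, ?_⟩
  · rw [hψR x (hx.trans hNR), mul_one]
    exact le_decayWeight hb0.le (by linarith) hx
  have hw : ContDiff ℝ 1 fun x => (decayWeight n b R x * ψ x) • W x :=
    hφ.smul (hW.of_le (by norm_num))
  have hwc : HasCompactSupport fun x => (decayWeight n b R x * ψ x) • W x := hφc.smul_right
  have e1 := hC _ hφ hφc hφ0 hφ1
  have e2 := hardy_inequality (by omega) hw hwc
  set D := ∫ x, gradSq (fun y => (decayWeight n b R y * ψ y) • W y) x with hD
  have hi1 : Integrable fun x => gradSq (fun y => decayWeight n b R y * ψ y) x * ‖W x‖ ^ 2 :=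
    ((Continuous.gradSq hφ).mul (hW.continuous.norm.pow 2)).integrable_of_hasCompactSupport
      hφc.gradSq.mul_right
  have hi2 : Integrable fun x => (1 + ‖x‖ ^ 2)⁻¹ * ‖(decayWeight n b R x * ψ x) • W x‖ ^ 2 := by
    refine Continuous.integrable_of_hasCompactSupport ?_ ?_
    · exact ((contDiff_one_add_norm_sq (r := 0)).continuous.inv₀
        fun x => (one_add_norm_sq_pos x).ne').mul (hw.continuous.norm.pow 2)
    · exact HasCompactSupport.mul_left (hwc.comp_left (g := fun v => ‖v‖ ^ 2) (by simp))
  have hi3 : Integrable ((ball (0 : EuclideanSpace ℝ (Fin n)) N)ᶜ.indicator fun x =>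
      c * ((1 + ‖x‖ ^ 2) ^ (-(b + 1)) * ‖W x‖ ^ 2)) :=
    (hG.const_mul c).indicator measurableSet_ball.compl
  have e3 : ∫ x, gradSq (fun y => decayWeight n b R y * ψ y) x * ‖W x‖ ^ 2
      ≤ (1 + ε) * b ^ 2 * (∫ x, (1 + ‖x‖ ^ 2)⁻¹ * ‖(decayWeight n b R x * ψ x) • W x‖ ^ 2)
        + c * ∫ x in (ball (0 : EuclideanSpace ℝ (Fin n)) N)ᶜ,
          (1 + ‖x‖ ^ 2) ^ (-(b + 1)) * ‖W x‖ ^ 2 := by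
    rw [← integral_const_mul, ← integral_const_mul,
      ← integral_indicator measurableSet_ball.compl,
      ← integral_add (hi2.const_mul _) hi3]
    refine integral_mono hi1 ((hi2.const_mul _).add hi3) fun x => ?_
    exact gradSq_decayWeight_mul_le hb0.le hR hε0 hψ hψN hψK (W x) x
  set Y := ∫ x, (1 + ‖x‖ ^ 2)⁻¹ * ‖(decayWeight n b R x * ψ x) • W x‖ ^ 2 with hY
  have e4 : (1 + ε) * b ^ 2 * Y ≤ (1 - 2 * η) * D := by
    have : (1 + ε) * b ^ 2 = (1 - 2 * η) * h ^ 2 := by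
      rw [hεb, hη]; field_simp; ring
    rw [this, mul_assoc]
    refine mul_le_mul_of_nonneg_left e2 ?_
    have : 0 < (1 - 2 * η) * h ^ 2 := by rw [← this]; positivity
    exact (pos_of_mul_pos_left this (by positivity)).le
  rw [le_div_iff₀ hη0]
  linarith

/-- A solution with finite scaling-critical norm has cut-offs, bounded below on arbitrarily large
balls, for which the cut-off solution has uniformly bounded energy. -/
theorem exists_energy_bounded_cutoffs [CompleteSpace F] (hn : 3 ≤ n) {q L : ℝ}
    (hq : 1 < q) (hL0 : 0 ≤ L) {W : EuclideanSpace ℝ (Fin n) → F} (hW : ContDiff ℝ 2 W)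
    (hL : ∀ x, |⟪W x, vecLap W x⟫| ≤ L * ‖W x‖ ^ (q + 1))
    (hLp : Integrable fun x => ‖W x‖ ^ ((n : ℝ) / 2 * (q - 1))) :
    ∃ c > 0, ∃ C : ℝ, ∀ R : ℝ, 1 ≤ R → ∃ φ : EuclideanSpace ℝ (Fin n) → ℝ, ContDiff ℝ 1 φ ∧
      HasCompactSupport φ ∧ (∀ x, 0 ≤ φ x) ∧ (∀ x, φ x ≤ 1) ∧ (∀ x, ‖x‖ ≤ R → c ≤ φ x) ∧
      ∫ x, gradSq (fun y => φ y • W y) x ≤ C := by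
  rcases le_or_gt ((n : ℝ) / 2 * (q - 1)) 2 with hp | hp
  · exact exists_energy_bounded_cutoffs_of_le_two hn hq hL0 hW hL hLp hp
  · exact exists_energy_bounded_cutoffs_of_two_lt hn hq hL0 hW hL hLp hp

end Energy

section Integrability

variable {n : ℕ} {F : Type*} [NormedAddCommGroup F] [InnerProductSpace ℝ F]

theorem integrable_of_le_on_balls {g : EuclideanSpace ℝ (Fin n) → ℝ} {C : ℝ} (hg : Continuous g)
    (hg0 : ∀ x, 0 ≤ g x)
    (h : ∀ R : ℝ, 1 ≤ R → ∃ G : EuclideanSpace ℝ (Fin n) → ℝ, Integrable G ∧ (∀ x, 0 ≤ G x) ∧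
      (∀ x, ‖x‖ < R → g x ≤ G x) ∧ ∫ x, G x ≤ C) : Integrable g := by
  refine (aecover_ball (μ := volume) (x := (0 : EuclideanSpace ℝ (Fin n)))
    tendsto_id).integrable_of_integral_bounded_of_nonneg_ae C (fun R => ?_)
    (Eventually.of_forall hg0) ?_
  · exact (hg.continuousOn.integrableOn_compact (isCompact_closedBall 0 R)).mono_set
      ball_subset_closedBall
  · filter_upwards [eventually_ge_atTop 1] with R hR
    obtain ⟨G, hG, hG0, hgG, hGC⟩ := h R hR
    calc ∫ x in ball 0 (id R), g x ≤ ∫ x in ball 0 (id R), G x :=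
          setIntegral_mono_on ((hg.continuousOn.integrableOn_compact
            (isCompact_closedBall 0 R)).mono_set ball_subset_closedBall) hG.integrableOn
            measurableSet_ball fun x hx => hgG x (by simpa using hx)
      _ ≤ ∫ x, G x := setIntegral_le_integral hG (Eventually.of_forall hG0)
      _ ≤ C := hGC

theorem integral_eq_zero_of_cutoffs {g G : EuclideanSpace ℝ (Fin n) → ℝ}
    {u : ℝ → EuclideanSpace ℝ (Fin n) → ℝ} (hG : Integrable G)
    (hu : ∀ R, 1 ≤ R → Continuous (u R)) (hb : ∀ R, 1 ≤ R → ∀ x, |u R x| ≤ G x)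
    (he : ∀ R, 1 ≤ R → ∀ x, ‖x‖ < R → u R x = g x) (h0 : ∀ R, 1 ≤ R → ∫ x, u R x = 0) :
    ∫ x, g x = 0 := by
  have ht : Tendsto (fun R => ∫ x, u R x) atTop (𝓝 (∫ x, g x)) := by
    refine tendsto_integral_filter_of_dominated_convergence G ?_ ?_ hG ?_
    · filter_upwards [eventually_ge_atTop 1] with R hR
      exact (hu R hR).aestronglyMeasurable
    · filter_upwards [eventually_ge_atTop 1] with R hR
      exact Eventually.of_forall (hb R hR)
    · refine Eventually.of_forall fun x => tendsto_const_nhds.congr' ?_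
      filter_upwards [eventually_ge_atTop 1, eventually_gt_atTop ‖x‖] with R hR hx
      exact (he R hR x hx).symm
  have h0' : Tendsto (fun R => ∫ x, u R x) atTop (𝓝 0) := by
    refine tendsto_const_nhds.congr' ?_
    filter_upwards [eventually_ge_atTop 1] with R hR
    exact (h0 R hR).symm
  exact tendsto_nhds_unique ht h0'

theorem gradSq_congr {W W' : EuclideanSpace ℝ (Fin n) → F} {x : EuclideanSpace ℝ (Fin n)}
    (h : W =ᶠ[𝓝 x] W') : gradSq W x = gradSq W' x := by
  simp only [gradSq, dirD, h.fderiv_eq]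

/-- Solutions with finite scaling-critical norm have finite energy. -/
theorem integrable_energy [CompleteSpace F] (hn : 3 ≤ n) {q L : ℝ}
    (hq : 1 < q) (hL0 : 0 ≤ L) {W : EuclideanSpace ℝ (Fin n) → F} (hW : ContDiff ℝ 2 W)
    (hL : ∀ x, |⟪W x, vecLap W x⟫| ≤ L * ‖W x‖ ^ (q + 1))
    (hLp : Integrable fun x => ‖W x‖ ^ ((n : ℝ) / 2 * (q - 1))) :
    Integrable (fun x => ‖W x‖ ^ (q + 1)) ∧
      Integrable (fun x => (1 + ‖x‖ ^ 2)⁻¹ * ‖W x‖ ^ 2) ∧ Integrable (gradSq W) := by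
  have hn' : (3 : ℝ) ≤ n := by exact_mod_cast hn
  have hW1 : ContDiff ℝ 1 W := hW.of_le (by norm_num)
  have hinv : Continuous fun x : EuclideanSpace ℝ (Fin n) => (1 + ‖x‖ ^ 2)⁻¹ :=
    (contDiff_one_add_norm_sq (r := 0)).continuous.inv₀ fun x => (one_add_norm_sq_pos x).ne'
  have hinv0 : ∀ x : EuclideanSpace ℝ (Fin n), 0 ≤ (1 + ‖x‖ ^ 2)⁻¹ := fun x => by positivity
  have hpow : Continuous fun x => ‖W x‖ ^ (q + 1) := hW.continuous.norm_rpow (by linarith)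
  obtain ⟨c, hc0, C, hC⟩ := exists_energy_bounded_cutoffs hn hq hL0 hW hL hLp
  obtain ⟨C₁, -, hC₁⟩ := exists_absorption_const hn hq hW1 hLp one_pos
  have i1 : Integrable fun x => ‖W x‖ ^ (q + 1) := by
    refine integrable_of_le_on_balls (C := (c ^ 2)⁻¹ * (C₁ + C)) hpow (fun x => by positivity)
      fun R hR => ?_
    obtain ⟨φ, hφ, hφc, hφ0, hφ1, hφR, hφC⟩ := hC R hR
    have hφ2c : HasCompactSupport fun x => φ x ^ 2 := hφc.comp_left (g := fun t => t ^ 2) (by simp)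
    have hi : Integrable fun x => φ x ^ 2 * ‖W x‖ ^ (q + 1) :=
      ((hφ.continuous.pow 2).mul hpow).integrable_of_hasCompactSupport hφ2c.mul_right
    refine ⟨fun x => (c ^ 2)⁻¹ * (φ x ^ 2 * ‖W x‖ ^ (q + 1)), hi.const_mul _,
      fun x => by positivity, fun x hx => ?_, ?_⟩
    · have := hφR x hx.le
      show ‖W x‖ ^ (q + 1) ≤ (c ^ 2)⁻¹ * (φ x ^ 2 * ‖W x‖ ^ (q + 1))
      rw [← div_eq_inv_mul, le_div_iff₀ (by positivity), mul_comm]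
      gcongr
    · rw [integral_const_mul]
      have := hC₁ φ hφ hφc hφ0 hφ1
      gcongr
      linarith
  have i2 : Integrable fun x => (1 + ‖x‖ ^ 2)⁻¹ * ‖W x‖ ^ 2 := by
    refine integrable_of_le_on_balls (C := (c ^ 2)⁻¹ * (C / (((n : ℝ) - 2) / 2) ^ 2))
      (hinv.mul (hW.continuous.norm.pow 2)) (fun x => mul_nonneg (hinv0 x) (sq_nonneg _))
      fun R hR => ?_
    obtain ⟨φ, hφ, hφc, hφ0, hφ1, hφR, hφC⟩ := hC R hR
    have hw : ContDiff ℝ 1 fun x => φ x • W x := hφ.smul hW1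
    have hwc : HasCompactSupport fun x => φ x • W x := hφc.smul_right
    have hw2c : HasCompactSupport fun x => ‖φ x • W x‖ ^ 2 :=
      hwc.comp_left (g := fun v => ‖v‖ ^ 2) (by simp)
    have hi : Integrable fun x => (1 + ‖x‖ ^ 2)⁻¹ * ‖φ x • W x‖ ^ 2 :=
      (hinv.mul (hw.continuous.norm.pow 2)).integrable_of_hasCompactSupport hw2c.mul_left
    refine ⟨fun x => (c ^ 2)⁻¹ * ((1 + ‖x‖ ^ 2)⁻¹ * ‖φ x • W x‖ ^ 2), hi.const_mul _,
      fun x => ?_, fun x hx => ?_, ?_⟩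
    · have := hinv0 x
      positivity
    · have h1 := hφR x hx.le
      have h2 := hinv0 x
      show (1 + ‖x‖ ^ 2)⁻¹ * ‖W x‖ ^ 2 ≤ (c ^ 2)⁻¹ * ((1 + ‖x‖ ^ 2)⁻¹ * ‖φ x • W x‖ ^ 2)
      rw [le_inv_mul_iff₀ (by positivity), norm_smul, mul_pow, Real.norm_eq_abs, sq_abs]
      calc c ^ 2 * ((1 + ‖x‖ ^ 2)⁻¹ * ‖W x‖ ^ 2) = (1 + ‖x‖ ^ 2)⁻¹ * (c ^ 2 * ‖W x‖ ^ 2) := by ring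
        _ ≤ _ := by gcongr
    · rw [integral_const_mul]
      have h1 := hardy_inequality (by omega) hw hwc
      have h2 : 0 < (((n : ℝ) - 2) / 2) ^ 2 := by
        have : (0 : ℝ) < n - 2 := by linarith
        positivity
      gcongr
      rw [le_div_iff₀ h2, mul_comm]
      exact h1.trans hφC
  refine ⟨i1, i2, ?_⟩
  obtain ⟨K, hK0, hK⟩ := exists_cutoff n
  refine integrable_of_le_on_balls (C := K * (∫ x, (1 + ‖x‖ ^ 2)⁻¹ * ‖W x‖ ^ 2)
    + L * ∫ x, ‖W x‖ ^ (q + 1)) (Continuous.gradSq hW1) (gradSq_nonneg W) fun R hR => ?_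
  obtain ⟨ψ, hψ, hψc, hψ0, hψ1, hψR, -, hψK⟩ := hK R hR
  have hw : ContDiff ℝ 1 fun x => ψ x • W x := hψ.smul hW1
  have hwc : HasCompactSupport fun x => ψ x • W x := hψc.smul_right
  have hψ2c : HasCompactSupport fun x => ψ x ^ 2 := hψc.comp_left (g := fun t => t ^ 2) (by simp)
  refine ⟨_, (Continuous.gradSq hw).integrable_of_hasCompactSupport hwc.gradSq, gradSq_nonneg _,
    fun x hx => ?_, (integral_gradSq_smul_le hq hW hL hψ hψc).trans (add_le_add ?_ ?_)⟩
  · refine (gradSq_congr ?_).le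
    have : ball (0 : EuclideanSpace ℝ (Fin n)) R ∈ 𝓝 x := isOpen_ball.mem_nhds (by simpa using hx)
    filter_upwards [this] with y hy
    rw [hψR y (by simpa using (mem_ball_zero_iff.1 hy).le), one_smul]
  · rw [← integral_const_mul]
    refine integral_mono (((Continuous.gradSq hψ).mul
      (hW.continuous.norm.pow 2)).integrable_of_hasCompactSupport hψc.gradSq.mul_right)
      (i2.const_mul K) fun x => ?_
    show gradSq ψ x * ‖W x‖ ^ 2 ≤ K * ((1 + ‖x‖ ^ 2)⁻¹ * ‖W x‖ ^ 2)
    rw [← mul_assoc]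
    gcongr
    exact hψK x
  · refine mul_le_mul_of_nonneg_left ?_ hL0
    refine integral_mono (((hψ.continuous.pow 2).mul hpow).integrable_of_hasCompactSupport
      hψ2c.mul_right) i1 fun x => ?_
    exact mul_le_of_le_one_left (by positivity) (pow_le_one₀ (hψ0 x) (hψ1 x))

theorem integral_gradSq_add_inner_eq_zero {L : ℝ} {g : EuclideanSpace ℝ (Fin n) → ℝ}
    {W : EuclideanSpace ℝ (Fin n) → F} (hW : ContDiff ℝ 2 W)
    (hL : ∀ x, |⟪W x, vecLap W x⟫| ≤ L * g x) (hg : Integrable g)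
    (hH : Integrable fun x => (1 + ‖x‖ ^ 2)⁻¹ * ‖W x‖ ^ 2) (hE : Integrable (gradSq W)) :
    ∫ x, (gradSq W x + ⟪W x, vecLap W x⟫) = 0 := by
  obtain ⟨K, hK0, hK⟩ := exists_cutoff n
  choose! ψ hψ using hK
  have hW1 : ContDiff ℝ 1 W := hW.of_le (by norm_num)
  refine integral_eq_zero_of_cutoffs
    (u := fun R x => ψ R x * (gradSq W x + ⟪W x, vecLap W x⟫)
      + ∑ l, dirD l (ψ R) x * ⟪W x, dirD l W x⟫)
    (G := fun x => (gradSq W x + L * g x) + (K * ((1 + ‖x‖ ^ 2)⁻¹ * ‖W x‖ ^ 2) + gradSq W x))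
    ((hE.add (hg.const_mul L)).add ((hH.const_mul K).add hE)) (fun R hR => ?_)
    (fun R hR x => ?_) (fun R hR x hx => ?_) fun R hR => ?_
  · refine ((hψ R hR).1.continuous.mul ((Continuous.gradSq hW1).add
      (hW.continuous.inner (Continuous.vecLap hW)))).add (continuous_finsetSum _ fun l _ => ?_)
    exact ((hψ R hR).1.dirD (r := 0) (by simp) l).continuous.mul
      (hW.continuous.inner (hW1.dirD (r := 0) (by simp) l).continuous)
  · obtain ⟨-, -, h0, h1, -, -, h2⟩ := hψ R hR
    refine (abs_add_le _ _).trans (add_le_add ?_ ?_)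
    · rw [abs_mul, abs_of_nonneg (h0 x)]
      refine (mul_le_of_le_one_left (abs_nonneg _) (h1 x)).trans ((abs_add_le _ _).trans ?_)
      rw [abs_of_nonneg (gradSq_nonneg W x)]
      exact add_le_add_right (hL x) _
    · have h3 : gradSq (ψ R) x * ‖W x‖ ^ 2 ≤ K * ((1 + ‖x‖ ^ 2)⁻¹ * ‖W x‖ ^ 2) := by
        rw [← mul_assoc]
        gcongr
        exact h2 x
      refine le_trans ?_ (add_le_add_left h3 _)
      simp only [gradSq, Finset.sum_mul]
      rw [← Finset.sum_add_distrib]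
      refine (Finset.abs_sum_le_sum_abs _ _).trans (Finset.sum_le_sum fun l _ => ?_)
      rw [abs_mul, Real.norm_eq_abs]
      have h4 := abs_real_inner_le_norm (W x) (dirD l W x)
      calc |dirD l (ψ R) x| * |⟪W x, dirD l W x⟫|
          ≤ |dirD l (ψ R) x| * (‖W x‖ * ‖dirD l W x‖) := by gcongr
        _ ≤ _ := by
          nlinarith [sq_nonneg (|dirD l (ψ R) x| * ‖W x‖ - ‖dirD l W x‖),
            sq_nonneg (|dirD l (ψ R) x| * ‖W x‖), sq_nonneg ‖dirD l W x‖]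
  · obtain ⟨-, -, -, -, h1, h2, -⟩ := hψ R hR
    simp [h1 x hx.le, h2 x hx]
  · exact integral_nehari (hψ R hR).1 (hψ R hR).2.1 hW

theorem integral_pohozaev_eq_zero {M : ℝ} {g H : EuclideanSpace ℝ (Fin n) → ℝ}
    {W : EuclideanSpace ℝ (Fin n) → F} (hW : ContDiff ℝ 2 W) (hH : ContDiff ℝ 1 H)
    (hHW : ∀ l x, dirD l H x = ⟪vecLap W x, dirD l W x⟫) (hM : ∀ x, |H x| ≤ M * g x)
    (hg : Integrable g) (hE : Integrable (gradSq W)) :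
    ∫ x, ((1 - n / 2) * gradSq W x - n * H x) = 0 := by
  obtain ⟨K, hK0, hK⟩ := exists_cutoff n
  choose! ψ hψ using hK
  have hW1 : ContDiff ℝ 1 W := hW.of_le (by norm_num)
  refine integral_eq_zero_of_cutoffs
    (u := fun R x => ψ R x * ((1 - n / 2) * gradSq W x - n * H x)
      + ∑ l, dirD l (ψ R) x * (∑ k, x k * ⟪dirD k W x, dirD l W x⟫
          - x l * (gradSq W x / 2 + H x)))
    (G := fun x => (|1 - (n : ℝ) / 2| * gradSq W x + n * (M * g x))
      + n * (√K * ((n + 1 / 2) * gradSq W x + M * g x)))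
    (((hE.const_mul _).add ((hg.const_mul M).const_mul _)).add
      ((((hE.const_mul _).add (hg.const_mul M)).const_mul _).const_mul _)) (fun R hR => ?_)
    (fun R hR x => ?_) (fun R hR x hx => ?_) fun R hR => ?_
  · have hc := Continuous.gradSq hW1
    have hd := fun l => (hW1.dirD (r := 0) (by simp) l).continuous
    refine ((hψ R hR).1.continuous.mul ((continuous_const.mul hc).sub
      (continuous_const.mul hH.continuous))).add (continuous_finsetSum _ fun l _ => ?_)
    refine ((hψ R hR).1.dirD (r := 0) (by simp) l).continuous.mul (Continuous.sub
      (continuous_finsetSum _ fun k _ => ?_) ?_)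
    · exact (contDiff_coord (r := 0) k).continuous.mul ((hd k).inner (hd l))
    · exact (contDiff_coord (r := 0) l).continuous.mul ((hc.div_const 2).add hH.continuous)
  · obtain ⟨-, -, h0, h1, -, -, h2⟩ := hψ R hR
    have hE0 := gradSq_nonneg W x
    refine (abs_add_le _ _).trans (add_le_add ?_ ?_)
    · rw [abs_mul, abs_of_nonneg (h0 x)]
      refine (mul_le_of_le_one_left (abs_nonneg _) (h1 x)).trans ((abs_sub _ _).trans ?_)
      rw [abs_mul, abs_mul, abs_of_nonneg hE0, Nat.abs_cast]
      gcongr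
      exact hM x
    · have hx : ∀ l k, |dirD l (ψ R) x| * |x k| ≤ √K := by
        intro l k
        apply Real.le_sqrt_of_sq_le
        have e1 : |dirD l (ψ R) x| ^ 2 ≤ gradSq (ψ R) x := by
          rw [← Real.norm_eq_abs]
          exact Finset.single_le_sum (f := fun l => ‖dirD l (ψ R) x‖ ^ 2)
            (fun _ _ => sq_nonneg _) (Finset.mem_univ l)
        have e2 : |x k| ^ 2 ≤ 1 + ‖x‖ ^ 2 := by
          have := PiLp.norm_apply_le x k
          rw [Real.norm_eq_abs] at this
          nlinarith [abs_nonneg (x k)]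
        calc (|dirD l (ψ R) x| * |x k|) ^ 2 = |dirD l (ψ R) x| ^ 2 * |x k| ^ 2 := by ring
          _ ≤ (K * (1 + ‖x‖ ^ 2)⁻¹) * (1 + ‖x‖ ^ 2) := by
            have := one_add_norm_sq_pos x
            gcongr
            exact e1.trans (h2 x)
          _ = K := by
            have := one_add_norm_sq_pos x
            field_simp
      have hd : ∀ l, ‖dirD l W x‖ ^ 2 ≤ gradSq W x := fun l =>
        Finset.single_le_sum (f := fun l => ‖dirD l W x‖ ^ 2)
          (fun _ _ => sq_nonneg _) (Finset.mem_univ l)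
      refine (Finset.abs_sum_le_sum_abs _ _).trans ((Finset.sum_le_card_nsmul _ _
        (√K * ((n + 1 / 2) * gradSq W x + M * g x)) fun l _ => ?_).trans_eq (by simp))
      have e1 : |dirD l (ψ R) x * ∑ k, x k * ⟪dirD k W x, dirD l W x⟫|
          ≤ n * (√K * gradSq W x) := by
        rw [Finset.mul_sum]
        refine (Finset.abs_sum_le_sum_abs _ _).trans ((Finset.sum_le_card_nsmul _ _
          (√K * gradSq W x) fun k _ => ?_).trans_eq (by simp))
        rw [← mul_assoc, abs_mul, abs_mul]
        refine mul_le_mul (hx l k) ?_ (abs_nonneg _) (Real.sqrt_nonneg _)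
        refine (abs_real_inner_le_norm _ _).trans ?_
        nlinarith [hd l, hd k, sq_nonneg (‖dirD k W x‖ - ‖dirD l W x‖)]
      have e2 : |dirD l (ψ R) x * (x l * (gradSq W x / 2 + H x))|
          ≤ √K * (gradSq W x / 2 + M * g x) := by
        rw [← mul_assoc, abs_mul, abs_mul]
        refine mul_le_mul (hx l l) ((abs_add_le _ _).trans (add_le_add ?_ (hM x))) (abs_nonneg _)
          (Real.sqrt_nonneg _)
        rw [abs_of_nonneg (by positivity)]
      rw [mul_sub]
      refine (abs_sub _ _).trans ((add_le_add e1 e2).trans_eq ?_)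
      ring
  · obtain ⟨-, -, -, -, h1, h2, -⟩ := hψ R hR
    simp [h1 x hx.le, h2 x hx]
  · exact integral_pohozaev (hψ R hR).1 (hψ R hR).2.1 hW hH hHW

/-- A Liouville theorem for the variational system `ΔW = ∇Q(W)`. -/
theorem eq_zero_of_vecLap_eq_gradient [CompleteSpace F] (hn : 3 ≤ n) {q M : ℝ} (hq : 1 < q)
    (hq' : q ≠ ((n : ℝ) + 2) / ((n : ℝ) - 2)) {Q : F → ℝ} (hQ : ContDiff ℝ 1 Q)
    (hQe : ∀ v, fderiv ℝ Q v v = (q + 1) * Q v) (hM : ∀ v, |Q v| ≤ M * ‖v‖ ^ (q + 1))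
    {W : EuclideanSpace ℝ (Fin n) → F} (hW : ContDiff ℝ 2 W)
    (hsol : ∀ x y, ⟪vecLap W x, y⟫ = fderiv ℝ Q (W x) y)
    (hLp : Integrable fun x => ‖W x‖ ^ ((n : ℝ) / 2 * (q - 1))) (x : EuclideanSpace ℝ (Fin n)) :
    W x = 0 := by
  have hn' : (3 : ℝ) ≤ n := by exact_mod_cast hn
  have hW1 : ContDiff ℝ 1 W := hW.of_le (by norm_num)
  have hin : ∀ x, ⟪W x, vecLap W x⟫ = (q + 1) * Q (W x) := fun x => by
    rw [real_inner_comm, hsol, hQe]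
  have hL : ∀ x, |⟪W x, vecLap W x⟫| ≤ (q + 1) * |M| * ‖W x‖ ^ (q + 1) := fun x => by
    have h1 : 0 ≤ ‖W x‖ ^ (q + 1) := by positivity
    rw [hin, abs_mul, abs_of_pos (by linarith), mul_assoc]
    exact mul_le_mul_of_nonneg_left
      ((hM _).trans (mul_le_mul_of_nonneg_right (le_abs_self M) h1)) (by linarith)
  obtain ⟨i1, i2, i3⟩ := integrable_energy hn hq
    (mul_nonneg (by linarith) (abs_nonneg M)) hW hL hLp
  have hHW : ∀ l x, dirD l (fun y => Q (W y)) x = ⟪vecLap W x, dirD l W x⟫ := fun l x => by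
    rw [hsol]
    exact dirD_comp_fderiv (hQ.differentiable (by norm_num) _) (hW.differentiable (by norm_num) _) l
  have hQW : Integrable fun x => Q (W x) :=
    (i1.const_mul M).mono' (hQ.continuous.comp hW.continuous).aestronglyMeasurable
      (Eventually.of_forall fun x => hM _)
  have e1 := integral_gradSq_add_inner_eq_zero hW hL i1 i2 i3
  have e2 := integral_pohozaev_eq_zero (H := fun x => Q (W x)) hW (hQ.comp hW1) hHW (fun x => hM (W x)) i1 i3
  simp_rw [hin] at e1
  rw [integral_add i3 (hQW.const_mul _), integral_const_mul] at e1
  rw [integral_sub (i3.const_mul _) (hQW.const_mul _), integral_const_mul, integral_const_mul] at e2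
  have hQ0 : ∫ x, Q (W x) = 0 := by
    have h1 : ((n - 2) * q - (n + 2)) * ∫ x, Q (W x) = 0 := by
      have h2 : ∫ x, gradSq W x = -((q + 1) * ∫ x, Q (W x)) := by linarith
      rw [h2] at e2
      linarith
    refine (mul_eq_zero.1 h1).resolve_left fun h => hq' ?_
    rw [eq_div_iff (by linarith)]
    linarith
  have hE : ∫ x, gradSq W x = 0 := by rw [hQ0] at e1; linarith
  have hz : gradSq W = 0 := by
    rw [integral_eq_zero_iff_of_nonneg (gradSq_nonneg W) i3] at hE
    exact (Continuous.gradSq hW1).ae_eq_iff_eq volume continuous_const |>.1 hE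
  have hf : ∀ x, fderiv ℝ W x = 0 := fun x => by
    have := norm_fderiv_sq_le_gradSq W x
    rw [hz] at this
    have h0 : ‖fderiv ℝ W x‖ ^ 2 = 0 := le_antisymm this (sq_nonneg _)
    simpa using h0
  have hconst : ∀ y, W y = W x := fun y =>
    is_const_of_fderiv_eq_zero (hW.differentiable (by norm_num)) hf y x
  simp_rw [hconst] at hLp
  have : Nonempty (Fin n) := ⟨⟨0, by omega⟩⟩
  rcases integrable_const_iff.1 hLp with h | h
  · by_contra hx
    have : 0 < ‖W x‖ := norm_pos_iff.2 hx
    exact absurd h (by positivity)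
  · exact absurd h.measure_univ_lt_top (by simp)

end Integrability

section Reduction

open scoped MatrixOrder Matrix.Norms.L2Operator in
theorem Matrix.PosDef.exists_continuousLinearEquiv {m : ℕ} {A : Matrix (Fin m) (Fin m) ℝ}
    (hA : A.PosDef) :
    ∃ T : EuclideanSpace ℝ (Fin m) ≃L[ℝ] EuclideanSpace ℝ (Fin m),
      ∀ u v, ⟪T u, T v⟫ = ∑ i, v i * ∑ j, A i j * u j := by
  obtain ⟨B, hB⟩ := CStarAlgebra.nonneg_iff_eq_star_mul_self.mp hA.posSemidef.nonneg
  have h : ∀ u v, ⟪Matrix.toEuclideanLin B u, Matrix.toEuclideanLin B v⟫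
      = ∑ i, v i * ∑ j, A i j * u j := by
    intro u v
    have e : v.ofLp ⬝ᵥ (A.mulVec u.ofLp) = ∑ i, v i * ∑ j, A i j * u j := rfl
    rw [← e, hB, ← Matrix.mulVec_mulVec, Matrix.dotProduct_mulVec, Matrix.star_eq_conjTranspose,
      Matrix.vecMul_conjTranspose, EuclideanSpace.inner_eq_star_dotProduct, dotProduct_comm]
    simp [dotProduct_comm]
  have hinj : Function.Injective (Matrix.toEuclideanLin B) := by
    rw [injective_iff_map_eq_zero]
    intro u hu
    by_contra hu0
    have h1 := h u u
    rw [hu, inner_zero_left] at h1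
    have h2 := hA.dotProduct_mulVec_pos (x := u.ofLp) (by simpa using hu0)
    exact h2.ne h1
  exact ⟨(LinearEquiv.ofInjectiveEndo _ hinj).toContinuousLinearEquiv, h⟩

theorem fderiv_apply_self_of_homogeneous {F : Type*} [NormedAddCommGroup F] [NormedSpace ℝ F]
    {Q : F → ℝ} {s : ℝ} (hQ : Differentiable ℝ Q)
    (hhom : ∀ t : ℝ, 0 < t → ∀ v, Q (t • v) = t ^ s * Q v) (v : F) :
    fderiv ℝ Q v v = s * Q v := by
  have h1 : HasDerivAt (fun t : ℝ => Q (t • v)) (fderiv ℝ Q v v) 1 := by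
    have h2 : HasDerivAt (fun t : ℝ => t • v) v 1 := by
      simpa using (hasDerivAt_id' (1 : ℝ)).smul_const v
    have h3 : HasFDerivAt Q (fderiv ℝ Q v) ((1 : ℝ) • v) := by
      rw [one_smul]
      exact (hQ v).hasFDerivAt
    exact h3.comp_hasDerivAt 1 h2
  have h4 : HasDerivAt (fun t : ℝ => t ^ s * Q v) (s * Q v) 1 := by
    simpa using (Real.hasDerivAt_rpow_const (p := s) (Or.inl (one_ne_zero' ℝ))).mul_const (Q v)
  refine h1.unique (h4.congr_of_eventuallyEq ?_)
  filter_upwards [Ioi_mem_nhds (zero_lt_one' ℝ)] with t ht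
  exact hhom t ht v

theorem exists_abs_le_of_homogeneous {F : Type*} [NormedAddCommGroup F] [NormedSpace ℝ F]
    [ProperSpace F] {Q : F → ℝ} {s : ℝ} (hs : 0 < s) (hQ : Continuous Q)
    (hhom : ∀ t : ℝ, 0 < t → ∀ v, Q (t • v) = t ^ s * Q v) :
    ∃ M : ℝ, ∀ v, |Q v| ≤ M * ‖v‖ ^ s := by
  obtain ⟨M, hM⟩ := (isCompact_sphere (0 : F) 1).exists_bound_of_continuousOn hQ.continuousOn
  refine ⟨M, fun v => ?_⟩
  rcases eq_or_ne v 0 with rfl | hv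
  · have h1 := hhom 2 two_pos 0
    have h2 : (1 : ℝ) < 2 ^ s := Real.one_lt_rpow one_lt_two hs
    rw [smul_zero] at h1
    have h3 : Q 0 = 0 := by
      have : (2 ^ s - 1) * Q 0 = 0 := by linarith
      exact (mul_eq_zero.1 this).resolve_left (by linarith)
    simp [h3, Real.zero_rpow hs.ne']
  · have hv0 : 0 < ‖v‖ := norm_pos_iff.2 hv
    have h1 := hhom ‖v‖ hv0 (‖v‖⁻¹ • v)
    rw [smul_smul, mul_inv_cancel₀ hv0.ne', one_smul] at h1
    have h2 := hM (‖v‖⁻¹ • v) (by simp [norm_smul, hv0.ne'])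
    rw [Real.norm_eq_abs] at h2
    rw [h1, abs_mul, abs_of_nonneg (by positivity), mul_comm]
    gcongr

theorem vecLap_clm_comp {n : ℕ} {F G : Type*} [NormedAddCommGroup F] [InnerProductSpace ℝ F]
    [NormedAddCommGroup G] [InnerProductSpace ℝ G] (T : F →L[ℝ] G)
    {W : EuclideanSpace ℝ (Fin n) → F} (hW : ContDiff ℝ 2 W) (x : EuclideanSpace ℝ (Fin n)) :
    vecLap (fun y => T (W y)) x = T (vecLap W x) := by
  have h : ∀ (U : EuclideanSpace ℝ (Fin n) → F), Differentiable ℝ U → ∀ l,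
      dirD l (fun y => T (U y)) = fun y => T (dirD l U y) := fun U hU l => by
    funext y
    have := (T.hasFDerivAt.comp y (hU y).hasFDerivAt).fderiv
    simp only [dirD]
    rw [show (fun y => T (U y)) = T ∘ U from rfl, this]
    rfl
  simp only [vecLap, map_sum]
  refine Finset.sum_congr rfl fun l _ => ?_
  rw [h W (hW.differentiable (by norm_num)),
    h _ ((hW.dirD (r := 1) (by norm_num) l).differentiable (by norm_num))]

theorem vecLap_apply {n m : ℕ} {V : EuclideanSpace ℝ (Fin n) → EuclideanSpace ℝ (Fin m)}
    (hV : ContDiff ℝ 2 V) (x : EuclideanSpace ℝ (Fin n)) (j : Fin m) :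
    vecLap V x j = lap (fun y => V y j) x := by
  rw [show vecLap V x j = (EuclideanSpace.proj j : EuclideanSpace ℝ (Fin m) →L[ℝ] ℝ) (vecLap V x)
    from rfl, ← vecLap_clm_comp _ hV]
  rfl

end Reduction

/-- **Theorem 2 (uniqueness of entire solutions).** Let `q > (n+2)/n`, `q ≠ (n+2)/(n-2)`,
`p = (n/2)(q-1)`, `P` a `C²` function positively homogeneous of degree `q+1`, and
`fⁱ = ∂P/∂Vᵢ`. Any smooth solution `V ∈ Lᵖ(ℝⁿ)` of `∑ⱼ Aᵢⱼ ΔVⱼ = fⁱ(V)` on `ℝⁿ`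
is identically zero. -/
theorem entire_uniqueness
    (n m : ℕ) (hn : 3 ≤ n) (hm : 1 ≤ m)
    (A : Matrix (Fin m) (Fin m) ℝ) (hA : A.PosDef) (hAsymm : A.IsSymm)
    (q p : ℝ) (hq : ((n : ℝ) + 2) / n < q) (hq' : q ≠ ((n : ℝ) + 2) / ((n : ℝ) - 2))
    (hp : p = ((n : ℝ) / 2) * (q - 1))
    (P : EuclideanSpace ℝ (Fin m) → ℝ) (hP : ContDiff ℝ 2 P)
    (hhom : ∀ t : ℝ, 0 < t → ∀ v : EuclideanSpace ℝ (Fin m), P (t • v) = t ^ (q + 1) * P v)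
    (V : EuclideanSpace ℝ (Fin n) → EuclideanSpace ℝ (Fin m))
    (hV : ContDiff ℝ (⊤ : ℕ∞) V)
    (hsol : ∀ x : EuclideanSpace ℝ (Fin n), ∀ i,
      ∑ j, A i j * lap (fun y => V y j) x = fderiv ℝ P (V x) (EuclideanSpace.single i 1))
    (hLp : Integrable (fun x : EuclideanSpace ℝ (Fin n) => ‖V x‖ ^ p)) :
    ∀ x, V x = 0 := by
  have hn' : (3 : ℝ) ≤ n := by exact_mod_cast hn
  have hq1 : 1 < q := by
    refine lt_trans ?_ hq
    rw [lt_div_iff₀ (by linarith)]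
    linarith
  have hV2 : ContDiff ℝ 2 V := contDiff_infty.mp hV 2
  obtain ⟨T, hT⟩ := hA.exists_continuousLinearEquiv
  have hQ : ContDiff ℝ 2 fun w => P (T.symm w) := hP.comp T.symm.contDiff
  have hQhom : ∀ t : ℝ, 0 < t → ∀ w, P (T.symm (t • w)) = t ^ (q + 1) * P (T.symm w) :=
    fun t ht w => by rw [map_smul, hhom t ht]
  obtain ⟨M, hM⟩ := exists_abs_le_of_homogeneous (by linarith) hQ.continuous hQhom
  have hW : ContDiff ℝ 2 fun x => T (V x) := T.contDiff.comp hV2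
  have hWsol : ∀ x y, ⟪vecLap (fun x => T (V x)) x, y⟫
      = fderiv ℝ (fun w => P (T.symm w)) (T (V x)) y := by
    intro x y
    have h1 : fderiv ℝ (fun w => P (T.symm w)) (T (V x)) y = fderiv ℝ P (V x) (T.symm y) := by
      have := ((hP.differentiable (by norm_num) (T.symm (T (V x)))).hasFDerivAt.comp (T (V x))
        T.symm.hasFDerivAt).fderiv
      rw [show (fun w => P (T.symm w)) = P ∘ T.symm from rfl, this]
      simp
    have h2 : vecLap (fun x => T (V x)) x = T (vecLap V x) :=
      vecLap_clm_comp (T : EuclideanSpace ℝ (Fin m) →L[ℝ] EuclideanSpace ℝ (Fin m)) hV2 x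
    obtain ⟨z, rfl⟩ := T.surjective y
    rw [h1, h2, hT, T.symm_apply_apply]
    simp_rw [vecLap_apply hV2, hsol]
    conv_rhs => rw [← (EuclideanSpace.basisFun (Fin m) ℝ).sum_repr z, map_sum]
    simp
  have hWp : Integrable fun x => ‖T (V x)‖ ^ ((n : ℝ) / 2 * (q - 1)) := by
    rw [← hp]
    have hp0 : 0 ≤ p := by
      rw [hp]
      exact mul_nonneg (by positivity) (by linarith)
    refine (hLp.const_mul (‖(T : EuclideanSpace ℝ (Fin m) →L[ℝ] EuclideanSpace ℝ (Fin m))‖ ^ p)).mono'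
      (hW.continuous.norm_rpow hp0).aestronglyMeasurable (Eventually.of_forall fun x => ?_)
    rw [Real.norm_of_nonneg (by positivity), ← Real.mul_rpow (norm_nonneg _) (norm_nonneg _)]
    exact Real.rpow_le_rpow (norm_nonneg _)
      ((T : EuclideanSpace ℝ (Fin m) →L[ℝ] EuclideanSpace ℝ (Fin m)).le_opNorm _) hp0
  intro x
  have h := eq_zero_of_vecLap_eq_gradient hn hq1 hq' (hQ.of_le (by norm_num))
    (fderiv_apply_self_of_homogeneous (hQ.differentiable (by norm_num)) hQhom) hM hW hWsol hWp x
  simpa using h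
end
end
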